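/- Let φ₁, φ₂ ∈ Φ² satisfy the SND condition and let a ∈ S^m_{ρ,δ}(n,2) with 0 ≤ ρ, δ ≤ 1 and m < n(ρ−1)/2 + n·min(ρ−δ,0)/2. Then the bilinear FIO T_a(f,g)(x) = ∫∫ a(x,ξ,η) e^{iφ₁(x,ξ)+iφ₂(x,η)} f̂(ξ) ĝ(η) dξ dη is globally bounded from L²(ℝⁿ) × L²(ℝⁿ) to L¹(ℝⁿ): ‖T_a(f,g)‖_{L¹} ≤ C ‖f‖_{L²} ‖g‖_{L²} for all Schwartz f, g. -/

import Mathlib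

open MeasureTheory Real Complex
open scoped ENNReal NNReal RealInnerProductSpace SchwartzMap Classical

noncomputable section

/-- `ℝⁿ` as a Euclidean space. -/
abbrev En (n : ℕ) : Type := EuclideanSpace ℝ (Fin n)

/-- Partial derivative in the `i`-th coordinate direction. -/
def pd {n : ℕ} {F : Type} [NormedAddCommGroup F] [NormedSpace ℝ F]
    (i : Fin n) (f : En n → F) : En n → F :=
  fun x => fderiv ℝ f x (EuclideanSpace.single i 1)

/-- Multi-index partial derivative `∂^α`. -/
def mderiv {n : ℕ} {F : Type} [NormedAddCommGroup F] [NormedSpace ℝ F]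
    (α : Fin n → ℕ) (f : En n → F) : En n → F :=
  (List.finRange n).foldr (fun i g => (pd i)^[α i] g) f

/-- The order `|α|` of a multi-index. -/
def mdeg {n : ℕ} (α : Fin n → ℕ) : ℕ := ∑ i, α i

/-- The finite set of multi-indices `α` with every entry `≤ k` and `|α| ≤ k`;
this enumerates all multi-indices of order at most `k`. -/
def multiIdx (n k : ℕ) : Finset (Fin n → ℕ) :=
  (Fintype.piFinset fun _ : Fin n => Finset.range (k + 1)).filter fun α => mdeg α ≤ k

/-- Japanese bracket `⟨ξ⟩^t = (1+|ξ|²)^{t/2}`. -/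
def jb {n : ℕ} (ξ : En n) (t : ℝ) : ℝ := (1 + ‖ξ‖ ^ 2) ^ (t / 2)

/-- The rough amplitude class `L^p S^m_ρ`. -/
def LpSm {n : ℕ} (p : ℝ≥0∞) (m ρ : ℝ) (a : En n → En n → ℂ) : Prop :=
  (∀ x, ContDiff ℝ (⊤ : ℕ∞) (a x)) ∧
  (∀ (α : Fin n → ℕ) (ξ : En n), AEStronglyMeasurable (fun x => mderiv α (a x) ξ) volume) ∧
  ∀ α : Fin n → ℕ, ∃ C : ℝ, ∀ ξ : En n,
    eLpNorm (fun x => mderiv α (a x) ξ) p volume ≤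
      ENNReal.ofReal (C * jb ξ (m - ρ * (mdeg α : ℝ)))

/-- The seminorms `|a|_{p,m,s}` of an amplitude in `L^p S^m_ρ`. -/
def aSemi {n : ℕ} (p : ℝ≥0∞) (m ρ : ℝ) (s : ℕ) (a : En n → En n → ℂ) : ℝ≥0∞ :=
  ∑ α ∈ multiIdx n s, ⨆ ξ : En n,
    ENNReal.ofReal (jb ξ (ρ * (mdeg α : ℝ) - m)) *
      eLpNorm (fun x => mderiv α (a x) ξ) p volume

/-- The mixed derivative `∂_ξ^α ∂_x^β φ(x,ξ)`. -/
def mixedD {n : ℕ} (α β : Fin n → ℕ) (φ : En n → En n → ℝ) (x ξ : En n) : ℝ :=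
  mderiv α (fun ζ => mderiv β (fun y => φ y ζ) x) ξ

/-- The phase function class `Φ^k`. -/
def PhiClass {n : ℕ} (k : ℕ) (φ : En n → En n → ℝ) : Prop :=
  ContDiffOn ℝ (⊤ : ℕ∞) (fun q : En n × En n => φ q.1 q.2) {q | q.2 ≠ 0} ∧
  (∀ (x ξ : En n) (t : ℝ), 0 < t → φ x (t • ξ) = t * φ x ξ) ∧
  ∀ α β : Fin n → ℕ, k ≤ mdeg α + mdeg β →
    ∃ C : ℝ, ∀ (x ξ : En n), ξ ≠ 0 →
      ‖ξ‖ ^ ((mdeg α : ℝ) - 1) * |mixedD α β φ x ξ| ≤ C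

/-- The mixed Hessian matrix `[∂²φ/∂x_j∂ξ_k]`. -/
def mixHess {n : ℕ} (φ : En n → En n → ℝ) (x ξ : En n) : Matrix (Fin n) (Fin n) ℝ :=
  Matrix.of fun j k => pd j (fun y => pd k (φ y) ξ) x

/-- The strong non-degeneracy (SND) condition. -/
def SNDcond {n : ℕ} (φ : En n → En n → ℝ) : Prop :=
  ∃ c : ℝ, 0 < c ∧ ∀ (x ξ : En n), ξ ≠ 0 → c ≤ |(mixHess φ x ξ).det|

/-- The Fourier transform `f̂(ξ) = ∫ e^{-i⟨y,ξ⟩} f(y) dy`. -/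
def ft {n : ℕ} (f : En n → ℂ) (ξ : En n) : ℂ :=
  ∫ y : En n, Complex.exp (-(Complex.I * Complex.ofReal ⟪y, ξ⟫)) * f y

/-- The linear Fourier integral operator
`T_a f(x) = (2π)^{-n} ∫ e^{iφ(x,ξ)} a(x,ξ) f̂(ξ) dξ`. -/
def fio {n : ℕ} (a : En n → En n → ℂ) (φ : En n → En n → ℝ) (f : En n → ℂ)
    (x : En n) : ℂ :=
  (((2 * Real.pi) ^ n)⁻¹ : ℝ) •
    ∫ ξ : En n, Complex.exp (Complex.I * Complex.ofReal (φ x ξ)) * a x ξ * ft f ξ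

/-- The conjugate exponent `p′` of `p ∈ [1,∞]`. -/
def pconj (p : ℝ≥0∞) : ℝ≥0∞ := (1 - p⁻¹)⁻¹

/-- The order `𝔪(ρ,p,q)` from Definition 4.6. -/
def frakm (n : ℕ) (ρ : ℝ) (p q : ℝ≥0∞) : ℝ :=
  if p < 2 ∨ (2 ≤ p ∧ q < pconj p) then
    (n : ℝ) * (ρ - 1) * (min p q)⁻¹.toReal -
      (((n : ℝ) - 1) / 2) * (p⁻¹.toReal + (min p q)⁻¹.toReal)
  else if 2 ≤ q then
    (n : ℝ) * (ρ - 1) / 2 - ((n : ℝ) - 1) * (1 / 2 - q⁻¹.toReal)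
  else
    (n : ℝ) * (ρ - 1) * q⁻¹.toReal -
      (((n : ℝ) - 1) / (1 - 2 * p⁻¹.toReal)) * (q⁻¹.toReal - 1 / 2)

/-- The order `ℳ(ρ,p,q)` from Definition 4.6. -/
def scrM (n : ℕ) (ρ : ℝ) (p q : ℝ≥0∞) : ℝ :=
  (n : ℝ) * (ρ - 1) * q⁻¹.toReal -
    (((n : ℝ) - 1) / (1 + p⁻¹.toReal)) * (q⁻¹.toReal - 1 / 2)

/-- The distribution function `λ_f(s) = |{x : |f(x)| > s}|`. -/
def distFn {n : ℕ} (f : En n → ℂ) (s : ℝ) : ℝ≥0∞ := volume {x : En n | s < ‖f x‖}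

/-- The decreasing rearrangement `f*`. -/
def rearr {n : ℕ} (f : En n → ℂ) (t : ℝ) : ℝ :=
  sInf {s : ℝ | 0 ≤ s ∧ distFn f s ≤ ENNReal.ofReal t}

/-- The Lorentz space quasinorm
`‖f‖_{L^{r,q}} = (∫_0^∞ (t^{1/r} f*(t))^q dt/t)^{1/q}`. -/
def lorentzNorm {n : ℕ} (r q : ℝ≥0∞) (f : En n → ℂ) : ℝ≥0∞ :=
  (∫⁻ t in Set.Ioi (0 : ℝ),
      ENNReal.ofReal ((t ^ r⁻¹.toReal * rearr f t) ^ q.toReal / t)) ^ q⁻¹.toReal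

/-- Mixed frequency derivatives `∂_ξ^{α₁} ∂_η^{α₂} a(x,ξ,η)` of a bilinear amplitude. -/
def d2 {n : ℕ} (α₁ α₂ : Fin n → ℕ) (a : En n → En n → En n → ℂ)
    (x ξ η : En n) : ℂ :=
  mderiv α₁ (fun ζ => mderiv α₂ (fun θ => a x ζ θ) η) ξ

/-- Mixed derivatives `∂_x^β ∂_ξ^{α₁} ∂_η^{α₂} a(x,ξ,η)` of a bilinear amplitude. -/
def d3 {n : ℕ} (β α₁ α₂ : Fin n → ℕ) (a : En n → En n → En n → ℂ)
    (x ξ η : En n) : ℂ :=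
  mderiv β (fun y => d2 α₁ α₂ a y ξ η) x

/-- The bilinear product-type rough amplitude class `L^p_Π S^{(m₁,m₂)}_{(ρ₁,ρ₂)}(n,2)`. -/
def LpPiSm2 {n : ℕ} (p : ℝ≥0∞) (m₁ m₂ ρ₁ ρ₂ : ℝ) (a : En n → En n → En n → ℂ) : Prop :=
  (∀ x, ContDiff ℝ (⊤ : ℕ∞) (fun q : En n × En n => a x q.1 q.2)) ∧
  (∀ (α₁ α₂ : Fin n → ℕ) (ξ η : En n),
    AEStronglyMeasurable (fun x => d2 α₁ α₂ a x ξ η) volume) ∧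
  ∀ α₁ α₂ : Fin n → ℕ, ∃ C : ℝ, ∀ ξ η : En n,
    eLpNorm (fun x => d2 α₁ α₂ a x ξ η) p volume ≤
      ENNReal.ofReal (C * jb ξ (m₁ - ρ₁ * (mdeg α₁ : ℝ)) * jb η (m₂ - ρ₂ * (mdeg α₂ : ℝ)))

/-- The bilinear rough amplitude class `L^p S^m_ρ(n,2)`. -/
def LpSm2 {n : ℕ} (p : ℝ≥0∞) (m ρ : ℝ) (a : En n → En n → En n → ℂ) : Prop :=
  (∀ x, ContDiff ℝ (⊤ : ℕ∞) (fun q : En n × En n => a x q.1 q.2)) ∧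
  (∀ (α₁ α₂ : Fin n → ℕ) (ξ η : En n),
    AEStronglyMeasurable (fun x => d2 α₁ α₂ a x ξ η) volume) ∧
  ∀ α₁ α₂ : Fin n → ℕ, ∃ C : ℝ, ∀ ξ η : En n,
    eLpNorm (fun x => d2 α₁ α₂ a x ξ η) p volume ≤
      ENNReal.ofReal (C * (1 + ‖ξ‖ + ‖η‖) ^ (m - ρ * ((mdeg α₁ : ℝ) + (mdeg α₂ : ℝ))))

/-- The bilinear Hörmander class `S^m_{ρ,δ}(n,2)`. -/
def HormS2 {n : ℕ} (m ρ δ : ℝ) (a : En n → En n → En n → ℂ) : Prop :=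
  ContDiff ℝ (⊤ : ℕ∞) (fun q : En n × En n × En n => a q.1 q.2.1 q.2.2) ∧
  ∀ β α₁ α₂ : Fin n → ℕ, ∃ C : ℝ, ∀ x ξ η : En n,
    ‖d3 β α₁ α₂ a x ξ η‖ ≤
      C * (1 + ‖ξ‖ + ‖η‖) ^ (m - ρ * ((mdeg α₁ : ℝ) + (mdeg α₂ : ℝ)) + δ * (mdeg β : ℝ))

/-- The bilinear Fourier integral operator
`T_a(f,g)(x) = ∫∫ a(x,ξ,η) e^{iφ₁(x,ξ)+iφ₂(x,η)} f̂(ξ) ĝ(η) dξ dη`. -/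
def bfio {n : ℕ} (a : En n → En n → En n → ℂ) (φ₁ φ₂ : En n → En n → ℝ)
    (f g : En n → ℂ) (x : En n) : ℂ :=
  ∫ w : En n × En n,
    a x w.1 w.2 * Complex.exp (Complex.I * Complex.ofReal (φ₁ x w.1 + φ₂ x w.2)) *
      ft f w.1 * ft g w.2

/-- Partial derivative of a function of `N` frequency variables in the `i`-th coordinate
of the `j`-th variable. -/
def pdN {n N : ℕ} (j : Fin N) (i : Fin n) (g : (Fin N → En n) → ℂ) :
    (Fin N → En n) → ℂ :=
  fun ξ => fderiv ℝ g ξ (Pi.single j (EuclideanSpace.single i 1))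

/-- Multi-index derivative `∂_{ξ₁}^{A 1} ⋯ ∂_{ξ_N}^{A N}`. -/
def mderivN {n N : ℕ} (A : Fin N → Fin n → ℕ) (g : (Fin N → En n) → ℂ) :
    (Fin N → En n) → ℂ :=
  (List.finRange N).foldr
    (fun j h => (List.finRange n).foldr (fun i h' => (pdN j i)^[A j i] h') h) g

/-- The multilinear product-type rough amplitude class `L^p_Π S^{m⃗}_{ρ⃗}(n,N)`. -/
def LpPiSmN {n N : ℕ} (p : ℝ≥0∞) (m ρ : Fin N → ℝ)
    (a : En n → (Fin N → En n) → ℂ) : Prop :=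
  (∀ x, ContDiff ℝ (⊤ : ℕ∞) (a x)) ∧
  (∀ (A : Fin N → Fin n → ℕ) (ξ : Fin N → En n),
    AEStronglyMeasurable (fun x => mderivN A (a x) ξ) volume) ∧
  ∀ A : Fin N → Fin n → ℕ, ∃ C : ℝ, ∀ ξ : Fin N → En n,
    eLpNorm (fun x => mderivN A (a x) ξ) p volume ≤
      ENNReal.ofReal (C * ∏ j, jb (ξ j) (m j - ρ j * (mdeg (A j) : ℝ)))

/-- The multilinear rough amplitude class `L^p S^m_ρ(n,N)`. -/
def LpSmN {n N : ℕ} (p : ℝ≥0∞) (m ρ : ℝ) (a : En n → (Fin N → En n) → ℂ) : Prop :=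
  (∀ x, ContDiff ℝ (⊤ : ℕ∞) (a x)) ∧
  (∀ (A : Fin N → Fin n → ℕ) (ξ : Fin N → En n),
    AEStronglyMeasurable (fun x => mderivN A (a x) ξ) volume) ∧
  ∀ A : Fin N → Fin n → ℕ, ∃ C : ℝ, ∀ ξ : Fin N → En n,
    eLpNorm (fun x => mderivN A (a x) ξ) p volume ≤
      ENNReal.ofReal (C * (1 + ∑ j, ‖ξ j‖) ^ (m - ρ * ∑ j, (mdeg (A j) : ℝ)))

/-- The multilinear Fourier integral operator. -/
def mfio {n N : ℕ} (a : En n → (Fin N → En n) → ℂ) (φ : Fin N → En n → En n → ℝ)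
    (f : Fin N → En n → ℂ) (x : En n) : ℂ :=
  ∫ ξ : Fin N → En n,
    a x ξ * Complex.exp (Complex.I * Complex.ofReal (∑ j, φ j x (ξ j))) *
      ∏ j, ft (f j) (ξ j)

/-- The Sobolev (Bessel potential) norm `‖f‖_{H^{s,q}} = ‖ℱ^{-1}(⟨ξ⟩^s f̂)‖_{L^q}`. -/
def besselNorm {n : ℕ} (s : ℝ) (q : ℝ≥0∞) (f : En n → ℂ) : ℝ≥0∞ :=
  eLpNorm (fun x : En n =>
    (((2 * Real.pi) ^ n)⁻¹ : ℝ) •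
      ∫ ξ : En n, Complex.ofReal (jb ξ s) * ft f ξ *
        Complex.exp (Complex.I * Complex.ofReal ⟪x, ξ⟫)) q volume

section plancherel
open scoped FourierTransform

lemma plancherel_L1L2 {n : ℕ} (F : En n → ℂ) (h1 : Integrable F) (h2 : MemLp F 2 volume) :
    eLpNorm (𝓕 F) 2 volume = eLpNorm F 2 volume := by
  set f : Lp ℂ 2 (volume : Measure (En n)) := h2.toLp F with hf
  have hae : ∀ᵐ x, 𝓕 F x = (𝓕 f) x := by
    refine ae_eq_of_integral_contDiff_smul_eq ?_ ?_ ?_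
    · have hc : Continuous (𝓕 F) := by
        exact VectorFourier.fourierIntegral_continuous (e := Real.fourierChar) (μ := (volume : Measure (En n))) (L := innerₗ (En n)) Real.continuous_fourierChar (by simpa using continuous_inner) h1
      exact hc.locallyIntegrable
    · exact (Lp.memLp (𝓕 f)).locallyIntegrable (by norm_num)
    · intro g hg hg'
      have hg2 : ContDiff ℝ (⊤ : ℕ∞) (Complex.ofRealCLM ∘ g) := ContDiff.comp (Complex.ofRealCLM.contDiff (n := (⊤ : ℕ∞))) hg
      have hg3 : HasCompactSupport (Complex.ofRealCLM ∘ g) := hg'.comp_left (by simp)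
      set ψ : 𝓢(En n, ℂ) := hg3.toSchwartzMap hg2 with hψ
      have e1 := congrArg (fun T => T ψ) (Lp.fourier_toTemperedDistribution_eq f)
      simp only [TemperedDistribution.fourier_apply, Lp.toTemperedDistribution_apply] at e1
      have e2 := VectorFourier.integral_fourierIntegral_smul_eq_flip (e := Real.fourierChar) (μ := (volume : Measure (En n))) (ν := (volume : Measure (En n))) (L := innerₗ (En n)) (f := F) (g := ψ) Real.continuous_fourierChar (by simpa using continuous_inner) h1 ψ.integrable
      have e3 : ∫ x, g x • 𝓕 F x = ∫ x, (𝓕 F x) • ψ x := by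
        congr 1; ext x; simp [hψ, mul_comm]
      have e4 : ∫ x, g x • (𝓕 f) x = ∫ x, ψ x • (𝓕 f) x := by
        congr 1
      rw [e3, e4, ← e1]
      refine e2.trans ?_
      refine integral_congr_ae ?_
      filter_upwards [h2.coeFn_toLp] with x hx
      rw [hx, smul_eq_mul, smul_eq_mul, mul_comm]
      congr 1
      simp only [flip_innerₗ]
      rfl
  rw [eLpNorm_congr_ae hae]
  have := Lp.norm_fourier_eq f
  rw [Lp.norm_def, Lp.norm_def] at this
  rw [ENNReal.toReal_eq_toReal_iff' (Lp.eLpNorm_ne_top _) (Lp.eLpNorm_ne_top _)] at this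
  rw [this]
  exact eLpNorm_congr_ae h2.coeFn_toLp

lemma eLpNorm_two_sq {α E : Type*} [MeasurableSpace α] [NormedAddCommGroup E] (μ : Measure α)
    (f : α → E) : (eLpNorm f 2 μ) ^ 2 = ∫⁻ x, ‖f x‖ₑ ^ 2 ∂μ := by
  rw [eLpNorm_eq_lintegral_rpow_enorm_toReal (by norm_num) (by norm_num)]
  simp only [ENNReal.toReal_ofNat, ENNReal.rpow_ofNat]
  rw [← ENNReal.rpow_natCast, ← ENNReal.rpow_mul]
  norm_num

/-- inverse Fourier integral -/
def PF {n : ℕ} (F : En n → ℂ) (y : En n) : ℂ :=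
  ∫ ξ : En n, Complex.exp (Complex.I * Complex.ofReal ⟪y, ξ⟫) * F ξ

lemma PF_eq {n : ℕ} (F : En n → ℂ) (y : En n) : PF F y = 𝓕 F ((-(2 * π)⁻¹ : ℝ) • y) := by
  rw [Real.fourier_eq', PF]
  congr 1; ext v
  congr 2
  rw [inner_smul_right, real_inner_comm]
  have : (π : ℂ) ≠ 0 := by exact_mod_cast Real.pi_ne_zero
  push_cast
  field_simp

/-- scaling constant -/
def cPl (n : ℕ) : ℝ≥0∞ := ENNReal.ofReal ((2 * π) ^ n)

lemma lintegral_comp_smul' {n : ℕ} (r : ℝ) (hr : r ≠ 0) (g : En n → ℝ≥0∞) :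
    ∫⁻ x, g (r • x) = ENNReal.ofReal |(r ^ n)⁻¹| * ∫⁻ x, g x := by
  have h := Measure.map_addHaar_smul (volume : Measure (En n)) hr
  have e : ∫⁻ x, g (r • x) = ∫⁻ x, g x ∂(Measure.map (r • ·) (volume : Measure (En n))) := by
    exact (lintegral_map_equiv g (Homeomorph.smulOfNeZero r hr).toMeasurableEquiv).symm
  rw [e, h, lintegral_smul_measure]
  simp

lemma PF_sq {n : ℕ} (F : En n → ℂ) (h1 : Integrable F) (h2 : MemLp F 2 volume) :
    ∫⁻ y, ‖PF F y‖ₑ ^ 2 = cPl n * (eLpNorm F 2 volume) ^ 2 := by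
  simp_rw [PF_eq]
  rw [lintegral_comp_smul' _ (by simp [Real.pi_ne_zero]) (fun z => ‖𝓕 F z‖ₑ ^ 2),
    ← eLpNorm_two_sq, plancherel_L1L2 F h1 h2]
  congr 2
  rw [abs_inv, abs_pow, abs_neg, abs_of_pos (by positivity), inv_pow, inv_inv]

lemma base_op {n : ℕ} (G : En n → En n) (G' : En n → En n →L[ℝ] En n)
    (hG : ∀ x, HasFDerivAt G (G' x) x) (hinj : Function.Injective G) (c : ℝ) (hc : 0 < c)
    (hdet : ∀ x, c ≤ |(G' x).det|) (F : En n → ℂ) (h1 : Integrable F) (h2 : MemLp F 2 volume) :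
    eLpNorm (fun x => PF F (G x)) 2 volume ≤
      (cPl n * ENNReal.ofReal c⁻¹) ^ (1/2 : ℝ) * eLpNorm F 2 volume := by
  have key : ∫⁻ x, ‖PF F (G x)‖ₑ ^ 2 ≤ (cPl n * ENNReal.ofReal c⁻¹) * (eLpNorm F 2 volume) ^ 2 := by
    have e := lintegral_image_eq_lintegral_abs_det_fderiv_mul volume MeasurableSet.univ
      (fun x _ => (hG x).hasFDerivWithinAt) hinj.injOn (fun z => ‖PF F z‖ₑ ^ 2)
    rw [Measure.restrict_univ] at e
    calc ∫⁻ x, ‖PF F (G x)‖ₑ ^ 2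
        ≤ ∫⁻ x, ENNReal.ofReal c⁻¹ * (ENNReal.ofReal |(G' x).det| * ‖PF F (G x)‖ₑ ^ 2) := by
          refine lintegral_mono fun x => ?_
          rw [← mul_assoc, ← ENNReal.ofReal_mul (by positivity)]
          refine le_mul_of_one_le_left' ?_
          rw [ENNReal.one_le_ofReal]
          rw [← div_eq_inv_mul, one_le_div hc]; exact hdet x
      _ = ENNReal.ofReal c⁻¹ * ∫⁻ x, (ENNReal.ofReal |(G' x).det| * ‖PF F (G x)‖ₑ ^ 2) := by
          rw [lintegral_const_mul' _ _ (by simp)]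
      _ ≤ ENNReal.ofReal c⁻¹ * ∫⁻ x, ‖PF F x‖ₑ ^ 2 := by
          rw [← e]; gcongr; exact Measure.restrict_le_self
      _ = _ := by rw [PF_sq F h1 h2]; ring
  rw [← eLpNorm_two_sq] at key
  have := ENNReal.rpow_le_rpow key (z := 1/2) (by norm_num)
  rw [ENNReal.mul_rpow_of_nonneg _ _ (by norm_num), ← ENNReal.rpow_natCast, ← ENNReal.rpow_natCast,
    ← ENNReal.rpow_mul, ← ENNReal.rpow_mul] at this
  simpa using this

lemma ft_eq {n : ℕ} (f : En n → ℂ) (ξ : En n) : ft f ξ = 𝓕 f (((2 * π)⁻¹ : ℝ) • ξ) := by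
  rw [Real.fourier_eq', ft]
  congr 1; ext v
  congr 2
  rw [inner_smul_right]
  have : (π : ℂ) ≠ 0 := by exact_mod_cast Real.pi_ne_zero
  push_cast
  field_simp

lemma ft_eq_schwartz {n : ℕ} (f : 𝓢(En n, ℂ)) :
    ft (⇑f) = fun ξ => (𝓕 f) (((2 * π)⁻¹ : ℝ) • ξ) := by
  ext ξ; rw [ft_eq, SchwartzMap.fourier_coe]

lemma two_pi_inv_ne : ((2 * π)⁻¹ : ℝ) ≠ 0 := by simp [Real.pi_ne_zero]

lemma ft_cont {n : ℕ} (f : 𝓢(En n, ℂ)) : Continuous (ft (⇑f)) := by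
  rw [ft_eq_schwartz]; exact (𝓕 f).continuous.comp (continuous_const_smul _)

lemma ft_int {n : ℕ} (f : 𝓢(En n, ℂ)) : Integrable (ft (⇑f)) := by
  rw [ft_eq_schwartz]; exact ((𝓕 f).integrable).comp_smul two_pi_inv_ne

lemma ft_norm {n : ℕ} (f : 𝓢(En n, ℂ)) :
    eLpNorm (ft (⇑f)) 2 volume = cPl n ^ (1/2 : ℝ) * eLpNorm (⇑f) 2 volume := by
  have h := plancherel_L1L2 (⇑f) f.integrable (f.memLp 2)
  have h3 : (eLpNorm (ft (⇑f)) 2 volume) ^ 2 = cPl n * (eLpNorm (⇑f) 2 volume) ^ 2 := by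
    rw [eLpNorm_two_sq]
    simp_rw [ft_eq]
    rw [lintegral_comp_smul' _ two_pi_inv_ne (fun z => ‖𝓕 (⇑f) z‖ₑ ^ 2), ← eLpNorm_two_sq, h]
    congr 2
    rw [abs_inv, abs_pow, abs_of_pos (by positivity), inv_pow, inv_inv]
  have h4 : ((eLpNorm (ft (⇑f)) 2 volume) ^ 2) ^ (1/2 : ℝ) =
    (cPl n * (eLpNorm (⇑f) 2 volume) ^ 2) ^ (1/2 : ℝ) := by rw [h3]
  rw [ENNReal.mul_rpow_of_nonneg _ _ (by norm_num), ← ENNReal.rpow_natCast,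
    ← ENNReal.rpow_natCast, ← ENNReal.rpow_mul, ← ENNReal.rpow_mul] at h4
  norm_num at h4 ⊢
  exact h4

lemma ft_memLp {n : ℕ} (f : 𝓢(En n, ℂ)) : MemLp (ft (⇑f)) 2 volume := by
  refine ⟨(ft_cont f).aestronglyMeasurable, ?_⟩
  rw [ft_norm]
  refine ENNReal.mul_lt_top (ENNReal.rpow_lt_top_of_nonneg (by norm_num) ?_) (f.memLp 2 volume).eLpNorm_lt_top
  unfold cPl; exact ENNReal.ofReal_ne_top

end plancherel

section hadamard

lemma had_local {n : ℕ} (G : En n → En n) (G' : En n → En n →L[ℝ] En n)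
    (hG : ∀ x, HasFDerivAt G (G' x) x) (c L : ℝ) (hc : 0 < c)
    (hlow : ∀ x v, c * ‖v‖ ≤ ‖G' x v‖) (hL : 0 < L) (hLip : ∀ x y, ‖G' x - G' y‖ ≤ L * ‖x - y‖) (r : ℝ)
    (hr : 0 < r) (hrL : L * (4 * r) ≤ c / 2) (x : En n) :
    (∀ a ∈ Metric.closedBall x (4*r), ∀ b ∈ Metric.closedBall x (4*r),
      c / 2 * ‖a - b‖ ≤ ‖G a - G b‖) ∧
    ∀ w, ‖w - G x‖ ≤ c / 2 * r → ∃ z, ‖z - x‖ ≤ r ∧ G z = w := by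
  have happ : ApproximatesLinearOn G (G' x) (Metric.closedBall x (4*r)) ⟨c/2, by positivity⟩ := by
    intro a ha b hb
    have := Convex.norm_image_sub_le_of_norm_hasFDerivWithin_le' (f := G) (f' := G') (φ := G' x)
      (C := c/2) (s := Metric.closedBall x (4*r)) (x := b) (y := a)
      (fun y _ => (hG y).hasFDerivWithinAt) (fun y hy => by
        refine (hLip y x).trans (le_trans ?_ hrL)
        have : ‖y - x‖ ≤ 4 * r := by simpa [dist_eq_norm] using hy
        gcongr) (convex_closedBall _ _) hb ha
    exact this
  constructor
  · intro a ha b hb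
    have h1 := happ a ha b hb
    have h2 := hlow x (a - b)
    have h3 := norm_sub_norm_le (G' x (a-b)) (G' x (a-b) - (G a - G b))
    rw [sub_sub_cancel, norm_sub_rev (G' x (a-b))] at h3
    have h1' : ‖G a - G b - (G' x) (a - b)‖ ≤ c / 2 * ‖a - b‖ := h1
    linarith
  · intro w hw
    have hinj : Function.Injective (G' x) := by
      refine (injective_iff_map_eq_zero _).2 fun v hv => ?_
      have := hlow x v
      rw [hv, norm_zero] at this
      have h0 := norm_nonneg v
      have : ‖v‖ = 0 := by nlinarith
      simpa using this
    have hsurj : Function.Surjective (G' x) :=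
      (LinearMap.injective_iff_surjective (f := (G' x : En n →ₗ[ℝ] En n))).1 hinj
    let R : (G' x).NonlinearRightInverse :=
      { toFun := Function.surjInv hsurj
        nnnorm := ⟨c⁻¹, by positivity⟩
        bound' := fun y => by
          have := hlow x (Function.surjInv hsurj y)
          rw [Function.surjInv_eq hsurj] at this
          change _ ≤ c⁻¹ * ‖y‖
          rw [inv_mul_eq_div, le_div_iff₀ hc]; linarith
        right_inv' := fun y => Function.surjInv_eq hsurj y }
    have hs := happ.surjOn_closedBall_of_nonlinearRightInverse R (ε := r) (b := x) hr.le
      (Metric.closedBall_subset_closedBall (by linarith))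
    have : w ∈ Metric.closedBall (G x) (((R.nnnorm : ℝ)⁻¹ - ((⟨c/2, by positivity⟩ : ℝ≥0) : ℝ)) * r) := by
      have e : ((R.nnnorm : ℝ)⁻¹ - ((⟨c/2, by positivity⟩ : ℝ≥0) : ℝ)) = c / 2 := by
        change (c⁻¹)⁻¹ - c / 2 = c / 2
        rw [inv_inv]; ring
      rw [e, Metric.mem_closedBall, dist_eq_norm]; exact hw
    obtain ⟨z, hz, hz'⟩ := hs this
    exact ⟨z, by simpa [dist_eq_norm] using hz, hz'⟩

lemma hadamard_inj {n : ℕ} (G : En n → En n) (G' : En n → En n →L[ℝ] En n)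
    (hG : ∀ x, HasFDerivAt G (G' x) x) (c L : ℝ) (hc : 0 < c)
    (hlow : ∀ x v, c * ‖v‖ ≤ ‖G' x v‖) (hL : 0 < L) (hLip : ∀ x y, ‖G' x - G' y‖ ≤ L * ‖x - y‖) :
    Function.Injective G := by
  obtain ⟨r, hr, hrL⟩ : ∃ r : ℝ, 0 < r ∧ L * (4 * r) ≤ c / 2 :=
    ⟨c / (8 * L), by positivity, by field_simp; norm_num⟩
  have hloc := had_local G G' hG c L hc hlow hL hLip r hr hrL
  have hGc : Continuous G := continuous_iff_continuousAt.2 fun x => (hG x).continuousAt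
  intro a b hab
  set w := G b with hw
  let γ : unitInterval → En n := fun t => a + (t : ℝ) • (b - a)
  have hγ : Continuous γ := by fun_prop
  have hD : Continuous (fun t => G (γ t) - w) := (hGc.comp hγ).sub continuous_const
  obtain ⟨M, hM⟩ := (isCompact_range hD).isBounded.exists_norm_le
  have hM' : ∀ t, ‖G (γ t) - w‖ ≤ M := fun t => hM _ ⟨t, rfl⟩
  obtain ⟨K, hK⟩ := exists_nat_gt (M / (c / 2 * r))
  have hM0 : 0 ≤ M := (norm_nonneg _).trans (hM' 0)
  have hKpos : (0 : ℝ) < K := lt_of_le_of_lt (by positivity) hK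
  have hMK : M / K ≤ c / 2 * r := by
    rw [div_lt_iff₀ (by positivity)] at hK
    rw [div_le_iff₀ hKpos]; linarith
  have ind : ∀ k : ℕ, ∃ Γ : unitInterval → En n, Continuous Γ ∧ Γ 0 = a ∧ Γ 1 = b ∧
      ∀ t, G (Γ t) = w + (1 - (k : ℝ) / K) • (G (γ t) - w) := by
    intro k
    induction k with
    | zero => exact ⟨γ, hγ, by simp [γ], by simp [γ], fun t => by simp⟩
    | succ k ih =>
      obtain ⟨Γ, hΓ, h0, h1, hΓG⟩ := ih
      have step : ∀ t, ‖(w + (1 - ((k+1 : ℕ) : ℝ) / K) • (G (γ t) - w)) - G (Γ t)‖ ≤ c / 2 * r := by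
        intro t
        rw [hΓG]
        have : (w + (1 - ((k+1 : ℕ) : ℝ) / K) • (G (γ t) - w)) - (w + (1 - (k : ℝ) / K) • (G (γ t) - w))
          = (-(1 / (K:ℝ))) • (G (γ t) - w) := by
            rw [add_sub_add_left_eq_sub, ← sub_smul]; congr 1; push_cast; ring
        rw [this, norm_smul, norm_neg, Real.norm_of_nonneg (by positivity)]
        refine le_trans ?_ hMK
        rw [one_div, inv_mul_eq_div]; gcongr; exact hM' t
      choose Γ' hΓ'1 hΓ'2 using fun t => (hloc (Γ t)).2 _ (step t)
      have uniq : ∀ t z, ‖z - Γ t‖ ≤ r → G z = G (Γ' t) → Γ' t = z := by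
        intro t z hz hzG
        have := (hloc (Γ t)).1 z (by rw [Metric.mem_closedBall, dist_eq_norm]; linarith) (Γ' t)
          (by rw [Metric.mem_closedBall, dist_eq_norm]; linarith [hΓ'1 t])
        rw [hzG, sub_self, norm_zero] at this
        have h0 := norm_nonneg (z - Γ' t)
        have : ‖z - Γ' t‖ = 0 := by nlinarith
        exact (sub_eq_zero.1 (norm_eq_zero.1 this)).symm
      refine ⟨Γ', ?_, ?_, ?_, hΓ'2⟩
      · rw [continuous_iff_continuousAt]
        intro t0
        have hW : Continuous fun t => (2 / c) * ‖G (Γ' t) - G (Γ' t0)‖ := by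
          simp_rw [hΓ'2]
          fun_prop
        have hWt : Filter.Tendsto (fun t => (2 / c) * ‖G (Γ' t) - G (Γ' t0)‖) (nhds t0) (nhds 0) := by
          have := hW.tendsto t0
          simpa using this
        rw [ContinuousAt, tendsto_iff_norm_sub_tendsto_zero]
        refine squeeze_zero' (Filter.Eventually.of_forall fun _ => norm_nonneg _) ?_ hWt
        have hev : ∀ᶠ t in nhds t0, ‖Γ t - Γ t0‖ ≤ r := by
          have := (hΓ.tendsto t0).eventually (Metric.closedBall_mem_nhds (Γ t0) hr)
          simpa [dist_eq_norm] using this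
        filter_upwards [hev] with t ht
        have := (hloc (Γ t0)).1 (Γ' t) (by
          rw [Metric.mem_closedBall, dist_eq_norm]
          have := norm_sub_le_norm_sub_add_norm_sub (Γ' t) (Γ t) (Γ t0)
          linarith [hΓ'1 t]) (Γ' t0) (by
          rw [Metric.mem_closedBall, dist_eq_norm]; linarith [hΓ'1 t0])
        calc ‖Γ' t - Γ' t0‖ = (2 / c) * (c / 2 * ‖Γ' t - Γ' t0‖) := by field_simp
          _ ≤ _ := by gcongr
      · apply uniq
        · rw [h0]; simpa using hr.le
        · rw [hΓ'2]; simp [γ, hab]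
      · apply uniq
        · rw [h1]; simpa using hr.le
        · rw [hΓ'2]; simp [γ, hw]
  obtain ⟨Γ, hΓ, h0, h1, hΓG⟩ := ind K
  have hconst : ∀ t, G (Γ t) = w := fun t => by
    rw [hΓG, div_self hKpos.ne']; simp
  have hlc : IsLocallyConstant Γ := by
    rw [IsLocallyConstant.iff_eventually_eq]
    intro t0
    have hev : ∀ᶠ t in nhds t0, ‖Γ t - Γ t0‖ ≤ r := by
      have := (hΓ.tendsto t0).eventually (Metric.closedBall_mem_nhds (Γ t0) hr)
      simpa [dist_eq_norm] using this
    filter_upwards [hev] with t ht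
    have := (hloc (Γ t0)).1 (Γ t) (by
          rw [Metric.mem_closedBall, dist_eq_norm]; linarith) (Γ t0) (by
          rw [Metric.mem_closedBall, dist_eq_norm]; simp; linarith)
    rw [hconst, hconst, sub_self, norm_zero] at this
    have h0 := norm_nonneg (Γ t - Γ t0)
    have : ‖Γ t - Γ t0‖ = 0 := by nlinarith
    exact sub_eq_zero.1 (norm_eq_zero.1 this)
  have := hlc.apply_eq_of_preconnectedSpace 0 1
  rw [h0, h1] at this
  exact this

end hadamard

lemma matrix_low (n : ℕ) (B c : ℝ) (hc : 0 < c) : ∃ c' : ℝ, 0 < c' ∧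
    ∀ M : Matrix (Fin n) (Fin n) ℝ, (∀ i j, |M i j| ≤ B) → c ≤ |M.det| →
      ∀ v : En n, c' * ‖v‖ ≤ ‖WithLp.toLp 2 (M.mulVec v.ofLp)‖ := by
  let S : Set (Matrix (Fin n) (Fin n) ℝ) := {M | (∀ i j, |M i j| ≤ B) ∧ c ≤ |M.det|}
  have hS : IsCompact S := by
    have h1 : IsCompact (Set.pi Set.univ fun _ : Fin n => Set.pi Set.univ fun _ : Fin n => Set.Icc (-B) B) :=
      isCompact_univ_pi fun _ => isCompact_univ_pi fun _ => isCompact_Icc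
    refine h1.of_isClosed_subset ?_ ?_
    · have : S = (⋂ i, ⋂ j, {M | |M i j| ≤ B}) ∩ {M | c ≤ |M.det|} := by
        ext M; simp [S]
      rw [this]
      refine IsClosed.inter (isClosed_iInter fun i => isClosed_iInter fun j => ?_) ?_
      · exact isClosed_le (by fun_prop) continuous_const
      · exact isClosed_le continuous_const (continuous_id.matrix_det.abs)
    · intro M hM i _ j _
      exact abs_le.1 (hM.1 i j)
  have hK : IsCompact (S ×ˢ Metric.sphere (0 : En n) 1) := hS.prod (isCompact_sphere _ _)
  let f : Matrix (Fin n) (Fin n) ℝ × En n → ℝ := fun q => ‖WithLp.toLp 2 (q.1.mulVec q.2.ofLp)‖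
  have hf : Continuous f := by
    refine Continuous.norm ?_
    refine (PiLp.continuous_toLp 2 _).comp ?_
    exact Continuous.matrix_mulVec continuous_fst ((PiLp.continuous_ofLp 2 _).comp continuous_snd)
  have fin : ∀ c' : ℝ, (∀ q ∈ S ×ˢ Metric.sphere (0 : En n) 1, c' ≤ f q) →
    ∀ M : Matrix (Fin n) (Fin n) ℝ, (∀ i j, |M i j| ≤ B) → c ≤ |M.det| →
      ∀ v : En n, c' * ‖v‖ ≤ ‖WithLp.toLp 2 (M.mulVec v.ofLp)‖ := by
    intro c' h M h1 h2 v
    by_cases hv : v = 0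
    · simp [hv]
    have hv' : 0 < ‖v‖ := norm_pos_iff.2 hv
    have := h (M, ‖v‖⁻¹ • v) ⟨⟨h1, h2⟩, by simp [norm_smul, hv'.ne']⟩
    simp only [f, WithLp.ofLp_smul, Matrix.mulVec_smul, WithLp.toLp_smul, norm_smul, norm_inv, norm_norm] at this
    rwa [inv_mul_eq_div, le_div_iff₀ hv'] at this
  rcases (S ×ˢ Metric.sphere (0 : En n) 1).eq_empty_or_nonempty with he | hne
  · exact ⟨1, one_pos, fin 1 (by simp [he])⟩
  · obtain ⟨q, hq, hmin⟩ := hK.exists_isMinOn hne hf.continuousOn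
    refine ⟨f q, ?_, fin _ fun z hz => hmin hz⟩
    have hq2 : ‖q.2‖ = 1 := by simpa using hq.2
    rw [norm_pos_iff]
    intro h0
    have h0' : q.1.mulVec q.2.ofLp = 0 := by
      have := congrArg WithLp.ofLp h0; simpa using this
    have hdet : q.1.det ≠ 0 := by
      intro h; have := hq.1.2; rw [h, abs_zero] at this; linarith
    have := Matrix.eq_zero_of_mulVec_eq_zero hdet h0'
    have : q.2 = 0 := by ext i; simp [this]
    rw [this] at hq2; simp at hq2

section classes
variable {E ι : Type} [NormedAddCommGroup E] [NormedSpace ℝ E]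

/-- amplitude class -/
def Cl (e : ι → E) (w : ι → E → ℝ) (D : Set E) : ℕ → (E → ℝ) → (E → ℂ) → Prop
  | 0, κ, b => ContinuousOn b D ∧ ∀ p ∈ D, ‖b p‖ ≤ κ p
  | N + 1, κ, b => (ContinuousOn b D ∧ ∀ p ∈ D, ‖b p‖ ≤ κ p) ∧
      ∀ i, ∃ b' : E → ℂ, (∀ p ∈ D, HasLineDerivAt ℝ b (b' p) p (e i)) ∧
        Cl e w D N (fun p => κ p * w i p) b'

variable {e : ι → E} {w w' : ι → E → ℝ} {D D' : Set E}

lemma Cl.cont {N : ℕ} {κ : E → ℝ} {b : E → ℂ} (h : Cl e w D N κ b) : ContinuousOn b D := by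
  cases N with
  | zero => exact h.1
  | succ N => exact h.1.1

lemma Cl.bd {N : ℕ} {κ : E → ℝ} {b : E → ℂ} (h : Cl e w D N κ b) : ∀ p ∈ D, ‖b p‖ ≤ κ p := by
  cases N with
  | zero => exact h.2
  | succ N => exact h.1.2

lemma Cl.pred {N : ℕ} : ∀ {κ : E → ℝ} {b : E → ℂ}, Cl e w D (N+1) κ b → Cl e w D N κ b := by
  induction N with
  | zero => intro κ b h; exact h.1
  | succ N ih =>
    intro κ b h
    refine ⟨h.1, fun i => ?_⟩
    obtain ⟨b', h1, h2⟩ := h.2 i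
    exact ⟨b', h1, ih h2⟩

lemma Cl.le {N M : ℕ} (hMN : M ≤ N) {κ : E → ℝ} {b : E → ℂ} (h : Cl e w D N κ b) :
    Cl e w D M κ b := by
  induction N with
  | zero => obtain rfl : M = 0 := by omega
            exact h
  | succ N ih =>
    rcases Nat.lt_or_ge N M with h1 | h1
    · obtain rfl : M = N + 1 := by omega
      exact h
    · exact ih h1 h.pred

lemma Cl.mono {N : ℕ} : ∀ {κ κ' : E → ℝ} {b : E → ℂ}, Cl e w D N κ b → D' ⊆ D →
    (∀ p ∈ D', κ p ≤ κ' p) → (∀ p ∈ D', 0 ≤ κ p) → (∀ i, ∀ p ∈ D', 0 ≤ w i p) →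
    (∀ i, ∀ p ∈ D', w i p ≤ w' i p) → Cl e w' D' N κ' b := by
  induction N with
  | zero =>
    intro κ κ' b h hD hκ h0 _ _
    exact ⟨h.1.mono hD, fun p hp => (h.2 p (hD hp)).trans (hκ p hp)⟩
  | succ N ih =>
    intro κ κ' b h hD hκ h0 hw hww
    refine ⟨⟨h.1.1.mono hD, fun p hp => (h.1.2 p (hD hp)).trans (hκ p hp)⟩, fun i => ?_⟩
    obtain ⟨b', h1, h2⟩ := h.2 i
    refine ⟨b', fun p hp => h1 p (hD hp), ih h2 hD ?_ ?_ hw hww⟩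
    · intro p hp
      exact mul_le_mul (hκ p hp) (hww i p hp) (hw i p hp) ((h0 p hp).trans (hκ p hp))
    · intro p hp; exact mul_nonneg (h0 p hp) (hw i p hp)

lemma HasLineDerivAt.mul' {b c : E → ℂ} {b' c' : ℂ} {p v : E} (hb : HasLineDerivAt ℝ b b' p v)
    (hc : HasLineDerivAt ℝ c c' p v) :
    HasLineDerivAt ℝ (fun q => b q * c q) (b' * c p + b p * c') p v := by
  unfold HasLineDerivAt at *
  exact HasDerivAt.congr_deriv (HasDerivAt.mul hb hc) (by simp)

lemma HasLineDerivAt.add' {b c : E → ℂ} {b' c' : ℂ} {p v : E} (hb : HasLineDerivAt ℝ b b' p v)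
    (hc : HasLineDerivAt ℝ c c' p v) :
    HasLineDerivAt ℝ (fun q => b q + c q) (b' + c') p v := by
  unfold HasLineDerivAt at *
  exact HasDerivAt.congr_deriv (HasDerivAt.add hb hc) (by simp)

lemma HasLineDerivAt.inv' {b : E → ℂ} {b' : ℂ} {p v : E} (hb : HasLineDerivAt ℝ b b' p v)
    (h0 : b p ≠ 0) :
    HasLineDerivAt ℝ (fun q => (b q)⁻¹) (-b' * ((b p)⁻¹ * (b p)⁻¹)) p v := by
  unfold HasLineDerivAt at *
  have := hb.inv (by simpa using h0)
  exact HasDerivAt.congr_deriv this (by simp; field_simp)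

lemma HasLineDerivAt.exp' {r : E → ℝ} {r' : ℝ} {p v : E} (hb : HasLineDerivAt ℝ r r' p v) :
    HasLineDerivAt ℝ (fun q => Complex.exp (Complex.I * Complex.ofReal (r q)))
      (Complex.I * r' * Complex.exp (Complex.I * Complex.ofReal (r p))) p v := by
  unfold HasLineDerivAt at *
  have := ((hb.ofReal_comp).const_mul Complex.I).cexp
  exact HasDerivAt.congr_deriv this (by simp; ring)

lemma Cl.zero {N : ℕ} : ∀ {κ : E → ℝ}, (∀ p ∈ D, 0 ≤ κ p) → (∀ i, ∀ p ∈ D, 0 ≤ w i p) →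
    Cl e w D N κ (fun _ => 0) := by
  induction N with
  | zero => intro κ h _; exact ⟨continuousOn_const, fun p hp => by simpa using h p hp⟩
  | succ N ih =>
    intro κ h hw
    refine ⟨⟨continuousOn_const, fun p hp => by simpa using h p hp⟩, fun i => ⟨fun _ => 0, ?_, ?_⟩⟩
    · intro p _; exact hasDerivAt_const _ _
    · exact ih (fun p hp => mul_nonneg (h p hp) (hw i p hp)) hw

lemma Cl.const {N : ℕ} {κ : E → ℝ} (c : ℂ) (h : ∀ p ∈ D, ‖c‖ ≤ κ p) (hw : ∀ i, ∀ p ∈ D, 0 ≤ w i p) :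
    Cl e w D N κ (fun _ => c) := by
  cases N with
  | zero => exact ⟨continuousOn_const, h⟩
  | succ N =>
    refine ⟨⟨continuousOn_const, h⟩, fun i => ⟨fun _ => 0, ?_, ?_⟩⟩
    · intro p _; exact hasDerivAt_const _ _
    · exact Cl.zero (fun p hp => mul_nonneg ((norm_nonneg _).trans (h p hp)) (hw i p hp)) hw

lemma Cl.add {N : ℕ} : ∀ {κ κ' : E → ℝ} {b c : E → ℂ}, Cl e w D N κ b → Cl e w D N κ' c →
    Cl e w D N (fun p => κ p + κ' p) (fun p => b p + c p) := by
  induction N with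
  | zero =>
    intro κ κ' b c h h'
    exact ⟨h.1.add h'.1, fun p hp => (norm_add_le _ _).trans (add_le_add (h.2 p hp) (h'.2 p hp))⟩
  | succ N ih =>
    intro κ κ' b c h h'
    refine ⟨⟨h.1.1.add h'.1.1, fun p hp => (norm_add_le _ _).trans
      (add_le_add (h.1.2 p hp) (h'.1.2 p hp))⟩, fun i => ?_⟩
    obtain ⟨b', h1, h2⟩ := h.2 i
    obtain ⟨c', h1', h2'⟩ := h'.2 i
    refine ⟨fun p => b' p + c' p, fun p hp => (h1 p hp).add' (h1' p hp), ?_⟩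
    have := ih h2 h2'
    simpa only [add_mul] using this

lemma Cl.mul {N : ℕ} (hw : ∀ i, ∀ p ∈ D, 0 ≤ w i p) :
    ∀ {κ κ' : E → ℝ} {b c : E → ℂ}, Cl e w D N κ b → Cl e w D N κ' c →
    Cl e w D N (fun p => 2 ^ N * (κ p * κ' p)) (fun p => b p * c p) := by
  induction N with
  | zero =>
    intro κ κ' b c h h'
    refine ⟨h.1.mul h'.1, fun p hp => ?_⟩
    simp only [norm_mul, pow_zero, one_mul]
    exact mul_le_mul (h.2 p hp) (h'.2 p hp) (norm_nonneg _) ((norm_nonneg _).trans (h.2 p hp))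
  | succ N ih =>
    intro κ κ' b c h h'
    refine ⟨⟨h.1.1.mul h'.1.1, fun p hp => ?_⟩, fun i => ?_⟩
    · rw [norm_mul]
      have h1 := mul_le_mul (h.1.2 p hp) (h'.1.2 p hp) (norm_nonneg _) ((norm_nonneg _).trans (h.1.2 p hp))
      refine h1.trans (le_mul_of_one_le_left ?_ ?_)
      · exact (mul_nonneg (norm_nonneg _) (norm_nonneg _)).trans h1
      · exact one_le_pow₀ (by norm_num)
    obtain ⟨b', h1, h2⟩ := h.2 i
    obtain ⟨c', h1', h2'⟩ := h'.2 i
    refine ⟨fun p => b' p * c p + b p * c' p, fun p hp => (h1 p hp).mul' (h1' p hp), ?_⟩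
    have := (ih h2 h'.pred).add (ih h.pred h2')
    convert this using 2 with p
    rw [pow_succ]; ring

lemma Cl.const_mul {N : ℕ} (z : ℂ) : ∀ {κ : E → ℝ} {b : E → ℂ}, Cl e w D N κ b →
    Cl e w D N (fun p => ‖z‖ * κ p) (fun p => z * b p) := by
  induction N with
  | zero =>
    intro κ b h
    exact ⟨continuousOn_const.mul h.1, fun p hp => by
      rw [norm_mul]; exact mul_le_mul_of_nonneg_left (h.2 p hp) (norm_nonneg _)⟩
  | succ N ih =>
    intro κ b h
    refine ⟨⟨continuousOn_const.mul h.1.1, fun p hp => by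
      rw [norm_mul]; exact mul_le_mul_of_nonneg_left (h.1.2 p hp) (norm_nonneg _)⟩, fun j => ?_⟩
    obtain ⟨b', u1, u2⟩ := h.2 j
    refine ⟨fun p => z * b' p, fun p hp => HasDerivAt.const_mul _ (u1 p hp), ?_⟩
    simpa only [mul_assoc] using ih u2

/-- constants for exponentials -/
def expC (C : ℝ) : ℕ → ℝ
  | 0 => 1
  | N + 1 => expC C N + 2 ^ N * (C * expC C N)

lemma expC_pos {C : ℝ} (hC : 0 ≤ C) (N : ℕ) : 0 < expC C N := by
  induction N with
  | zero => simp [expC]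
  | succ N ih => simp only [expC]; positivity

lemma Cl.exp {N : ℕ} {C : ℝ} (hC : 0 ≤ C) (hw : ∀ i, ∀ p ∈ D, 0 ≤ w i p) {r : E → ℝ}
    (hc : ContinuousOn r D)
    (hr : ∀ i, ∃ r' : E → ℝ, (∀ p ∈ D, HasLineDerivAt ℝ r (r' p) p (e i)) ∧
      Cl e w D N (fun p => C * w i p) (fun p => (r' p : ℂ))) :
    ∀ M ≤ N + 1, Cl e w D M (fun _ => expC C M)
      (fun p => Complex.exp (Complex.I * Complex.ofReal (r p))) := by
  have hcont : ContinuousOn (fun p => Complex.exp (Complex.I * Complex.ofReal (r p))) D := by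
    fun_prop
  have hn : ∀ p, ‖Complex.exp (Complex.I * Complex.ofReal (r p))‖ = 1 := by
    intro p; rw [mul_comm]; exact Complex.norm_exp_ofReal_mul_I _
  intro M
  induction M with
  | zero => intro _; exact ⟨hcont, fun p _ => by simp [hn, expC]⟩
  | succ M ih =>
    intro hM
    have hM' := ih (by omega)
    refine ⟨⟨hcont, fun p hp => ?_⟩, fun i => ?_⟩
    · refine (hM'.bd p hp).trans ?_
      have := expC_pos hC M
      simp only [expC]
      have : 0 ≤ 2 ^ M * (C * expC C M) := by positivity
      linarith
    · obtain ⟨r', h1, h2⟩ := hr i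
      refine ⟨_, fun p hp => (h1 p hp).exp', ?_⟩
      have a1 := Cl.mul hw (h2.le (by omega : M ≤ N)) hM'
      have a2 : Cl e w D M (fun p => 2 ^ M * (C * w i p * expC C M))
          (fun p => Complex.I * (r' p * Complex.exp (Complex.I * Complex.ofReal (r p)))) := by
        simpa using a1.const_mul Complex.I
      have a3 := a2.mono (w' := w) (κ' := fun p => expC C (M+1) * w i p) (subset_refl D) (fun p hp => ?_) (fun p hp => ?_)
        hw (fun _ _ _ => le_rfl)
      · simpa only [mul_assoc] using a3
      · have := expC_pos hC M
        have h0 := hw i p hp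
        simp only [expC]
        nlinarith [mul_nonneg this.le h0]
      · have := expC_pos hC M
        have h0 := hw i p hp
        positivity

lemma Cl.sub {N : ℕ} {κ κ' : E → ℝ} {b c : E → ℂ} (h : Cl e w D N κ b) (h' : Cl e w D N κ' c) :
    Cl e w D N (fun p => κ p + κ' p) (fun p => b p - c p) := by
  have := h.add (h'.const_mul (-1))
  simpa [sub_eq_add_neg] using this

/-- constants for inverses -/
def invC (C : ℝ) : ℕ → ℝ
  | 0 => 1
  | N + 1 => invC C N + 2 ^ N * (C * (2 ^ N * (invC C N * invC C N)))

lemma invC_pos {C : ℝ} (hC : 0 ≤ C) (N : ℕ) : 0 < invC C N := by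
  induction N with
  | zero => simp [invC]
  | succ N ih => simp only [invC]; positivity

lemma Cl.inv {N : ℕ} {C : ℝ} (hC : 0 ≤ C) (hw : ∀ i, ∀ p ∈ D, 0 ≤ w i p) {v : E → ℂ} {κ : E → ℝ}
    (hκ : ∀ p ∈ D, 0 < κ p) (hv0 : ∀ p ∈ D, κ p ≤ ‖v p‖)
    (hv : Cl e w D N (fun p => C * κ p) v) :
    Cl e w D N (fun p => invC C N * (κ p)⁻¹) (fun p => (v p)⁻¹) := by
  have hne : ∀ p ∈ D, v p ≠ 0 := fun p hp h => by
    have := hv0 p hp; rw [h, norm_zero] at this; exact absurd (hκ p hp) (not_lt.2 this)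
  have hb : ∀ p ∈ D, ‖(v p)⁻¹‖ ≤ (κ p)⁻¹ := fun p hp => by
    rw [norm_inv]; exact inv_anti₀ (hκ p hp) (hv0 p hp)
  induction N with
  | zero =>
    refine ⟨hv.1.inv₀ hne, fun p hp => by simpa [invC] using hb p hp⟩
  | succ N ih =>
    have hM' := ih hv.pred
    refine ⟨⟨hv.cont.inv₀ hne, fun p hp => (hM'.bd p hp).trans ?_⟩, fun i => ?_⟩
    · have := invC_pos hC N
      have := hκ p hp
      refine mul_le_mul_of_nonneg_right ?_ (by positivity)
      simp only [invC]
      have : 0 ≤ 2 ^ N * (C * (2 ^ N * (invC C N * invC C N))) := by positivity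
      linarith
    · obtain ⟨v', h1, h2⟩ := hv.2 i
      refine ⟨_, fun p hp => (h1 p hp).inv' (hne p hp), ?_⟩
      have a1 := Cl.mul hw (h2.const_mul (-1)) (Cl.mul hw hM' hM')
      have a3 := a1.mono (w' := w) (κ' := fun p => invC C (N+1) * (κ p)⁻¹ * w i p) (subset_refl D)
        (fun p hp => ?_) (fun p hp => ?_) hw (fun _ _ _ => le_rfl)
      · simpa only [neg_one_mul] using a3
      · have h3 := invC_pos hC N
        have h0 := hw i p hp
        have h4 := hκ p hp
        have e1 : 2 ^ N * (‖(-1 : ℂ)‖ * (C * κ p * w i p) * (2 ^ N * (invC C N * (κ p)⁻¹ * (invC C N * (κ p)⁻¹))))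
          = (2 ^ N * (C * (2 ^ N * (invC C N * invC C N)))) * (κ p)⁻¹ * w i p := by
          simp; field_simp
        rw [e1]
        simp only [invC]
        gcongr
        linarith
      · have h3 := invC_pos hC N
        have h0 := hw i p hp
        have h4 := hκ p hp
        positivity

/-- product of weights along a word -/
def wprod (w : ι → E → ℝ) (l : List ι) (p : E) : ℝ := (l.map (fun i => w i p)).prod

lemma Cl.of_family {N : ℕ} : ∀ {κ : E → ℝ} {U : List ι → E → ℂ},
    (∀ l, l.length ≤ N → ContinuousOn (U l) D) →
    (∀ l, l.length < N → ∀ i, ∀ p ∈ D, HasLineDerivAt ℝ (U l) (U (l ++ [i]) p) p (e i)) →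
    (∀ l, l.length ≤ N → ∀ p ∈ D, ‖U l p‖ ≤ κ p * wprod w l p) → Cl e w D N κ (U []) := by
  induction N with
  | zero =>
    intro κ U h1 _ h3
    exact ⟨h1 [] le_rfl, fun p hp => by simpa [wprod] using h3 [] le_rfl p hp⟩
  | succ N ih =>
    intro κ U h1 h2 h3
    refine ⟨⟨h1 [] (Nat.zero_le _), fun p hp => by simpa [wprod] using h3 [] (Nat.zero_le _) p hp⟩, fun i => ?_⟩
    refine ⟨U [i], fun p hp => h2 [] (Nat.succ_pos _) i p hp, ?_⟩
    refine ih (U := fun l => U (i :: l)) (fun l hl => h1 _ (by simpa using hl))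
      (fun l hl j p hp => h2 (i :: l) (by simpa using hl) j p hp) (fun l hl p hp => ?_)
    have := h3 (i :: l) (by simpa using hl) p hp
    simpa [wprod, mul_assoc] using this

lemma Cl.family {N : ℕ} : ∀ {κ : E → ℝ} {b : E → ℂ}, Cl e w D N κ b →
    ∃ U : List ι → E → ℂ, U [] = b ∧ (∀ l, l.length ≤ N → ContinuousOn (U l) D) ∧
    (∀ l, l.length < N → ∀ i, ∀ p ∈ D, HasLineDerivAt ℝ (U l) (U (l ++ [i]) p) p (e i)) ∧
    (∀ l, l.length ≤ N → Cl e w D (N - l.length) (fun p => κ p * wprod w l p) (U l)) := by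
  induction N with
  | zero =>
    intro κ b h
    refine ⟨fun _ => b, rfl, fun _ _ => h.1, fun l hl => absurd hl (Nat.not_lt_zero _), fun l hl => ?_⟩
    obtain rfl : l = [] := List.length_eq_zero_iff.1 (by omega)
    simpa [wprod] using h
  | succ N ih =>
    intro κ b h
    choose b' h1 h2 using h.2
    choose V hV0 hV1 hV2 hV3 using fun i => ih (h2 i)
    let U : List ι → E → ℂ := fun l => match l with
      | [] => b
      | i :: l => V i l
    refine ⟨U, rfl, ?_, ?_, ?_⟩
    · intro l hl
      cases l with
      | nil => exact h.1.1
      | cons i l => exact hV1 i l (by simpa using hl)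
    · intro l hl j p hp
      cases l with
      | nil =>
        change HasLineDerivAt ℝ b (V j [] p) p (e j)
        rw [hV0]; exact h1 j p hp
      | cons i l => exact hV2 i l (by simpa using hl) j p hp
    · intro l hl
      cases l with
      | nil => simpa [wprod] using h
      | cons i l =>
        have := hV3 i l (by simpa using hl)
        simpa [wprod, mul_assoc] using this

end classes

section words
variable {E E' F ι ι' : Type} [NormedAddCommGroup E] [NormedSpace ℝ E]
  [NormedAddCommGroup E'] [NormedSpace ℝ E'] [NormedAddCommGroup F] [NormedSpace ℝ F]

/-- iterated directional derivatives along a word, first letter innermost -/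
def wd (e : ι → E) : List ι → (E → F) → E → F
  | [], b => b
  | i :: l, b => wd e l (fun p => fderiv ℝ b p (e i))

lemma wd_append (e : ι → E) (l l' : List ι) (b : E → F) : wd e (l ++ l') b = wd e l' (wd e l b) := by
  induction l generalizing b with
  | nil => rfl
  | cons i l ih => exact ih _

lemma wd_concat (e : ι → E) (l : List ι) (i : ι) (b : E → F) (p : E) :
    wd e (l ++ [i]) b p = fderiv ℝ (wd e l b) p (e i) := by
  rw [wd_append]; rfl

lemma smooth_dir {U : Set E} (hU : IsOpen U) {b : E → F} (hb : ContDiffOn ℝ (⊤ : ℕ∞) b U) (v : E) :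
    ContDiffOn ℝ (⊤ : ℕ∞) (fun p => fderiv ℝ b p v) U := by
  have := hb.fderiv_of_isOpen (m := (⊤ : ℕ∞)) hU (by simp)
  exact this.clm_apply contDiffOn_const

lemma wd_smooth (e : ι → E) {U : Set E} (hU : IsOpen U) (l : List ι) {b : E → F}
    (hb : ContDiffOn ℝ (⊤ : ℕ∞) b U) : ContDiffOn ℝ (⊤ : ℕ∞) (wd e l b) U := by
  induction l generalizing b with
  | nil => exact hb
  | cons i l ih => exact ih (smooth_dir hU hb _)

lemma wd_congr (e : ι → E) {U : Set E} (hU : IsOpen U) (l : List ι) {b b' : E → F}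
    (h : Set.EqOn b b' U) : Set.EqOn (wd e l b) (wd e l b') U := by
  induction l generalizing b b' with
  | nil => exact h
  | cons i l ih =>
    refine ih fun p hp => ?_
    have : b =ᶠ[nhds p] b' := Filter.eventuallyEq_of_mem (hU.mem_nhds hp) h
    simp only [this.fderiv_eq]

lemma smooth_at {U : Set E} (hU : IsOpen U) {b : E → F} (hb : ContDiffOn ℝ (⊤ : ℕ∞) b U) {p : E}
    (hp : p ∈ U) : DifferentiableAt ℝ b p :=
  (hb.contDiffAt (hU.mem_nhds hp)).differentiableAt (by simp)

lemma wd_line (e : ι → E) {U : Set E} (hU : IsOpen U) (l : List ι) {b : E → F}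
    (hb : ContDiffOn ℝ (⊤ : ℕ∞) b U) (i : ι) {p : E} (hp : p ∈ U) :
    HasLineDerivAt ℝ (wd e l b) (wd e (l ++ [i]) b p) p (e i) := by
  rw [wd_concat]
  exact (smooth_at hU (wd_smooth e hU l hb) hp).hasFDerivAt.hasLineDerivAt _

lemma dir_comm {U : Set E} (hU : IsOpen U) {b : E → F} (hb : ContDiffOn ℝ (⊤ : ℕ∞) b U) (v v' : E)
    {p : E} (hp : p ∈ U) :
    fderiv ℝ (fun q => fderiv ℝ b q v) p v' = fderiv ℝ (fun q => fderiv ℝ b q v') p v := by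
  have hs : IsSymmSndFDerivAt ℝ b p :=
    (hb.contDiffAt (hU.mem_nhds hp)).isSymmSndFDerivAt (by simp only [minSmoothness_of_isRCLikeNormedField]; exact WithTop.coe_le_coe.2 (le_top : (2:ℕ∞) ≤ ⊤))
  have hd : DifferentiableAt ℝ (fderiv ℝ b) p :=
    ((hb.fderiv_of_isOpen (m := (⊤ : ℕ∞)) hU (by simp)).contDiffAt (hU.mem_nhds hp)).differentiableAt (by simp)
  have key : ∀ v v', fderiv ℝ (fun q => fderiv ℝ b q v) p v' = fderiv ℝ (fderiv ℝ b) p v' v := by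
    intro v v'
    rw [fderiv_clm_apply hd (differentiableAt_const _)]
    simp
  rw [key, key]
  exact hs v' v

lemma wd_perm (e : ι → E) {U : Set E} (hU : IsOpen U) {l l' : List ι} (h : l.Perm l') :
    ∀ {b : E → F}, ContDiffOn ℝ (⊤ : ℕ∞) b U → Set.EqOn (wd e l b) (wd e l' b) U := by
  induction h with
  | nil => intro b _ p _; rfl
  | cons i _ ih => intro b hb; exact ih (smooth_dir hU hb _)
  | swap i j l =>
    intro b hb
    exact wd_congr e hU l fun p hp => dir_comm hU hb _ _ hp
  | trans _ _ ih1 ih2 => intro b hb; exact (ih1 hb).trans (ih2 hb)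

/-- composition with affine maps -/
lemma wd_comp (e : ι → E) (e' : ι' → E') (σ : ι' → ι) (L : E' →L[ℝ] E) (q₀ : E)
    (hL : ∀ i, L (e' i) = e (σ i)) {U : Set E} (hU : IsOpen U) (l : List ι') :
    ∀ {b : E → F}, ContDiffOn ℝ (⊤ : ℕ∞) b U → ∀ p, q₀ + L p ∈ U →
      wd e' l (fun p => b (q₀ + L p)) p = wd e (l.map σ) b (q₀ + L p) := by
  induction l with
  | nil => intro b _ p _; rfl
  | cons i l ih =>
    intro b hb p hp
    have hU' : IsOpen {p : E' | q₀ + L p ∈ U} := hU.preimage (by fun_prop)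
    simp only [wd, List.map_cons]
    rw [← ih (smooth_dir hU hb _) p hp]
    refine wd_congr e' hU' l (fun q hq => ?_) hp
    have hd : HasFDerivAt (fun p => q₀ + L p) L q := (L.hasFDerivAt).const_add q₀
    have := (smooth_at hU hb hq).hasFDerivAt.comp q hd
    have h2 : fderiv ℝ (fun p => b (q₀ + L p)) q = (fderiv ℝ b (q₀ + L q)).comp L := this.fderiv
    simp only [h2, ContinuousLinearMap.comp_apply, hL]

end words

section conv
variable {n : ℕ} {F : Type} [NormedAddCommGroup F] [NormedSpace ℝ F]

/-- basis vectors -/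
def eB (i : Fin n) : En n := EuclideanSpace.single i 1

lemma pd_iter (i : Fin n) (k : ℕ) (f : En n → F) : (pd i)^[k] f = wd eB (List.replicate k i) f := by
  induction k generalizing f with
  | zero => rfl
  | succ k ih => rw [Function.iterate_succ_apply, ih]; rfl

/-- word of a multiindex -/
def wordOf (α : Fin n → ℕ) : List (Fin n) → List (Fin n)
  | [] => []
  | i :: L => wordOf α L ++ List.replicate (α i) i

lemma foldr_word (α : Fin n → ℕ) (L : List (Fin n)) (f : En n → F) :
    L.foldr (fun i g => (pd i)^[α i] g) f = wd eB (wordOf α L) f := by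
  induction L with
  | nil => rfl
  | cons i L ih => rw [List.foldr_cons, ih, pd_iter, wordOf, wd_append]

lemma mderiv_word (α : Fin n → ℕ) (f : En n → F) :
    mderiv α f = wd eB (wordOf α (List.finRange n)) f := foldr_word _ _ _

lemma wordOf_count (α : Fin n → ℕ) (L : List (Fin n)) (hL : L.Nodup) (i : Fin n) :
    (wordOf α L).count i = if i ∈ L then α i else 0 := by
  induction L with
  | nil => simp [wordOf]
  | cons j L ih =>
    rw [List.nodup_cons] at hL
    rw [wordOf, List.count_append, ih hL.2, List.count_replicate]
    by_cases h : i = j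
    · subst h; simp [hL.1]
    · simp [h, Ne.symm h]

lemma word_count (α : Fin n → ℕ) (i : Fin n) : (wordOf α (List.finRange n)).count i = α i := by
  rw [wordOf_count _ _ (List.nodup_finRange n)]; simp

lemma word_length (α : Fin n → ℕ) : (wordOf α (List.finRange n)).length = mdeg α := by
  have : ∀ L, (wordOf α L).length = (L.map α).sum := by
    intro L
    induction L with
    | nil => rfl
    | cons i L ih => simp [wordOf, ih, add_comm]
  rw [this, mdeg]
  exact (List.sum_ofFn (f := α) ▸ by rw [List.ofFn_eq_map])

/-- joint directions -/
def eJ : Fin n ⊕ Fin n → En n × En n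
  | Sum.inl i => (eB i, 0)
  | Sum.inr i => (0, eB i)

/-- joint directions, trilinear -/
def e3 : Fin n ⊕ (Fin n ⊕ Fin n) → En n × En n × En n
  | Sum.inl i => (eB i, 0, 0)
  | Sum.inr (Sum.inl i) => (0, eB i, 0)
  | Sum.inr (Sum.inr i) => (0, 0, eB i)

instance sumLawful {A B : Type} [BEq A] [BEq B] [LawfulBEq A] [LawfulBEq B] : LawfulBEq (A ⊕ B) where
  eq_of_beq := by
    rintro (a | a) (b | b) h
    · exact congrArg Sum.inl (eq_of_beq (α := A) h)
    · exact absurd (show false = true from h) (by simp)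
    · exact absurd (show false = true from h) (by simp)
    · exact congrArg Sum.inr (eq_of_beq (α := B) h)
  rfl := by
    rintro (a | a)
    · exact beq_self_eq_true (α := A) a
    · exact beq_self_eq_true (α := B) a

lemma count_map_inl {A B : Type} [BEq A] [BEq B] [LawfulBEq A] [LawfulBEq B] (l : List A) (i : A) :
    (l.map (Sum.inl : A → A ⊕ B)).count (Sum.inl i) = l.count i :=
  List.count_map_of_injective l _ Sum.inl_injective i

lemma count_map_inr {A B : Type} [BEq A] [BEq B] [LawfulBEq A] [LawfulBEq B] (l : List B) (i : B) :
    (l.map (Sum.inr : B → A ⊕ B)).count (Sum.inr i) = l.count i :=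
  List.count_map_of_injective l _ Sum.inr_injective i

lemma count_map_inl' {A B : Type} [BEq A] [BEq B] [LawfulBEq A] [LawfulBEq B] (l : List A) (i : B) :
    (l.map (Sum.inl : A → A ⊕ B)).count (Sum.inr i) = 0 :=
  List.count_eq_zero.2 (by simp)

lemma count_map_inr' {A B : Type} [BEq A] [BEq B] [LawfulBEq A] [LawfulBEq B] (l : List B) (i : A) :
    (l.map (Sum.inr : B → A ⊕ B)).count (Sum.inl i) = 0 :=
  List.count_eq_zero.2 (by simp)

/-- full word of a multiindex -/
def wo (α : Fin n → ℕ) : List (Fin n) := wordOf α (List.finRange n)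

lemma perm_J (l : List (Fin n ⊕ Fin n)) :
    l.Perm ((wo fun i => l.count (Sum.inl i)).map Sum.inl ++
      (wo fun i => l.count (Sum.inr i)).map Sum.inr) := by
  rw [List.perm_iff_count]
  rintro (i | i)
  · rw [List.count_append, count_map_inl, count_map_inr', wo, word_count, add_zero]
  · rw [List.count_append, count_map_inr, count_map_inl', wo, word_count, zero_add]

lemma perm_3 (l : List (Fin n ⊕ (Fin n ⊕ Fin n))) :
    l.Perm (((wo fun i => l.count (Sum.inr (Sum.inr i))).map (fun i => Sum.inr (Sum.inr i)) ++
      (wo fun i => l.count (Sum.inr (Sum.inl i))).map (fun i => Sum.inr (Sum.inl i))) ++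
      (wo fun i => l.count (Sum.inl i)).map Sum.inl) := by
  rw [List.perm_iff_count]
  have hm : ∀ (k : List (Fin n)) (g : Fin n → Fin n ⊕ Fin n),
      (k.map fun i => (Sum.inr (g i) : Fin n ⊕ (Fin n ⊕ Fin n))) = (k.map g).map Sum.inr := by
    intro k g; simp
  rw [hm, hm]
  rintro (i | (i | i))
  · rw [List.count_append, List.count_append, count_map_inl, count_map_inr', count_map_inr',
      wo, word_count]; simp
  · rw [List.count_append, List.count_append, count_map_inl', count_map_inr, count_map_inr,
      count_map_inr', count_map_inl, wo, word_count]; simp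
  · rw [List.count_append, List.count_append, count_map_inl', count_map_inr, count_map_inr,
      count_map_inr, count_map_inl', wo, word_count]; simp

lemma wd_slice_x {U : Set (En n × En n)} (hU : IsOpen U) {b : En n × En n → F}
    (hb : ContDiffOn ℝ (⊤ : ℕ∞) b U) (l : List (Fin n)) (x ξ : En n) (h : (x, ξ) ∈ U) :
    wd eB l (fun y => b (y, ξ)) x = wd eJ (l.map Sum.inl) b (x, ξ) := by
  have := wd_comp (eJ (n := n)) eB Sum.inl (ContinuousLinearMap.inl ℝ (En n) (En n)) (0, ξ)
    (fun i => by simp [eJ]) hU l hb x (by simpa using h)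
  simpa using this

lemma wd_slice_ξ {U : Set (En n × En n)} (hU : IsOpen U) {b : En n × En n → F}
    (hb : ContDiffOn ℝ (⊤ : ℕ∞) b U) (l : List (Fin n)) (x ξ : En n) (h : (x, ξ) ∈ U) :
    wd eB l (fun y => b (x, y)) ξ = wd eJ (l.map Sum.inr) b (x, ξ) := by
  have := wd_comp (eJ (n := n)) eB Sum.inr (ContinuousLinearMap.inr ℝ (En n) (En n)) (x, 0)
    (fun i => by simp [eJ]) hU l hb ξ (by simpa using h)
  simpa using this

/-- nonzero frequencies -/
def Unz (n : ℕ) : Set (En n × En n) := {q | q.2 ≠ 0}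

lemma Unz_open : IsOpen (Unz n) := isOpen_ne_fun continuous_snd continuous_const

lemma joint_word {φ : En n → En n → ℝ}
    (hφ : ContDiffOn ℝ (⊤ : ℕ∞) (fun q : En n × En n => φ q.1 q.2) (Unz n))
    (l : List (Fin n ⊕ Fin n)) (p : En n × En n) (hp : p.2 ≠ 0) :
    wd eJ l (fun q : En n × En n => φ q.1 q.2) p =
      mixedD (fun i => l.count (Sum.inr i)) (fun i => l.count (Sum.inl i)) φ p.1 p.2 := by
  obtain ⟨x, ξ⟩ := p
  rw [wd_perm eJ Unz_open (perm_J l) hφ (show (x, ξ) ∈ Unz n from hp), wd_append,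
    ← wd_slice_ξ Unz_open (wd_smooth eJ Unz_open _ hφ) _ x ξ hp, mixedD, mderiv_word]
  have ho : IsOpen {ζ : En n | ζ ≠ 0} := isOpen_ne_fun continuous_id continuous_const
  refine wd_congr eB ho _ (fun ζ hζ => ?_) hp
  simp only []
  rw [mderiv_word, ← wd_slice_x Unz_open hφ _ x ζ hζ, wo]

lemma wd3_x {b : En n × En n × En n → F} (hb : ContDiff ℝ (⊤ : ℕ∞) b) (l : List (Fin n)) (x ξ η : En n) :
    wd eB l (fun y => b (y, ξ, η)) x = wd e3 (l.map Sum.inl) b (x, ξ, η) := by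
  have := wd_comp (e3 (n := n)) eB Sum.inl (ContinuousLinearMap.inl ℝ (En n) (En n × En n)) (0, ξ, η)
    (fun i => by simp [e3]; rfl) isOpen_univ l hb.contDiffOn x (Set.mem_univ _)
  simpa using this

lemma wd3_ξ {b : En n × En n × En n → F} (hb : ContDiff ℝ (⊤ : ℕ∞) b) (l : List (Fin n)) (x ξ η : En n) :
    wd eB l (fun y => b (x, y, η)) ξ = wd e3 (l.map (fun i => Sum.inr (Sum.inl i))) b (x, ξ, η) := by
  have := wd_comp (e3 (n := n)) eB (fun i => Sum.inr (Sum.inl i))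
    ((ContinuousLinearMap.inr ℝ (En n) (En n × En n)).comp (ContinuousLinearMap.inl ℝ (En n) (En n))) (x, 0, η)
    (fun i => by simp [e3]) isOpen_univ l hb.contDiffOn ξ (Set.mem_univ _)
  simpa using this

lemma wd3_η {b : En n × En n × En n → F} (hb : ContDiff ℝ (⊤ : ℕ∞) b) (l : List (Fin n)) (x ξ η : En n) :
    wd eB l (fun y => b (x, ξ, y)) η = wd e3 (l.map (fun i => Sum.inr (Sum.inr i))) b (x, ξ, η) := by
  have := wd_comp (e3 (n := n)) eB (fun i => Sum.inr (Sum.inr i))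
    ((ContinuousLinearMap.inr ℝ (En n) (En n × En n)).comp (ContinuousLinearMap.inr ℝ (En n) (En n))) (x, ξ, 0)
    (fun i => by simp [e3]) isOpen_univ l hb.contDiffOn η (Set.mem_univ _)
  simpa using this

lemma wd_smooth' {ι E : Type} [NormedAddCommGroup E] [NormedSpace ℝ E] (e : ι → E) (l : List ι) {b : E → F}
    (hb : ContDiff ℝ (⊤ : ℕ∞) b) : ContDiff ℝ (⊤ : ℕ∞) (wd e l b) :=
  contDiffOn_univ.1 (wd_smooth e isOpen_univ l hb.contDiffOn)

lemma joint_word3 {a : En n → En n → En n → ℂ}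
    (ha : ContDiff ℝ (⊤ : ℕ∞) (fun q : En n × En n × En n => a q.1 q.2.1 q.2.2))
    (l : List (Fin n ⊕ (Fin n ⊕ Fin n))) (x ξ η : En n) :
    wd e3 l (fun q : En n × En n × En n => a q.1 q.2.1 q.2.2) (x, ξ, η) =
      d3 (fun i => l.count (Sum.inl i)) (fun i => l.count (Sum.inr (Sum.inl i)))
        (fun i => l.count (Sum.inr (Sum.inr i))) a x ξ η := by
  rw [wd_perm e3 isOpen_univ (perm_3 l) ha.contDiffOn (Set.mem_univ _), wd_append,
    ← wd3_x (wd_smooth' e3 _ ha), d3, mderiv_word, wo]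
  congr 1
  ext y
  rw [wd_append, ← wd3_ξ (wd_smooth' e3 _ ha), d2, mderiv_word, wo]
  congr 1
  ext ζ
  rw [← wd3_η ha, mderiv_word, wo]

/-- weights for the phase -/
def wJ : Fin n ⊕ Fin n → En n × En n → ℝ
  | Sum.inl _, _ => 1
  | Sum.inr _, p => ‖p.2‖⁻¹

/-- bracket -/
def Bk (p : En n × En n × En n) : ℝ := 1 + ‖p.2.1‖ + ‖p.2.2‖

/-- weights for the amplitude -/
def w3 (ρ δ : ℝ) : Fin n ⊕ (Fin n ⊕ Fin n) → En n × En n × En n → ℝ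
  | Sum.inl _, p => Bk p ^ δ
  | Sum.inr _, p => Bk p ^ (-ρ)

lemma Bk_pos (p : En n × En n × En n) : 0 < Bk p := by unfold Bk; positivity

lemma wprod_perm {ι E : Type} (w : ι → E → ℝ) {l l' : List ι} (h : l.Perm l') (p : E) :
    wprod w l p = wprod w l' p := (h.map _).prod_eq

lemma wprod_append {ι E : Type} (w : ι → E → ℝ) (l l' : List ι) (p : E) :
    wprod w (l ++ l') p = wprod w l p * wprod w l' p := by simp [wprod]

lemma wprod_map_const {ι ι' E : Type} (w : ι → E → ℝ) (l : List ι') (g : ι' → ι) (p : E) (c : ℝ)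
    (h : ∀ i, w (g i) p = c) : wprod w (l.map g) p = c ^ l.length := by
  induction l with
  | nil => simp [wprod]
  | cons i l ih =>
    simp only [wprod, List.map_cons, List.prod_cons, List.length_cons, pow_succ, h] at ih ⊢
    rw [ih, mul_comm]

lemma finite_sup {ι : Type} [Finite ι] (N : ℕ) (P : List ι → ℝ → Prop)
    (hm : ∀ l c c', c ≤ c' → P l c → P l c') (h : ∀ l, ∃ c, P l c) :
    ∃ C : ℝ, 0 < C ∧ ∀ l, l.length ≤ N → P l C := by
  choose f hf using h
  have hfin := List.finite_length_le ι N
  obtain ⟨M, hM⟩ := (hfin.image f).bddAbove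
  refine ⟨max M 1, by positivity, fun l hl => hm l _ _ ?_ (hf l)⟩
  exact (hM ⟨l, hl, rfl⟩).trans (le_max_left _ _)

lemma phase_bd {φ : En n → En n → ℝ} (hφ : PhiClass 2 φ) (N : ℕ) :
    ∃ C : ℝ, 0 < C ∧ ∀ l : List (Fin n ⊕ Fin n), l.length ≤ N → 2 ≤ l.length → ∀ p ∈ Unz n,
      |wd eJ l (fun q : En n × En n => φ q.1 q.2) p| ≤ C * (‖p.2‖ * wprod wJ l p) := by
  have hw : ∀ (l : List (Fin n ⊕ Fin n)) (p : En n × En n), 0 ≤ wprod wJ l p := by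
    intro l p
    refine List.prod_nonneg fun x hx => ?_
    obtain ⟨i, _, rfl⟩ := List.mem_map.1 hx
    rcases i with i | i <;> simp [wJ]
  refine finite_sup N (fun l C => 2 ≤ l.length → ∀ p ∈ Unz n,
    |wd eJ l (fun q : En n × En n => φ q.1 q.2) p| ≤ C * (‖p.2‖ * wprod wJ l p)) ?_ ?_
  · intro l c c' hcc h h2 p hp
    exact (h h2 p hp).trans (mul_le_mul_of_nonneg_right hcc (mul_nonneg (norm_nonneg _) (hw _ _)))
  · intro l
    by_cases h2 : 2 ≤ l.length
    swap
    · exact ⟨0, fun h => absurd h h2⟩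
    have hlen := (perm_J l).length_eq
    rw [List.length_append, List.length_map, List.length_map, wo, wo, word_length, word_length] at hlen
    obtain ⟨C, hC⟩ := hφ.2.2 (fun i => l.count (Sum.inr i)) (fun i => l.count (Sum.inl i)) (by omega)
    refine ⟨C, fun _ p hp => ?_⟩
    have hp' : p.2 ≠ 0 := hp
    rw [joint_word hφ.1 l p hp, wprod_perm _ (perm_J l), wprod_append,
      wprod_map_const wJ _ _ p 1 (fun i => rfl), wprod_map_const wJ _ _ p (‖p.2‖⁻¹) (fun i => rfl),
      one_pow, one_mul, wo, word_length]
    have h := hC p.1 p.2 hp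
    have hpos : 0 < ‖p.2‖ := norm_pos_iff.2 hp'
    rw [Real.rpow_sub hpos, Real.rpow_natCast, Real.rpow_one, div_mul_eq_mul_div, div_le_iff₀ hpos] at h
    rw [inv_pow]
    set k := mdeg fun i => List.count (Sum.inr i) l
    have hk : 0 < ‖p.2‖ ^ k := pow_pos hpos k
    rw [← mul_assoc, ← div_eq_mul_inv, le_div_iff₀ hk, mul_comm]
    exact h

lemma amp_bd {a : En n → En n → En n → ℂ} {m ρ δ : ℝ} (ha : HormS2 m ρ δ a) (N : ℕ) :
    ∃ C : ℝ, 0 < C ∧ ∀ l : List (Fin n ⊕ (Fin n ⊕ Fin n)), l.length ≤ N → ∀ p,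
      ‖wd e3 l (fun q : En n × En n × En n => a q.1 q.2.1 q.2.2) p‖ ≤
        C * (Bk p ^ m * wprod (w3 ρ δ) l p) := by
  have hw : ∀ (l : List (Fin n ⊕ (Fin n ⊕ Fin n))) (p : En n × En n × En n), 0 ≤ wprod (w3 ρ δ) l p := by
    intro l p
    refine List.prod_nonneg fun x hx => ?_
    obtain ⟨i, _, rfl⟩ := List.mem_map.1 hx
    rcases i with i | i <;> exact Real.rpow_nonneg (Bk_pos p).le _
  refine finite_sup N (fun l C => ∀ p,
    ‖wd e3 l (fun q : En n × En n × En n => a q.1 q.2.1 q.2.2) p‖ ≤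
        C * (Bk p ^ m * wprod (w3 ρ δ) l p)) ?_ ?_
  · intro l c c' hcc h p
    exact (h p).trans (mul_le_mul_of_nonneg_right hcc
      (mul_nonneg (Real.rpow_nonneg (Bk_pos p).le _) (hw _ _)))
  · intro l
    obtain ⟨C, hC⟩ := ha.2 (fun i => l.count (Sum.inl i)) (fun i => l.count (Sum.inr (Sum.inl i)))
        (fun i => l.count (Sum.inr (Sum.inr i)))
    refine ⟨C, ?_⟩
    rintro ⟨x, ξ, η⟩
    have h := hC x ξ η
    rw [joint_word3 ha.1]
    refine h.trans (le_of_eq ?_)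
    have hB := Bk_pos (x, ξ, η)
    rw [wprod_perm _ (perm_3 l), wprod_append, wprod_append,
      wprod_map_const (w3 ρ δ) _ _ (x, ξ, η) (Bk (x, ξ, η) ^ (-ρ)) (fun i => rfl),
      wprod_map_const (w3 ρ δ) _ _ (x, ξ, η) (Bk (x, ξ, η) ^ (-ρ)) (fun i => rfl),
      wprod_map_const (w3 ρ δ) _ _ (x, ξ, η) (Bk (x, ξ, η) ^ δ) (fun i => rfl),
      wo, wo, wo, word_length, word_length, word_length]
    rw [← Real.rpow_mul_natCast hB.le, ← Real.rpow_mul_natCast hB.le, ← Real.rpow_mul_natCast hB.le,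
      ← Real.rpow_add hB, ← Real.rpow_add hB, ← Real.rpow_add hB]
    congr 2
    ring

end conv

section ftc
variable {n : ℕ}

/-- replace a coordinate -/
def up (i : Fin n) (t : ℝ) (ξ : En n) : En n := ξ + (t - ξ i) • eB i

lemma eB_apply (i j : Fin n) : (eB i : En n) j = if j = i then 1 else 0 := by
  simp [eB]

lemma up_apply (i j : Fin n) (t : ℝ) (ξ : En n) : up i t ξ j = if j = i then t else ξ j := by
  simp only [up, PiLp.add_apply, PiLp.smul_apply, eB_apply]
  split_ifs with h
  · subst h; simp
  · simp

lemma up_self (i : Fin n) (ξ : En n) : up i (ξ i) ξ = ξ := by simp [up]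

lemma up_add (i : Fin n) (t s : ℝ) (ξ : En n) : up i t ξ + s • eB i = up i (t + s) ξ := by
  simp only [up, add_assoc, ← add_smul]; congr 2; ring

lemma up_line (i j : Fin n) (h : i ≠ j) (t s : ℝ) (ξ : En n) :
    up i t (ξ + s • eB j) = up i t ξ + s • eB j := by
  simp only [up, PiLp.add_apply, PiLp.smul_apply, eB_apply, if_neg h, smul_zero, add_zero]
  abel

/-- product set -/
def bx (J : Fin n → Set ℝ) : Set (En n) := {ξ | ∀ i, ξ i ∈ J i}

lemma bx_meas {J : Fin n → Set ℝ} (hJ : ∀ i, MeasurableSet (J i)) : MeasurableSet (bx J) := by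
  have : bx J = ⋂ i, (fun ξ : En n => ξ i) ⁻¹' (J i) := by ext; simp [bx]
  rw [this]
  exact MeasurableSet.iInter fun i => (by fun_prop : Measurable fun ξ : En n => ξ i) (hJ i)

lemma up_mem {J : Fin n → Set ℝ} {i : Fin n} {t : ℝ} {ξ : En n} (hξ : ξ ∈ bx J) (ht : t ∈ J i) :
    up i t ξ ∈ bx J := by
  intro j
  rw [up_apply]
  split_ifs with h
  · subst h; exact ht
  · exact hξ j

/-- good input functions supported in `D` -/
structure FG (D : Set (En n)) (F : En n → ℂ) : Prop where
  meas : Measurable F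
  int : Integrable F volume
  l2 : MemLp F 2 volume
  supp : ∀ ξ, ξ ∉ D → F ξ = 0

lemma FG.mul_bdd {D : Set (En n)} {F : En n → ℂ} (h : FG D F) {σ : En n → ℂ} (hσ : Measurable σ)
    (h1 : ∀ ξ, ‖σ ξ‖ ≤ 1) : FG D (fun ξ => σ ξ * F ξ) where
  meas := hσ.mul h.meas
  int := h.int.bdd_mul hσ.aestronglyMeasurable (c := 1) (Filter.Eventually.of_forall h1)
  l2 := h.l2.mono (hσ.mul h.meas).aestronglyMeasurable (Filter.Eventually.of_forall fun ξ => by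
    rw [norm_mul]; exact mul_le_of_le_one_left (norm_nonneg _) (h1 ξ))
  supp := fun ξ hξ => by rw [h.supp ξ hξ, mul_zero]

lemma FG.norm_mul_bdd {F : En n → ℂ} {σ : En n → ℂ}
    (h1 : ∀ ξ, ‖σ ξ‖ ≤ 1) : eLpNorm (fun ξ => σ ξ * F ξ) 2 volume ≤ eLpNorm F 2 volume :=
  eLpNorm_mono fun ξ => by rw [norm_mul]; exact mul_le_of_le_one_left (norm_nonneg _) (h1 ξ)

/-- signed interval indicator -/
def sgI (p t y : ℝ) : ℂ := if p < t ∧ t ≤ y then 1 else if y < t ∧ t ≤ p then -1 else 0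

lemma sgI_norm (p t y : ℝ) : ‖sgI p t y‖ ≤ 1 := by
  unfold sgI; split_ifs <;> simp

lemma sgI_meas (p : ℝ) : Measurable (fun q : ℝ × ℝ => sgI p q.1 q.2) := by
  unfold sgI
  refine Measurable.ite ?_ measurable_const (Measurable.ite ?_ measurable_const measurable_const)
  · exact (measurableSet_lt measurable_const measurable_fst).inter (measurableSet_le measurable_fst measurable_snd)
  · exact (measurableSet_lt measurable_snd measurable_fst).inter (measurableSet_le measurable_fst measurable_const)

lemma sgI_int (p y : ℝ) (J : Set ℝ) (hJo : J.OrdConnected) (hp : p ∈ J) (hy : y ∈ J)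
    (v : ℝ → ℂ) : ∫ t in J, sgI p t y * v t = ∫ t in p..y, v t := by
  rcases le_total p y with h | h
  · rw [intervalIntegral.integral_of_le h]
    have h1 : ∀ t, sgI p t y * v t = (Set.Ioc p y).indicator v t := by
      intro t
      by_cases ht : t ∈ Set.Ioc p y
      · rw [Set.indicator_of_mem ht, sgI, if_pos ⟨ht.1, ht.2⟩, one_mul]
      · rw [Set.indicator_of_notMem ht, sgI, if_neg (fun hh => ht ⟨hh.1, hh.2⟩), if_neg, zero_mul]
        rintro ⟨a, b⟩; linarith
    simp_rw [h1]
    rw [setIntegral_indicator measurableSet_Ioc]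
    congr 2
    exact Set.inter_eq_right.2 ((Set.Ioc_subset_Icc_self).trans (hJo.out hp hy))
  · rw [intervalIntegral.integral_of_ge h]
    have h1 : ∀ t, sgI p t y * v t = (Set.Ioc y p).indicator (fun t => - v t) t := by
      intro t
      by_cases ht : t ∈ Set.Ioc y p
      · rw [Set.indicator_of_mem ht, sgI, if_neg, if_pos ⟨ht.1, ht.2⟩]
        · ring
        · rintro ⟨a, b⟩; linarith [ht.1, ht.2]
      · rw [Set.indicator_of_notMem ht, sgI, if_neg, if_neg, zero_mul]
        · exact ht
        · rintro ⟨a, b⟩; linarith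
    simp_rw [h1]
    rw [setIntegral_indicator measurableSet_Ioc, integral_neg]
    congr 3
    exact Set.inter_eq_right.2 ((Set.Ioc_subset_Icc_self).trans (hJo.out hy hp))

lemma up_meas (i : Fin n) : Measurable (fun q : ℝ × En n => up i q.1 q.2) := by
  have : Continuous (fun q : ℝ × En n => up i q.1 q.2) := by unfold up; fun_prop
  exact this.measurable

/-- product of weights -/
def wp (w : Fin n → ℝ → ℝ) (l : List (Fin n)) (ξ : En n) : ℝ := (l.map fun i => w i (ξ i)).prod

lemma wp_up {w : Fin n → ℝ → ℝ} {l : List (Fin n)} {i : Fin n} (h : i ∉ l) (t : ℝ) (ξ : En n) :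
    wp w l (up i t ξ) = wp w l ξ := by
  unfold wp
  congr 1
  refine List.map_congr_left fun j hj => ?_
  rw [up_apply, if_neg]
  rintro rfl; exact h hj

lemma wp_nonneg {w : Fin n → ℝ → ℝ} (hw : ∀ i t, 0 ≤ w i t) (l : List (Fin n)) (ξ : En n) : 0 ≤ wp w l ξ := by
  refine List.prod_nonneg fun x hx => ?_
  obtain ⟨i, _, rfl⟩ := List.mem_map.1 hx
  exact hw _ _

/-- hypotheses on the amplitude family -/
structure FV (J : Fin n → Set ℝ) (w : Fin n → ℝ → ℝ) (L : List (Fin n))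
    (V : List (Fin n) → En n → En n → ℂ) (K : ℝ≥0∞) : Prop where
  meas : ∀ l, l.Sublist L → Measurable (fun q : En n × En n => (bx J).indicator (V l q.1) q.2)
  der : ∀ l j, (l ++ [j]).Sublist L → ∀ x, ∀ ξ ∈ bx J,
    HasLineDerivAt ℝ (V l x) (V (l ++ [j]) x ξ) ξ (eB j)
  bd : ∀ l, l.Sublist L → ∀ ξ ∈ bx J,
    eLpNorm (fun x => V l x ξ) 2 volume ≤ K * ENNReal.ofReal (wp w l ξ)
  pbd : ∀ x, ∃ M : ℝ, ∀ l, l.Sublist L → ∀ ξ ∈ bx J, ‖V l x ξ‖ ≤ M * wp w l ξ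
  indep : ∀ l, l.Sublist L → ∀ x, ∀ ξ ∈ bx J, ∀ ξ' ∈ bx J, (∀ j ∈ L, ξ j = ξ' j) → V l x ξ = V l x ξ'

lemma FV.freeze {J : Fin n → Set ℝ} {w : Fin n → ℝ → ℝ} {i : Fin n} {L : List (Fin n)}
    {V : List (Fin n) → En n → En n → ℂ} {K : ℝ≥0∞} (hJm : ∀ i, MeasurableSet (J i))
    (hi : i ∉ L) (l0 : List (Fin n)) (hl0 : ∀ l, l.Sublist L → (l0 ++ l).Sublist (i :: L))
    (c : ℝ) (hc0 : 0 ≤ c)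
    (t : ℝ) (ht : t ∈ J i) (hc : ∀ ξ, up i t ξ = ξ → wp w l0 ξ = c)
    (h : FV J w (i :: L) V K) :
    FV J w L (fun l x ξ => V (l0 ++ l) x (up i t ξ)) (K * ENNReal.ofReal c) := by
  have hup : ∀ ξ : En n, up i t (up i t ξ) = up i t ξ := by
    intro ξ; ext j; simp only [up_apply]; split_ifs <;> rfl
  have hwp : ∀ l, l.Sublist L → ∀ ξ, wp w (l0 ++ l) (up i t ξ) = c * wp w l ξ := by
    intro l hl ξ
    rw [← hc _ (hup ξ), ← wp_up (w := w) (fun hh => hi (hl.subset hh)) t ξ]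
    simp [wp]
  refine ⟨fun l hl => ?_, fun l j hl x ξ hξ => ?_, fun l hl ξ hξ => ?_, fun x => ?_, fun l hl x ξ hξ ξ' hξ' hj => ?_⟩
  · have h1 := (h.meas _ (hl0 l hl)).comp
      ((measurable_fst (α := En n) (β := En n)).prodMk ((up_meas i).comp (measurable_const.prodMk measurable_snd) :
        Measurable fun q : En n × En n => up i t q.2))
    have h2 : (fun q : En n × En n => (bx J).indicator (fun ξ => V (l0 ++ l) q.1 (up i t ξ)) q.2) =
        (Prod.snd ⁻¹' (bx J)).indicator
          (fun q : En n × En n => (bx J).indicator (V (l0 ++ l) q.1) (up i t q.2)) := by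
      ext q
      by_cases hq : q.2 ∈ bx J
      · rw [Set.indicator_of_mem hq, Set.indicator_of_mem (show q ∈ Prod.snd ⁻¹' (bx J) from hq),
          Set.indicator_of_mem (up_mem hq ht)]
      · rw [Set.indicator_of_notMem hq, Set.indicator_of_notMem (show q ∉ Prod.snd ⁻¹' (bx J) from hq)]
    rw [h2]
    exact h1.indicator (measurable_snd (bx_meas hJm))
  · have h1 := h.der (l0 ++ l) j (by rw [List.append_assoc]; exact hl0 _ hl) x _ (up_mem hξ ht)
    have hij : i ≠ j := by rintro rfl; exact hi (hl.subset (by simp))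
    unfold HasLineDerivAt at h1 ⊢
    simp only [up_line i j hij]
    rw [List.append_assoc] at h1
    exact h1
  · refine (h.bd _ (hl0 l hl) _ (up_mem hξ ht)).trans (le_of_eq ?_)
    rw [hwp l hl, ENNReal.ofReal_mul hc0, mul_assoc]
  · obtain ⟨M, hM⟩ := h.pbd x
    refine ⟨M * c, fun l hl ξ hξ => (hM _ (hl0 l hl) _ (up_mem hξ ht)).trans (le_of_eq ?_)⟩
    rw [hwp l hl, mul_assoc]
  · refine h.indep _ (hl0 l hl) x _ (up_mem hξ ht) _ (up_mem hξ' ht) fun k hk => ?_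
    rw [up_apply, up_apply]
    split_ifs with hki
    · rfl
    · exact hj k ((List.mem_cons.1 hk).resolve_left hki)

/-- base operator bound on functions supported in `D` -/
def BaseBd (e : En n → En n → ℂ) (D : Set (En n)) (Bc : ℝ≥0∞) : Prop :=
  ∀ F, FG D F → eLpNorm (fun x => ∫ ξ, e x ξ * F ξ) 2 volume ≤ Bc * eLpNorm F 2 volume

lemma FV.eq_ftc {J : Fin n → Set ℝ} {w : Fin n → ℝ → ℝ} {i : Fin n} {L : List (Fin n)}
    {V : List (Fin n) → En n → En n → ℂ} {K : ℝ≥0∞} (h : FV J w (i :: L) V K)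
    (hJo : ∀ i, (J i).OrdConnected) (p : ℝ) (hp : p ∈ J i)
    (hwi : IntegrableOn (w i) (J i)) (x ξ : En n) (hξ : ξ ∈ bx J) :
    V [] x ξ = V [] x (up i p ξ) + ∫ t in J i, sgI p t (ξ i) * V [i] x (up i t ξ) := by
  rw [sgI_int p (ξ i) (J i) (hJo i) hp (hξ i)]
  have hsub : Set.uIcc p (ξ i) ⊆ J i := (hJo i).uIcc_subset hp (hξ i)
  have hder : ∀ t ∈ Set.uIcc p (ξ i), HasDerivAt (fun t => V [] x (up i t ξ)) (V [i] x (up i t ξ)) t := by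
    intro t ht
    have h1 := h.der [] i (by simp) x _ (up_mem hξ (hsub ht))
    unfold HasLineDerivAt at h1
    simp only [up_add, List.nil_append] at h1
    have h2 : HasDerivAt (fun s : ℝ => V [] x (up i (t + s) ξ)) (V [i] x (up i t ξ)) (t - t) := by
      simpa using h1
    have h3 := h2.comp_sub_const (a := t) (x := t)
    simpa using h3
  have hIntg : IntervalIntegrable (fun t => V [i] x (up i t ξ)) volume p (ξ i) := by
    obtain ⟨M, hM⟩ := h.pbd x
    rw [intervalIntegrable_iff]
    have hsub' : Set.uIoc p (ξ i) ⊆ J i := Set.uIoc_subset_uIcc.trans hsub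
    have hb : IntegrableOn (fun t => M * w i t) (Set.uIoc p (ξ i)) := (hwi.mono_set hsub').const_mul M
    refine Integrable.mono' hb ?_ ?_
    · have h1 : Measurable (fun t => (bx J).indicator (V [i] x) (up i t ξ)) :=
        (h.meas [i] (by simp)).comp (measurable_const.prodMk ((up_meas i).comp (measurable_id.prodMk measurable_const)))
      refine h1.aestronglyMeasurable.congr ?_
      filter_upwards [ae_restrict_mem measurableSet_uIoc] with t ht
      rw [Set.indicator_of_mem (up_mem hξ (hsub' ht))]
    · filter_upwards [ae_restrict_mem measurableSet_uIoc] with t ht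
      have := hM [i] (by simp) _ (up_mem hξ (hsub' ht))
      simpa [wp, up_apply] using this
  rw [intervalIntegral.integral_eq_sub_of_hasDerivAt hder hIntg, up_self]
  ring

theorem ftc_main {e : En n → En n → ℂ} (he : Measurable (Function.uncurry e)) (he1 : ∀ x ξ, ‖e x ξ‖ ≤ 1)
    {J : Fin n → Set ℝ} (hJm : ∀ i, MeasurableSet (J i)) (hJo : ∀ i, (J i).OrdConnected)
    (p : Fin n → ℝ) (hp : ∀ i, p i ∈ J i) {w : Fin n → ℝ → ℝ} (hw0 : ∀ i t, 0 ≤ w i t)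
    (hwm : ∀ i, Measurable (w i))
    (hwi : ∀ i, IntegrableOn (w i) (J i)) {W : ℝ≥0∞} (hW : ∀ i, ∫⁻ t in J i, ENNReal.ofReal (w i t) ≤ W)
    {Bc : ℝ≥0∞} (hbase : BaseBd e (bx J) Bc) :
    ∀ L : List (Fin n), L.Nodup → ∀ V K, FV J w L V K → ∀ F, FG (bx J) F →
      ∫⁻ x, ‖∫ ξ, e x ξ * V [] x ξ * F ξ‖ₑ ≤ Bc * K * (1 + W) ^ L.length * eLpNorm F 2 volume := by
  have hD := bx_meas hJm
  intro L
  induction L with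
  | nil =>
    intro _ V K hV F hF
    have hpD : (WithLp.toLp 2 p : En n) ∈ bx J := hp
    set v : En n → ℂ := fun x => V [] x (WithLp.toLp 2 p) with hv
    have h1 : ∀ x, ∫ ξ, e x ξ * V [] x ξ * F ξ = v x * ∫ ξ, e x ξ * F ξ := by
      intro x
      rw [← integral_const_mul]
      refine integral_congr_ae (Filter.Eventually.of_forall fun ξ => ?_)
      by_cases hξ : ξ ∈ bx J
      · simp only [hv]
        rw [hV.indep [] (by simp) x ξ hξ _ hpD (by simp)]; ring
      · simp only [hF.supp ξ hξ, mul_zero]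
    simp_rw [h1, enorm_mul]
    have hvm : Measurable v := by
      have := (hV.meas [] (by simp)).comp (measurable_id.prodMk measurable_const : Measurable fun x : En n => (x, (WithLp.toLp 2 p : En n)))
      convert this using 1
      ext x
      simp [hv, Set.indicator_of_mem hpD]
    have hSm : Measurable fun x => ∫ ξ, e x ξ * F ξ := by
      have : StronglyMeasurable (fun q : En n × En n => e q.1 q.2 * F q.2) :=
        (he.mul (hF.meas.comp measurable_snd)).stronglyMeasurable
      exact this.integral_prod_right'.measurable
    have h2 := ENNReal.lintegral_mul_le_Lp_mul_Lq volume Real.HolderConjugate.two_two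
      hvm.enorm.aemeasurable hSm.enorm.aemeasurable
    refine h2.trans ?_
    have h3 : ∀ g : En n → ℂ, (∫⁻ x, ‖g x‖ₑ ^ (2:ℝ)) ^ (1 / (2:ℝ)) = eLpNorm g 2 volume := by
      intro g
      rw [eLpNorm_eq_lintegral_rpow_enorm_toReal (by simp) (by simp)]
      simp
    rw [h3, h3]
    have h4 := hV.bd [] (by simp) _ hpD
    simp only [wp, List.map_nil, List.prod_nil, ENNReal.ofReal_one, mul_one] at h4
    calc eLpNorm v 2 volume * eLpNorm (fun x => ∫ ξ, e x ξ * F ξ) 2 volume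
        ≤ K * (Bc * eLpNorm F 2 volume) := mul_le_mul' h4 (hbase F hF)
      _ = _ := by simp; ring
  | cons i L ih =>
    intro hnd V K hV F hF
    rw [List.nodup_cons] at hnd
    have hVp := hV.freeze hJm hnd.1 [] (fun l hl => hl.cons i) 1 zero_le_one (p i) (hp i) (fun ξ _ => by simp [wp])
    have hVt : ∀ t ∈ J i, FV J w L (fun l x ξ => V ([i] ++ l) x (up i t ξ)) (K * ENNReal.ofReal (w i t)) :=
      fun t ht => hV.freeze hJm hnd.1 [i] (fun l hl => hl.cons_cons i) (w i t) (hw0 i t) t ht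
        (fun ξ hξ => by
          have : ξ i = t := by rw [← hξ, up_apply, if_pos rfl]
          simp [wp, this])
    have hsm : ∀ t, Measurable fun ξ : En n => sgI (p i) t (ξ i) := fun t =>
      (sgI_meas (p i)).comp (measurable_const.prodMk (by fun_prop))
    have hFt : ∀ t, FG (bx J) (fun ξ => sgI (p i) t (ξ i) * F ξ) := fun t => hF.mul_bdd (hsm t) (fun ξ => sgI_norm _ _ _)
    have B1 := ih hnd.2 _ _ hVp F hF
    have B2 := fun t ht => ih hnd.2 _ _ (hVt t ht) _ (hFt t)
    simp only [List.nil_append, List.append_nil] at B1 B2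
    -- the jointly measurable integrand
    set Θ : En n → ℝ → En n → ℂ := fun x t ξ =>
      e x ξ * (bx J).indicator (V [i] x) (up i t ξ) * (sgI (p i) t (ξ i) * F ξ) with hΘ
    have hΘm : Measurable (fun q : (En n × ℝ) × En n => Θ q.1.1 q.1.2 q.2) := by
      refine Measurable.mul (Measurable.mul ?_ ?_) (Measurable.mul ?_ ?_)
      · exact he.comp ((measurable_fst.comp measurable_fst).prodMk measurable_snd)
      · exact (hV.meas [i] (by simp)).comp ((measurable_fst.comp measurable_fst).prodMk
          ((up_meas i).comp ((measurable_snd.comp measurable_fst).prodMk measurable_snd)))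
      · exact (sgI_meas (p i)).comp ((measurable_snd.comp measurable_fst).prodMk
          ((by fun_prop : Measurable fun ξ : En n => ξ i).comp measurable_snd))
      · exact hF.meas.comp measurable_snd
    have hΘe : ∀ x, ∀ t ∈ J i, ∀ ξ, Θ x t ξ = e x ξ * V [i] x (up i t ξ) * (sgI (p i) t (ξ i) * F ξ) := by
      intro x t ht ξ
      simp only [hΘ]
      by_cases hξ : ξ ∈ bx J
      · rw [Set.indicator_of_mem (up_mem hξ ht)]
      · rw [hF.supp ξ hξ]; simp
    set Ψ : En n → ℝ → ℂ := fun x t => ∫ ξ, Θ x t ξ with hΨ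
    have hΨm : Measurable (Function.uncurry Ψ) := hΘm.stronglyMeasurable.integral_prod_right'.measurable
    set I1 : En n → ℂ := fun x => ∫ ξ, e x ξ * V [] x (up i (p i) ξ) * F ξ with hI1
    have key : ∀ x, ∫ ξ, e x ξ * V [] x ξ * F ξ = I1 x + ∫ t in J i, Ψ x t := by
      intro x
      obtain ⟨M, hM⟩ := hV.pbd x
      have hex : Measurable (e x) := he.comp (measurable_const.prodMk measurable_id)
      have hint1 : Integrable (fun ξ => e x ξ * V [] x (up i (p i) ξ) * F ξ) := by
        refine Integrable.mono' (g := fun ξ => M * ‖F ξ‖) (hF.int.norm.const_mul M) ?_ ?_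
        · have hm1 : Measurable (fun ξ => e x ξ * (bx J).indicator (V [] x) (up i (p i) ξ) * F ξ) :=
            (hex.mul ((hV.meas [] (by simp)).comp (measurable_const.prodMk
              ((up_meas i).comp (measurable_const.prodMk measurable_id))))).mul hF.meas
          refine hm1.aestronglyMeasurable.congr (Filter.Eventually.of_forall fun ξ => ?_)
          by_cases hξ : ξ ∈ bx J
          · simp only [Set.indicator_of_mem (up_mem hξ (hp i))]
          · simp only [hF.supp ξ hξ, mul_zero]
        · refine Filter.Eventually.of_forall fun ξ => ?_
          by_cases hξ : ξ ∈ bx J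
          · have hb := hM [] (by simp) _ (up_mem hξ (hp i))
            simp only [wp, List.map_nil, List.prod_nil, mul_one] at hb
            rw [norm_mul, norm_mul]
            refine mul_le_mul_of_nonneg_right ?_ (norm_nonneg _)
            calc _ ≤ 1 * M := mul_le_mul (he1 x ξ) hb (norm_nonneg _) zero_le_one
              _ = M := one_mul M
          · simp [hF.supp ξ hξ]
      have hint2 : Integrable (fun q : En n × ℝ => Θ x q.2 q.1) (volume.prod (volume.restrict (J i))) := by
        refine Integrable.mono' (g := fun q : En n × ℝ => ‖F q.1‖ * (M * w i q.2))
          (hF.int.norm.mul_prod ((hwi i).const_mul M)) ?_ ?_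
        · exact (hΘm.comp ((measurable_const.prodMk measurable_snd).prodMk measurable_fst)).aestronglyMeasurable
        · have hae : ∀ᵐ q : En n × ℝ ∂(volume.prod (volume.restrict (J i))), q.2 ∈ J i :=
            Measure.quasiMeasurePreserving_snd.ae (ae_restrict_mem (hJm i))
          filter_upwards [hae] with q hq
          rw [hΘe x q.2 hq]
          by_cases hξ : q.1 ∈ bx J
          · have hb := hM [i] (by simp) _ (up_mem hξ hq)
            simp only [wp, List.map_cons, List.map_nil, List.prod_cons, List.prod_nil, mul_one, up_apply, if_true] at hb
            rw [norm_mul, norm_mul, norm_mul]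
            have hs := sgI_norm (p i) q.2 (q.1 i)
            calc ‖e x q.1‖ * ‖V [i] x (up i q.2 q.1)‖ * (‖sgI (p i) q.2 (q.1 i)‖ * ‖F q.1‖)
                ≤ 1 * (M * w i q.2) * (1 * ‖F q.1‖) := by
                  have := he1 x q.1
                  have h0 := (norm_nonneg _).trans hb
                  gcongr
              _ = _ := by ring
          · simp [hF.supp _ hξ]
      have hpt : ∀ ξ, e x ξ * V [] x ξ * F ξ =
          e x ξ * V [] x (up i (p i) ξ) * F ξ + ∫ t in J i, Θ x t ξ := by
        intro ξ
        have hc : ∫ t in J i, Θ x t ξ = ∫ t in J i, (e x ξ * F ξ) * (sgI (p i) t (ξ i) * V [i] x (up i t ξ)) := by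
          refine setIntegral_congr_fun (hJm i) fun t ht => ?_
          simp only [hΘe x t ht]; ring
        rw [hc, integral_const_mul]
        by_cases hξ : ξ ∈ bx J
        · rw [hV.eq_ftc hJo (p i) (hp i) (hwi i) x ξ hξ]; ring
        · simp [hF.supp ξ hξ]
      simp_rw [hpt]
      rw [integral_add hint1 hint2.integral_prod_left]
      congr 1
      exact integral_integral_swap hint2
    have hI1m : Measurable I1 := by
      have hm1 : Measurable (fun q : En n × En n => e q.1 q.2 * (bx J).indicator (V [] q.1) (up i (p i) q.2) * F q.2) :=
        (he.mul ((hV.meas [] (by simp)).comp (measurable_fst.prodMk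
          ((up_meas i).comp (measurable_const.prodMk measurable_snd))))).mul (hF.meas.comp measurable_snd)
      have := (hm1.stronglyMeasurable.integral_prod_right' (ν := volume)).measurable
      convert this using 1
      ext x
      refine integral_congr_ae (Filter.Eventually.of_forall fun ξ => ?_)
      by_cases hξ : ξ ∈ bx J
      · simp only [Set.indicator_of_mem (up_mem hξ (hp i))]
      · simp only [hF.supp ξ hξ, mul_zero]
    simp_rw [key]
    calc ∫⁻ x, ‖I1 x + ∫ t in J i, Ψ x t‖ₑ
        ≤ ∫⁻ x, (‖I1 x‖ₑ + ∫⁻ t in J i, ‖Ψ x t‖ₑ) := lintegral_mono fun x =>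
          (enorm_add_le _ _).trans (add_le_add le_rfl (enorm_integral_le_lintegral_enorm _))
      _ = (∫⁻ x, ‖I1 x‖ₑ) + ∫⁻ x, ∫⁻ t in J i, ‖Ψ x t‖ₑ := lintegral_add_left hI1m.enorm _
      _ = (∫⁻ x, ‖I1 x‖ₑ) + ∫⁻ t in J i, ∫⁻ x, ‖Ψ x t‖ₑ := by
          congr 1
          exact lintegral_lintegral_swap hΨm.enorm.aemeasurable
      _ ≤ Bc * K * (1 + W) ^ L.length * eLpNorm F 2 volume +
          ∫⁻ t in J i, (Bc * K * (1 + W) ^ L.length * eLpNorm F 2 volume) * ENNReal.ofReal (w i t) := by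
          refine add_le_add (by simpa using B1) (setLIntegral_mono' (hJm i) fun t ht => ?_)
          have hB := B2 t ht
          have he : ∀ x, Ψ x t = ∫ ξ, e x ξ * V [i] x (up i t ξ) * (sgI (p i) t (ξ i) * F ξ) := fun x =>
            integral_congr_ae (Filter.Eventually.of_forall fun ξ => hΘe x t ht ξ)
          simp_rw [he]
          refine hB.trans ?_
          calc _ ≤ Bc * (K * ENNReal.ofReal (w i t)) * (1 + W) ^ L.length * eLpNorm F 2 volume :=
                mul_le_mul' le_rfl (FG.norm_mul_bdd fun ξ => sgI_norm _ _ _)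
            _ = _ := by ring
      _ = Bc * K * (1 + W) ^ L.length * eLpNorm F 2 volume * (1 + ∫⁻ t in J i, ENNReal.ofReal (w i t)) := by
          rw [lintegral_const_mul _ (by exact (hwm i).ennreal_ofReal)]; ring
      _ ≤ Bc * K * (1 + W) ^ L.length * eLpNorm F 2 volume * (1 + W) := by gcongr; exact hW i
      _ = _ := by rw [List.length_cons, pow_succ]; ring

end ftc

section ftclin
variable {n : ℕ}

lemma fatou_bd {f : ℕ → En n → ℂ} {g : En n → ℂ} {C : ℝ≥0∞} (hf : ∀ k, AEStronglyMeasurable (f k) volume)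
    (hlim : ∀ x, Filter.Tendsto (fun k => f k x) Filter.atTop (nhds (g x)))
    (hC : ∀ k, eLpNorm (f k) 2 volume ≤ C) : eLpNorm g 2 volume ≤ C := by
  refine (Lp.eLpNorm_lim_le_liminf_eLpNorm hf g (Filter.Eventually.of_forall hlim)).trans ?_
  calc Filter.liminf (fun k => eLpNorm (f k) 2 volume) Filter.atTop
      ≤ Filter.liminf (fun _ : ℕ => C) Filter.atTop := Filter.liminf_le_liminf (Filter.Eventually.of_forall hC)
    _ = C := Filter.liminf_const C

lemma T_meas {e : En n → En n → ℂ} (he : Measurable (Function.uncurry e)) {F : En n → ℂ} (hF : Measurable F) :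
    Measurable fun x => ∫ ξ, e x ξ * F ξ := by
  have : StronglyMeasurable (fun q : En n × En n => e q.1 q.2 * F q.2) :=
    (he.mul (hF.comp measurable_snd)).stronglyMeasurable
  exact this.integral_prod_right'.measurable

theorem ftc_lin {e : En n → En n → ℂ} (he : Measurable (Function.uncurry e)) (he1 : ∀ x ξ, ‖e x ξ‖ ≤ 1)
    {J : Fin n → Set ℝ} (hJm : ∀ i, MeasurableSet (J i)) (hJo : ∀ i, (J i).OrdConnected)
    (p : Fin n → ℝ) (hp : ∀ i, p i ∈ J i) {w : Fin n → ℝ → ℝ} (hw0 : ∀ i t, 0 ≤ w i t)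
    (hwm : ∀ i, Measurable (w i))
    (hwi : ∀ i, IntegrableOn (w i) (J i)) {W : ℝ≥0∞} (hW : ∀ i, ∫⁻ t in J i, ENNReal.ofReal (w i t) ≤ W)
    {Bc : ℝ≥0∞} (hbase : BaseBd e (bx J) Bc) (U : List (Fin n) → En n → En n → ℂ) (K : ℝ)
    (hm : ∀ l : List (Fin n), l.length ≤ n →
      Measurable (fun q : En n × En n => (bx J).indicator (U l q.1) q.2))
    (hder : ∀ l j, l.length < n → ∀ x, ∀ ξ ∈ bx J,
      HasLineDerivAt ℝ (U l x) (U (l ++ [j]) x ξ) ξ (eB j))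
    (hbd : ∀ l : List (Fin n), l.Nodup → ∀ x, ∀ ξ ∈ bx J, ‖U l x ξ‖ ≤ K * wp w l ξ)
    {F : En n → ℂ} (hF : FG (bx J) F) :
    eLpNorm (fun x => ∫ ξ, e x ξ * U [] x ξ * F ξ) 2 volume ≤
      Bc * ENNReal.ofReal K * (1 + W) ^ n * eLpNorm F 2 volume := by
  have hD := bx_meas hJm
  have hK : 0 ≤ K := by
    have h := hbd [] (by simp) 0 (WithLp.toLp 2 p) hp
    simp only [wp, List.map_nil, List.prod_nil, mul_one] at h
    exact (norm_nonneg _).trans h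
  set S : En n → ℂ := fun x => ∫ ξ, e x ξ * U [] x ξ * F ξ with hS
  have hSm : Measurable S := by
    have hm1 : Measurable (fun q : En n × En n => e q.1 q.2 * (bx J).indicator (U [] q.1) q.2 * F q.2) :=
        (he.mul (hm [] (by simp))).mul (hF.meas.comp measurable_snd)
    have := (hm1.stronglyMeasurable.integral_prod_right' (ν := volume)).measurable
    convert this using 1
    ext x
    refine integral_congr_ae (Filter.Eventually.of_forall fun ξ => ?_)
    by_cases hξ : ξ ∈ bx J
    · simp only [Set.indicator_of_mem hξ]
    · simp only [hF.supp ξ hξ, mul_zero]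
  set M := K * ∫ ξ, ‖F ξ‖ with hM
  have hSb : ∀ x, ‖S x‖ ≤ M := by
    intro x
    rw [hM, ← integral_const_mul]
    refine norm_integral_le_of_norm_le (hF.int.norm.const_mul K) (Filter.Eventually.of_forall fun ξ => ?_)
    by_cases hξ : ξ ∈ bx J
    · have h := hbd [] (by simp) x ξ hξ
      simp only [wp, List.map_nil, List.prod_nil, mul_one] at h
      rw [norm_mul, norm_mul]
      refine mul_le_mul_of_nonneg_right ?_ (norm_nonneg _)
      calc _ ≤ 1 * K := mul_le_mul (he1 x ξ) h (norm_nonneg _) zero_le_one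
        _ = K := one_mul K
    · simp [hF.supp ξ hξ]
  set u : ℕ → En n → ℂ := fun k => (Metric.ball 0 k).indicator S with hu
  have hum : ∀ k, Measurable (u k) := fun k => hSm.indicator measurableSet_ball
  have hub : ∀ k x, ‖u k x‖ ≤ M := fun k x => (norm_indicator_le_norm_self _ _).trans (hSb x)
  refine fatou_bd (f := u) (fun k => (hum k).aestronglyMeasurable) ?_ ?_
  · intro x
    refine tendsto_const_nhds.congr' ?_
    obtain ⟨k0, hk0⟩ := exists_nat_gt ‖x‖
    filter_upwards [Filter.eventually_ge_atTop k0] with k hk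
    rw [hu]
    have : x ∈ Metric.ball (0 : En n) k := by
      rw [mem_ball_zero_iff]; exact hk0.trans_le (by exact_mod_cast hk)
    simp only [Set.indicator_of_mem this]
  · intro k
    have hfin : eLpNorm (u k) 2 volume ≠ ⊤ := by
      have h1 : MemLp S 2 (volume.restrict (Metric.ball (0 : En n) k)) := by
        have : IsFiniteMeasure (volume.restrict (Metric.ball (0 : En n) k)) :=
          ⟨by rw [Measure.restrict_apply_univ]; exact measure_ball_lt_top⟩
        exact MemLp.of_bound hSm.aestronglyMeasurable M (Filter.Eventually.of_forall hSb)
      rw [hu, eLpNorm_indicator_eq_eLpNorm_restrict measurableSet_ball]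
      exact h1.eLpNorm_ne_top
    have hFV : FV J w (List.finRange n) (fun l x ξ => U l x ξ * u k x)
        (ENNReal.ofReal K * eLpNorm (u k) 2 volume) := by
      refine ⟨fun l hl => ?_, fun l j hl x ξ hξ => ?_, fun l hl ξ hξ => ?_, fun x => ?_, fun l hl x ξ hξ ξ' hξ' hj => ?_⟩
      · have h1 := (hm l (by simpa using hl.length_le)).mul ((hum k).comp (measurable_fst (α := En n) (β := En n)))
        convert h1 using 1
        ext q
        by_cases hq : q.2 ∈ bx J <;> simp [hq]
      · have h1 := hder l j (by have := hl.length_le; simp at this; omega) x ξ hξ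
        unfold HasLineDerivAt at h1 ⊢
        exact h1.mul_const _
      · have h1 : eLpNorm (fun x => U l x ξ * u k x) 2 volume ≤ eLpNorm (fun x => ((K * wp w l ξ : ℝ) : ℂ) * u k x) 2 volume := by
          refine eLpNorm_mono fun x => ?_
          rw [norm_mul, norm_mul]
          refine mul_le_mul_of_nonneg_right ((hbd l (hl.nodup (List.nodup_finRange n)) x ξ hξ).trans ?_) (norm_nonneg _)
          rw [Complex.norm_real]; exact le_abs_self _
        refine h1.trans (le_of_eq ?_)
        have h2 := eLpNorm_const_smul ((K * wp w l ξ : ℝ) : ℂ) (u k) 2 (volume : Measure (En n))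
        change eLpNorm (((K * wp w l ξ : ℝ) : ℂ) • u k) 2 volume = _
        rw [h2]
        have hnn : 0 ≤ K * wp w l ξ := mul_nonneg hK (wp_nonneg hw0 _ _)
        have : ‖((K * wp w l ξ : ℝ) : ℂ)‖ₑ = ENNReal.ofReal (K * wp w l ξ) := by
          rw [← ofReal_norm, Complex.norm_real, Real.norm_of_nonneg hnn]
        rw [this, ENNReal.ofReal_mul hK]; ring
      · refine ⟨K * M, fun l hl ξ hξ => ?_⟩
        rw [norm_mul]
        calc _ ≤ (K * wp w l ξ) * M := mul_le_mul (hbd l (hl.nodup (List.nodup_finRange n)) x ξ hξ) (hub k x)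
              (norm_nonneg _) (mul_nonneg hK (wp_nonneg hw0 _ _))
          _ = _ := by ring
      · have : ξ = ξ' := by ext j; exact hj j (List.mem_finRange j)
        rw [this]
    have h3 := ftc_main he he1 hJm hJo p hp hw0 hwm hwi hW hbase _ (List.nodup_finRange n) _ _ hFV F hF
    have h4 : ∀ x, ‖∫ ξ, e x ξ * (U [] x ξ * u k x) * F ξ‖ₑ = ‖u k x‖ₑ ^ 2 := by
      intro x
      have h5 : ∫ ξ, e x ξ * (U [] x ξ * u k x) * F ξ = u k x * S x := by
        rw [hS]
        simp only []
        rw [← integral_const_mul]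
        refine integral_congr_ae (Filter.Eventually.of_forall fun ξ => ?_)
        simp only []; ring
      rw [h5, enorm_mul, hu]
      by_cases hx : x ∈ Metric.ball (0 : En n) k
      · simp only [Set.indicator_of_mem hx]; ring
      · simp only [Set.indicator_of_notMem hx]; simp
    simp_rw [h4] at h3
    rw [← eLpNorm_two_sq, List.length_finRange] at h3
    by_cases h0 : eLpNorm (u k) 2 volume = 0
    · rw [h0]; exact zero_le
    rw [sq] at h3
    refine (ENNReal.mul_le_mul_iff_left h0 hfin).1 (h3.trans (le_of_eq ?_))
    ring

/-- frequency directions -/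
def eX (i : Fin n) : En n × En n := (0, eB i)

lemma meas_ind {D : Set (En n)} (hD : MeasurableSet D) {b : En n × En n → ℂ}
    (hb : ContinuousOn b (Set.univ ×ˢ D)) : Measurable (fun q : En n × En n => D.indicator (fun ξ => b (q.1, ξ)) q.2) := by
  have hs : MeasurableSet ((Set.univ : Set (En n)) ×ˢ D) := MeasurableSet.univ.prod hD
  have h1 := hb.measurable_piecewise (g := fun _ => 0) continuousOn_const hs
  convert h1 using 1
  ext q
  by_cases hq : q.2 ∈ D
  · rw [Set.indicator_of_mem hq, Set.piecewise_eq_of_mem _ _ _ (show q ∈ Set.univ ×ˢ D from ⟨trivial, hq⟩)]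
  · rw [Set.indicator_of_notMem hq, Set.piecewise_eq_of_notMem _ _ _ (fun h => hq h.2)]

lemma line_slice {b : En n × En n → ℂ} {b' : ℂ} {x ξ v : En n} (h : HasLineDerivAt ℝ b b' (x, ξ) (0, v)) :
    HasLineDerivAt ℝ (fun ξ => b (x, ξ)) b' ξ v := by
  unfold HasLineDerivAt at h ⊢
  simpa using h

lemma base_empty {D : Set (En n)} (h : ¬ D.Nonempty) {F : En n → ℂ} (hF : FG D F) :
    F = fun _ => 0 := by
  ext ξ
  exact hF.supp ξ fun hξ => h ⟨ξ, hξ⟩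

theorem ftc_cl {e : En n → En n → ℂ} (he : Measurable (Function.uncurry e)) (he1 : ∀ x ξ, ‖e x ξ‖ ≤ 1)
    {J : Fin n → Set ℝ} (hJm : ∀ i, MeasurableSet (J i)) (hJo : ∀ i, (J i).OrdConnected)
    {ℓ : ℝ} (hℓ : 0 < ℓ) (hJ : ∀ i, volume (J i) ≤ ENNReal.ofReal ℓ)
    {Bc : ℝ≥0∞} (hbase : BaseBd e (bx J) Bc) {b : En n × En n → ℂ} {K : ℝ}
    (hb : Cl eX (fun _ _ => ℓ⁻¹) (Set.univ ×ˢ bx J) n (fun _ => K) b)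
    {F : En n → ℂ} (hF : FG (bx J) F) :
    eLpNorm (fun x => ∫ ξ, e x ξ * b (x, ξ) * F ξ) 2 volume ≤
      Bc * ENNReal.ofReal K * 2 ^ n * eLpNorm F 2 volume := by
  by_cases hne : (bx J).Nonempty
  swap
  · rw [base_empty hne hF]; simp
  obtain ⟨p, hp⟩ := hne
  obtain ⟨U, hU0, hU1, hU2, hU3⟩ := hb.family
  have := ftc_lin he he1 hJm hJo (fun i => p i) hp (w := fun _ _ => ℓ⁻¹) (fun _ _ => by positivity)
    (fun _ => measurable_const) (fun i => integrableOn_const ((hJ i).trans_lt ENNReal.ofReal_lt_top).ne) (W := 1)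
    (fun i => by
      rw [setLIntegral_const]
      calc ENNReal.ofReal ℓ⁻¹ * volume (J i) ≤ ENNReal.ofReal ℓ⁻¹ * ENNReal.ofReal ℓ := by gcongr; exact hJ i
        _ = 1 := by rw [← ENNReal.ofReal_mul (by positivity), inv_mul_cancel₀ hℓ.ne', ENNReal.ofReal_one])
    hbase (fun l x ξ => U l (x, ξ)) K
    (fun l hl => meas_ind (bx_meas hJm) (hU1 l hl))
    (fun l j hl x ξ hξ => line_slice (hU2 l hl j (x, ξ) ⟨trivial, hξ⟩))
    (fun l hl x ξ hξ => by
      have hlen : l.length ≤ n := by simpa using hl.length_le_card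
      have := (hU3 l hlen).bd (x, ξ) ⟨trivial, hξ⟩
      simpa [wprod, wp] using this) hF
  rw [hU0] at this
  rw [one_add_one_eq_two] at this
  exact this

end ftclin

section phase
variable {n : ℕ}

/-- word derivatives of the phase -/
def PW (φ : En n → En n → ℝ) (l : List (Fin n ⊕ Fin n)) (x ξ : En n) : ℝ :=
  wd eJ l (fun q : En n × En n => φ q.1 q.2) (x, ξ)

lemma vec_sum (v : En n) : v = ∑ i, v i • (eB i : En n) := by
  ext j
  simp [eB_apply]

lemma eB_norm (i : Fin n) : ‖(eB i : En n)‖ = 1 := by simp [eB]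

lemma coord_le (v : En n) (i : Fin n) : |v i| ≤ ‖v‖ := by
  simpa using PiLp.norm_apply_le v i

lemma norm_le_coord (v : En n) {M : ℝ} (h : ∀ i, |v i| ≤ M) : ‖v‖ ≤ n * M := by
  rw [vec_sum v]
  refine (norm_sum_le _ _).trans ?_
  calc ∑ i, ‖v i • (eB i : En n)‖ ≤ ∑ _i : Fin n, M :=
        Finset.sum_le_sum fun i _ => by rw [norm_smul, eB_norm, mul_one]; exact h i
    _ = n * M := by simp

lemma clm_bd {F : Type} [NormedAddCommGroup F] [NormedSpace ℝ F] (L : En n →L[ℝ] F) {M : ℝ} (hM : 0 ≤ M)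
    (h : ∀ i, ‖L (eB i)‖ ≤ M) : ‖L‖ ≤ n * M := by
  refine L.opNorm_le_bound (by positivity) fun v => ?_
  conv_lhs => rw [vec_sum v]
  rw [map_sum]
  refine (norm_sum_le _ _).trans ?_
  calc ∑ i, ‖L (v i • (eB i : En n))‖ ≤ ∑ _i : Fin n, ‖v‖ * M :=
        Finset.sum_le_sum fun i _ => by
          rw [map_smul, norm_smul]
          exact mul_le_mul (coord_le v i) (h i) (norm_nonneg _) (norm_nonneg _)
    _ = n * M * ‖v‖ := by simp; ring

lemma mv_seg {F : Type} [NormedAddCommGroup F] [NormedSpace ℝ F] {g : En n → F} {g' : En n → En n →L[ℝ] F} {ξ η : En n} {M : ℝ} (hM : 0 ≤ M)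
    (hg : ∀ ζ ∈ segment ℝ η ξ, HasFDerivAt g (g' ζ) ζ)
    (hb : ∀ ζ ∈ segment ℝ η ξ, ∀ i, ‖g' ζ (eB i)‖ ≤ M) : ‖g ξ - g η‖ ≤ n * M * ‖ξ - η‖ :=
  Convex.norm_image_sub_le_of_norm_hasFDerivWithin_le (fun ζ hζ => (hg ζ hζ).hasFDerivWithinAt)
    (fun ζ hζ => clm_bd _ hM (hb ζ hζ)) (convex_segment η ξ) (left_mem_segment ℝ η ξ) (right_mem_segment ℝ η ξ)

variable {φ : En n → En n → ℝ}

lemma PW_diff (hφ : PhiClass 2 φ) (l : List (Fin n ⊕ Fin n)) {x ξ : En n} (hξ : ξ ≠ 0) :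
    HasFDerivAt (fun q : En n × En n => PW φ l q.1 q.2)
      (fderiv ℝ (wd eJ l (fun q : En n × En n => φ q.1 q.2)) (x, ξ)) (x, ξ) :=
  (smooth_at Unz_open (wd_smooth eJ Unz_open l hφ.1) (show (x, ξ) ∈ Unz n from hξ)).hasFDerivAt

lemma PW_contOn (hφ : PhiClass 2 φ) (l : List (Fin n ⊕ Fin n)) :
    ContinuousOn (fun q : En n × En n => PW φ l q.1 q.2) (Unz n) :=
  (wd_smooth eJ Unz_open l hφ.1).continuousOn

/-- x-gradient -/
def PWx (φ : En n → En n → ℝ) (l : List (Fin n ⊕ Fin n)) (x ξ : En n) : En n →L[ℝ] ℝ :=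
  (fderiv ℝ (wd eJ l (fun q : En n × En n => φ q.1 q.2)) (x, ξ)).comp
    (ContinuousLinearMap.inl ℝ (En n) (En n))

/-- ξ-gradient -/
def PWξ (φ : En n → En n → ℝ) (l : List (Fin n ⊕ Fin n)) (x ξ : En n) : En n →L[ℝ] ℝ :=
  (fderiv ℝ (wd eJ l (fun q : En n × En n => φ q.1 q.2)) (x, ξ)).comp
    (ContinuousLinearMap.inr ℝ (En n) (En n))

lemma PWx_apply (l : List (Fin n ⊕ Fin n)) (x ξ : En n) (i : Fin n) :
    PWx φ l x ξ (eB i) = PW φ (l ++ [Sum.inl i]) x ξ := by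
  simp only [PWx, PW, wd_concat]; simp [eJ]

lemma PWξ_apply (l : List (Fin n ⊕ Fin n)) (x ξ : En n) (i : Fin n) :
    PWξ φ l x ξ (eB i) = PW φ (l ++ [Sum.inr i]) x ξ := by
  simp only [PWξ, PW, wd_concat]; simp [eJ]

lemma PW_dx (hφ : PhiClass 2 φ) (l : List (Fin n ⊕ Fin n)) {x ξ : En n} (hξ : ξ ≠ 0) :
    HasFDerivAt (fun y => PW φ l y ξ) (PWx φ l x ξ) x := by
  have h := PW_diff hφ l (x := x) hξ
  exact h.comp x (f := fun y : En n => (y, ξ)) (by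
    simpa using (hasFDerivAt_prodMk_left x ξ))

lemma PW_dξ (hφ : PhiClass 2 φ) (l : List (Fin n ⊕ Fin n)) {x ξ : En n} (hξ : ξ ≠ 0) :
    HasFDerivAt (fun ζ => PW φ l x ζ) (PWξ φ l x ξ) ξ := by
  have h := PW_diff hφ l (x := x) hξ
  exact h.comp ξ (f := fun y : En n => (x, y)) (by
    simpa using (hasFDerivAt_prodMk_right x ξ))

lemma PW_line (hφ : PhiClass 2 φ) (l : List (Fin n ⊕ Fin n)) (i : Fin n ⊕ Fin n) {p : En n × En n} (hp : p.2 ≠ 0) :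
    HasLineDerivAt ℝ (fun q : En n × En n => PW φ l q.1 q.2) (PW φ (l ++ [i]) p.1 p.2) p (eJ i) :=
  wd_line eJ Unz_open l hφ.1 i (show p ∈ Unz n from hp)

/-- number of frequency letters -/
def nr (l : List (Fin n ⊕ Fin n)) : ℕ := l.countP (fun i => i.isRight)

@[simp] lemma nr_nil : nr ([] : List (Fin n ⊕ Fin n)) = 0 := rfl
@[simp] lemma nr_inl (i : Fin n) (l : List (Fin n ⊕ Fin n)) : nr (Sum.inl i :: l) = nr l := by simp [nr]
@[simp] lemma nr_inr (i : Fin n) (l : List (Fin n ⊕ Fin n)) : nr (Sum.inr i :: l) = nr l + 1 := by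
  unfold nr; rw [List.countP_cons_of_pos (by simp)]
@[simp] lemma nr_append (l l' : List (Fin n ⊕ Fin n)) : nr (l ++ l') = nr l + nr l' := by simp [nr]

lemma PW_hom (hφ : PhiClass 2 φ) {t : ℝ} (ht : 0 < t) (l : List (Fin n ⊕ Fin n)) :
    ∀ {x ξ : En n}, ξ ≠ 0 → PW φ l x (t • ξ) * t ^ (nr l) = t * PW φ l x ξ := by
  induction l using List.reverseRecOn with
  | nil => intro x ξ _; simpa [nr, PW, wd] using hφ.2.1 x ξ t ht
  | append_singleton l i ih =>
    intro x ξ hξ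
    have hξ' : t • ξ ≠ 0 := smul_ne_zero ht.ne' hξ
    rcases i with i | i
    · have e1 := (PW_dx hφ l (x := x) hξ').hasLineDerivAt (eB i)
      have e2 := (PW_dx hφ l (x := x) hξ).hasLineDerivAt (eB i)
      rw [PWx_apply] at e1 e2
      have h1 : HasDerivAt (fun s : ℝ => PW φ l (x + s • eB i) (t • ξ) * t ^ nr l) _ 0 :=
        HasDerivAt.mul_const e1 _
      have h2 : HasDerivAt (fun s : ℝ => t * PW φ l (x + s • eB i) ξ) _ 0 :=
        HasDerivAt.const_mul t e2
      have : (fun s : ℝ => PW φ l (x + s • eB i) (t • ξ) * t ^ nr l) =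
        (fun s : ℝ => t * PW φ l (x + s • eB i) ξ) := by
        funext s; exact ih hξ
      rw [this] at h1
      have := h1.unique h2
      simpa using this
    · have e1 := (PW_dξ hφ l (x := x) hξ').hasLineDerivAt (t • eB i)
      have e2 := (PW_dξ hφ l (x := x) hξ).hasLineDerivAt (eB i)
      rw [map_smul] at e1
      rw [PWξ_apply] at e1 e2
      have h1 : HasDerivAt (fun s : ℝ => PW φ l x (t • ξ + s • t • eB i) * t ^ nr l) _ 0 :=
        HasDerivAt.mul_const e1 _
      have h2 : HasDerivAt (fun s : ℝ => t * PW φ l x (ξ + s • eB i)) _ 0 :=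
        HasDerivAt.const_mul t e2
      have hne : ∀ᶠ s : ℝ in nhds 0, ξ + s • (eB i : En n) ≠ 0 := by
        have : ContinuousAt (fun s : ℝ => ξ + s • (eB i : En n)) 0 := by fun_prop
        exact this.eventually_ne (by simpa using hξ)
      have : (fun s : ℝ => PW φ l x (t • ξ + s • t • eB i) * t ^ nr l) =ᶠ[nhds 0]
        (fun s : ℝ => t * PW φ l x (ξ + s • eB i)) := by
        filter_upwards [hne] with s hs
        rw [← ih hs, smul_add, smul_comm]
      have := (h1.congr_of_eventuallyEq this.symm).unique h2
      simp only [nr_append, nr_inr, nr_nil, smul_eq_mul] at this ⊢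
      rw [← this]; ring

lemma phi_zero (hφ : PhiClass 2 φ) (x : En n) : φ x 0 = 0 := by
  have := hφ.2.1 x 0 2 (by norm_num)
  rw [smul_zero] at this; linarith

lemma phi_meas (hφ : PhiClass 2 φ) : Measurable (fun q : En n × En n => φ q.1 q.2) := by
  have h : (fun q : En n × En n => φ q.1 q.2) = (Unz n).indicator (fun q : En n × En n => φ q.1 q.2) := by
    funext q
    by_cases hq : q ∈ Unz n
    · rw [Set.indicator_of_mem hq]
    · rw [Set.indicator_of_notMem hq]
      have : q.2 = 0 := by simpa [Unz] using hq
      rw [this, phi_zero hφ]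
  rw [h]
  have := hφ.1.continuousOn.measurable_piecewise (g := fun _ => 0) continuousOn_const Unz_open.measurableSet
  rw [← Set.piecewise_eq_indicator]
  convert this using 1
  funext q
  by_cases hq : q.2 = 0 <;> simp [Set.piecewise, Unz, hq]


/-- oscillating factor -/
def eP (φ : En n → En n → ℝ) (x ξ : En n) : ℂ := Complex.exp (Complex.I * Complex.ofReal (φ x ξ))

lemma eP_meas (hφ : Measurable (fun q : En n × En n => φ q.1 q.2)) : Measurable (Function.uncurry (eP φ)) := by
  unfold Function.uncurry eP
  exact Complex.measurable_exp.comp (measurable_const.mul (Complex.measurable_ofReal.comp hφ))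

lemma eP_norm (x ξ : En n) : ‖eP φ x ξ‖ = 1 := by
  unfold eP; rw [mul_comm]; exact Complex.norm_exp_ofReal_mul_I _

/-- frozen frequency gradient -/
def Gp (φ : En n → En n → ℝ) (p x : En n) : En n := WithLp.toLp 2 (fun i => PW φ [Sum.inr i] x p)

/-- its derivative matrix -/
def Mp (φ : En n → En n → ℝ) (p x : En n) : Matrix (Fin n) (Fin n) ℝ :=
  Matrix.of fun i j => PW φ [Sum.inr i, Sum.inl j] x p

lemma Mp_eq (hφ : PhiClass 2 φ) {p : En n} (hp : p ≠ 0) (x : En n) : Mp φ p x = (mixHess φ x p).transpose := by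
  ext i j
  simp only [Mp, mixHess, Matrix.transpose_apply, Matrix.of_apply]
  have h1 : (fun y => pd i (φ y) p) = fun y => PW φ [Sum.inr i] y p := by
    funext y
    exact wd_slice_ξ Unz_open hφ.1 [i] y p hp
  rw [h1]
  exact (wd_slice_x Unz_open (wd_smooth eJ Unz_open [Sum.inr i] hφ.1) [j] x p hp).symm

lemma euc_apply (M : Matrix (Fin n) (Fin n) ℝ) (v : En n) :
    Matrix.toEuclideanCLM (𝕜 := ℝ) M v = WithLp.toLp 2 (M.mulVec v.ofLp) := rfl

lemma euc_eB (M : Matrix (Fin n) (Fin n) ℝ) (i j : Fin n) :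
    Matrix.toEuclideanCLM (𝕜 := ℝ) M (eB j) i = M i j := by
  rw [euc_apply]
  simp [eB]

lemma euc_det (M : Matrix (Fin n) (Fin n) ℝ) : (Matrix.toEuclideanCLM (𝕜 := ℝ) M).det = M.det := by
  rw [ContinuousLinearMap.det, Matrix.coe_toEuclideanCLM_eq_toEuclideanLin]
  exact LinearMap.det_toLpLin 2 M

lemma euc_bd (M : Matrix (Fin n) (Fin n) ℝ) {K : ℝ} (hK : 0 ≤ K) (h : ∀ i j, |M i j| ≤ K) :
    ‖Matrix.toEuclideanCLM (𝕜 := ℝ) M‖ ≤ n * (n * K) :=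
  clm_bd _ (by positivity) fun j => norm_le_coord _ fun i => by rw [euc_eB]; exact h i j

lemma Gp_diff (hφ : PhiClass 2 φ) {p : En n} (hp : p ≠ 0) (x : En n) :
    HasFDerivAt (Gp φ p) (Matrix.toEuclideanCLM (𝕜 := ℝ) (Mp φ p x)) x := by
  rw [← hasFDerivWithinAt_univ, hasFDerivWithinAt_euclidean]
  intro i
  have h := PW_dx hφ [Sum.inr i] (x := x) hp
  have e : (EuclideanSpace.proj i : En n →L[ℝ] ℝ).comp (Matrix.toEuclideanCLM (𝕜 := ℝ) (Mp φ p x)) = PWx φ [Sum.inr i] x p := by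
    refine ContinuousLinearMap.ext fun v => ?_
    rw [vec_sum v, map_sum, map_sum]
    refine Finset.sum_congr rfl fun j _ => ?_
    rw [map_smul, map_smul, PWx_apply]
    congr 1
    exact euc_eB _ _ _
  rw [hasFDerivWithinAt_univ]
  exact HasFDerivAt.congr_fderiv h e.symm

lemma PW_mixed_bd (hφ : PhiClass 2 φ) (N : ℕ) : ∃ C : ℝ, 0 < C ∧ ∀ l : List (Fin n ⊕ Fin n),
    l.length ≤ N → 2 ≤ l.length → ∀ x ξ : En n, ξ ≠ 0 → |PW φ l x ξ| ≤ C * (‖ξ‖ * (‖ξ‖⁻¹) ^ nr l) := by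
  obtain ⟨C, hC, h⟩ := phase_bd hφ N
  refine ⟨C, hC, fun l hl hl2 x ξ hξ => ?_⟩
  refine (h l hl hl2 (x, ξ) hξ).trans_eq ?_
  congr 2
  clear hl hl2
  induction l with
  | nil => simp [wprod, nr]
  | cons i l ih =>
    rw [wprod, List.map_cons, List.prod_cons, ← wprod, ih]
    rcases i with i | i
    · simp [wJ]
    · rw [nr_inr, pow_succ']; rfl

lemma Mp_bd (hφ : PhiClass 2 φ) : ∃ C : ℝ, 0 < C ∧ ∀ p, p ≠ 0 → ∀ x : En n, ∀ i j, |Mp φ p x i j| ≤ C := by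
  obtain ⟨C, hC, h⟩ := PW_mixed_bd hφ 2
  refine ⟨C, hC, fun p hp x i j => ?_⟩
  have := h [Sum.inr i, Sum.inl j] (by simp) (by simp) x p hp
  have hp' : ‖p‖ ≠ 0 := norm_ne_zero_iff.2 hp
  simpa [hp', Mp] using this

lemma Mp_low (hφ : PhiClass 2 φ) (hs : SNDcond φ) : ∃ c : ℝ, 0 < c ∧ ∀ p, p ≠ 0 → ∀ x v : En n,
    c * ‖v‖ ≤ ‖Matrix.toEuclideanCLM (𝕜 := ℝ) (Mp φ p x) v‖ ∧
    c * ‖v‖ ≤ ‖Matrix.toEuclideanCLM (𝕜 := ℝ) (Mp φ p x).transpose v‖ := by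
  obtain ⟨C, hC, h⟩ := Mp_bd hφ
  obtain ⟨c, hc, hdet⟩ := hs
  obtain ⟨c', hc', hl⟩ := matrix_low n C c hc
  refine ⟨c', hc', fun p hp x v => ⟨?_, ?_⟩⟩
  · rw [euc_apply]
    exact hl _ (h p hp x) (by rw [Mp_eq hφ hp, Matrix.det_transpose]; exact hdet x p hp) v
  · rw [euc_apply]
    exact hl (Mp φ p x).transpose (fun i j => h p hp x j i) (by rw [Matrix.det_transpose, Mp_eq hφ hp, Matrix.det_transpose]; exact hdet x p hp) v

lemma base_lin (hφ : PhiClass 2 φ) (hs : SNDcond φ) : ∃ B : ℝ≥0∞, B ≠ ⊤ ∧ ∀ p : En n, p ≠ 0 →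
    BaseBd (eP fun x ξ => ⟪Gp φ p x, ξ⟫) Set.univ B := by
  obtain ⟨c, hc, hlow⟩ := Mp_low hφ hs
  obtain ⟨d, hd, hdet⟩ := hs
  obtain ⟨C, hC, hM⟩ := PW_mixed_bd hφ 3
  refine ⟨(cPl n * ENNReal.ofReal d⁻¹) ^ (1/2 : ℝ), ?_, fun p hp F hF => ?_⟩
  · refine ENNReal.rpow_ne_top_of_nonneg (by norm_num) (ENNReal.mul_ne_top ?_ ENNReal.ofReal_ne_top)
    simp [cPl]
  have hp' : ‖p‖ ≠ 0 := norm_ne_zero_iff.2 hp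
  have hinj : Function.Injective (Gp φ p) := by
    refine hadamard_inj _ _ (Gp_diff hφ hp) c (n * (n * (n * C)) + 1) hc (fun x v => (hlow p hp x v).1)
      (by positivity) fun x y => ?_
    rw [← map_sub]
    have : ∀ i j, |(Mp φ p x - Mp φ p y) i j| ≤ n * C * ‖x - y‖ := by
      intro i j
      refine mv_seg hC.le (g := fun x => PW φ [Sum.inr i, Sum.inl j] x p) (fun ζ _ => PW_dx hφ _ hp) fun ζ _ k => ?_
      rw [PWx_apply]
      have := hM ([Sum.inr i, Sum.inl j] ++ [Sum.inl k]) (by simp) (by simp) ζ p hp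
      simpa [hp'] using this
    refine (euc_bd _ (by positivity) this).trans ?_
    nlinarith [norm_nonneg (x - y)]
  exact base_op _ _ (Gp_diff hφ hp) hinj d hd (fun x => by
    rw [euc_det, Mp_eq hφ hp, Matrix.det_transpose]; exact hdet x p hp) F hF.int hF.l2

lemma unit_seg {u v ζ : En n} (hu : ‖u‖ = 1) (hv : ‖v‖ = 1) (h : 0 ≤ ⟪u, v⟫) (hζ : ζ ∈ segment ℝ u v) :
    1 / 2 ≤ ‖ζ‖ := by
  obtain ⟨a, b, ha, hb, hab, rfl⟩ := hζ
  have e : ‖a • u + b • v‖ ^ 2 = a ^ 2 + 2 * (a * b * ⟪u, v⟫) + b ^ 2 := by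
    rw [norm_add_sq_real, norm_smul, norm_smul, hu, hv, real_inner_smul_left, real_inner_smul_right]
    simp [mul_pow]; ring
  have h2 : 0 ≤ a * b * ⟪u, v⟫ := by positivity
  by_contra hlt
  push Not at hlt
  nlinarith [norm_nonneg (a • u + b • v), sq_nonneg (a - b)]

lemma grad_osc (hφ : PhiClass 2 φ) : ∃ C : ℝ, 0 < C ∧ ∀ ξ p : En n, ξ ≠ 0 → p ≠ 0 → 0 ≤ ⟪ξ, p⟫ →
    ∀ x i, |PW φ [Sum.inr i] x ξ - PW φ [Sum.inr i] x p| ≤ C := by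
  obtain ⟨C, hC, hM⟩ := PW_mixed_bd hφ 2
  refine ⟨n * (2 * C) * 2 + 1, by positivity, fun ξ p hξ hp h x i => ?_⟩
  have hom : ∀ ξ : En n, ξ ≠ 0 → PW φ [Sum.inr i] x ξ = PW φ [Sum.inr i] x (‖ξ‖⁻¹ • ξ) := by
    intro ξ hξ
    have hpos : 0 < ‖ξ‖⁻¹ := inv_pos.2 (norm_pos_iff.2 hξ)
    have := PW_hom hφ hpos [Sum.inr i] (x := x) hξ
    simp only [nr_inr, nr_nil, zero_add, pow_one] at this
    rw [mul_comm] at this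
    exact (mul_left_cancel₀ hpos.ne' this).symm
  have hu : ∀ ξ : En n, ξ ≠ 0 → ‖‖ξ‖⁻¹ • ξ‖ = 1 := fun ξ hξ => by
    rw [norm_smul, norm_inv, norm_norm, inv_mul_cancel₀ (norm_ne_zero_iff.2 hξ)]
  rw [hom ξ hξ, hom p hp]
  have hs : ∀ ζ ∈ segment ℝ (‖p‖⁻¹ • p) (‖ξ‖⁻¹ • ξ), 1 / 2 ≤ ‖ζ‖ := fun ζ hζ =>
    unit_seg (hu p hp) (hu ξ hξ) (by
      rw [real_inner_smul_left, real_inner_smul_right, real_inner_comm]; positivity) hζ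
  have hne : ∀ ζ ∈ segment ℝ (‖p‖⁻¹ • p) (‖ξ‖⁻¹ • ξ), ζ ≠ 0 := fun ζ hζ h0 => by
    have := hs ζ hζ; rw [h0, norm_zero] at this; norm_num at this
  refine (mv_seg (M := 2 * C) (by positivity) (fun ζ hζ => PW_dξ hφ [Sum.inr i] (hne ζ hζ)) fun ζ hζ k => ?_).trans ?_
  · rw [PWξ_apply]
    refine (hM _ (by simp) (by simp) x ζ (hne ζ hζ)).trans ?_
    have h0 : ‖ζ‖ ≠ 0 := norm_ne_zero_iff.2 (hne ζ hζ)
    have h1 : ‖ζ‖⁻¹ ≤ 2 := by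
      have := inv_anti₀ (by norm_num) (hs ζ hζ); norm_num at this; exact this
    have : ‖ζ‖ * ‖ζ‖⁻¹ ^ nr ([Sum.inr i] ++ [Sum.inr k]) = ‖ζ‖⁻¹ := by
      simp only [nr_append, nr_inr, nr_nil, zero_add, Nat.reduceAdd]; field_simp
    rw [this]; nlinarith
  · have : ‖‖ξ‖⁻¹ • ξ - ‖p‖⁻¹ • p‖ ≤ 2 := by
      refine (norm_sub_le _ _).trans ?_
      rw [hu ξ hξ, hu p hp]; norm_num
    have h2 : (0:ℝ) ≤ n * (2 * C) := by positivity
    nlinarith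

/-- differences of x-derivatives of the phase -/
lemma x_diff (hφ : PhiClass 2 φ) (N : ℕ) : ∃ C : ℝ, 0 < C ∧ ∀ l : List (Fin n), l ≠ [] → l.length ≤ N →
    ∀ ξ η : En n, (∀ ζ ∈ segment ℝ η ξ, ζ ≠ 0) → ∀ x,
      |PW φ (l.map Sum.inl) x ξ - PW φ (l.map Sum.inl) x η| ≤ C * ‖ξ - η‖ := by
  obtain ⟨C, hC, hM⟩ := PW_mixed_bd hφ (N + 1)
  refine ⟨n * C + 1, by positivity, fun l hl0 hl ξ η hs x => ?_⟩
  have hlen : 1 ≤ l.length := List.length_pos_iff.2 hl0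
  refine (mv_seg (M := C) hC.le (fun ζ hζ => PW_dξ hφ (l.map Sum.inl) (hs ζ hζ)) fun ζ hζ k => ?_).trans ?_
  · rw [PWξ_apply]
    refine (hM _ (by simpa using hl) (by simpa using hlen) x ζ (hs ζ hζ)).trans_eq ?_
    have : nr (l.map Sum.inl ++ [Sum.inr k]) = 1 := by simp [nr]
    rw [this, pow_one, mul_inv_cancel₀ (norm_ne_zero_iff.2 (hs ζ hζ)), mul_one]
  · nlinarith [norm_nonneg (ξ - η)]

/-- x-gradient as a vector -/
def Xg (φ : En n → En n → ℝ) (x ξ : En n) : En n := WithLp.toLp 2 (fun i => PW φ [Sum.inl i] x ξ)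

lemma Mp_swap (hφ : PhiClass 2 φ) {p : En n} (hp : p ≠ 0) (x : En n) (k l : Fin n) :
    Mp φ p x k l = PW φ [Sum.inl l, Sum.inr k] x p :=
  wd_perm eJ Unz_open (List.Perm.swap _ _ _) hφ.1 (show (x, p) ∈ Unz n from hp)

lemma Xg_diff (hφ : PhiClass 2 φ) {p : En n} (hp : p ≠ 0) (x : En n) :
    HasFDerivAt (Xg φ x) (Matrix.toEuclideanCLM (𝕜 := ℝ) (Mp φ p x).transpose) p := by
  rw [← hasFDerivWithinAt_univ, hasFDerivWithinAt_euclidean]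
  intro i
  have h := PW_dξ hφ [Sum.inl i] (x := x) hp
  have e : (EuclideanSpace.proj i : En n →L[ℝ] ℝ).comp (Matrix.toEuclideanCLM (𝕜 := ℝ) (Mp φ p x).transpose) = PWξ φ [Sum.inl i] x p := by
    refine ContinuousLinearMap.ext fun v => ?_
    rw [vec_sum v, map_sum, map_sum]
    refine Finset.sum_congr rfl fun j _ => ?_
    rw [map_smul, map_smul, PWξ_apply]
    congr 1
    refine (euc_eB _ _ _).trans ?_
    rw [Matrix.transpose_apply, Mp_swap hφ hp]; rfl
  rw [hasFDerivWithinAt_univ]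
  exact HasFDerivAt.congr_fderiv h e.symm

/-- cone around a direction -/
def Cone (ω : En n) (ε : ℝ) : Set (En n) := {ζ | ∃ t : ℝ, 0 < t ∧ ‖ζ - t • ω‖ ≤ ε * t}

lemma Cone_convex (ω : En n) (ε : ℝ) : Convex ℝ (Cone ω ε) := by
  rintro ζ ⟨t, ht, h⟩ ζ' ⟨t', ht', h'⟩ a b ha hb hab
  refine ⟨a * t + b * t', ?_, ?_⟩
  · rcases ha.eq_or_lt with rfl | ha
    · have : b = 1 := by linarith
      subst this; simpa using ht'
    · positivity
  · have : a • ζ + b • ζ' - (a * t + b * t') • ω = a • (ζ - t • ω) + b • (ζ' - t' • ω) := by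
      module
    rw [this]
    refine (norm_add_le _ _).trans ?_
    rw [norm_smul, norm_smul, Real.norm_of_nonneg ha, Real.norm_of_nonneg hb]
    nlinarith

lemma Cone_norm {ω : En n} (hω : ‖ω‖ = 1) {ε : ℝ} (hε : ε ≤ 1 / 2) {ζ : En n} (hζ : ζ ∈ Cone ω ε) :
    ∃ t : ℝ, 0 < t ∧ ‖t⁻¹ • ζ - ω‖ ≤ ε ∧ 1 / 2 ≤ ‖t⁻¹ • ζ‖ := by
  obtain ⟨t, ht, h⟩ := hζ
  have h1 : ‖t⁻¹ • ζ - ω‖ ≤ ε := by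
    have : t⁻¹ • ζ - ω = t⁻¹ • (ζ - t • ω) := by rw [smul_sub, smul_smul, inv_mul_cancel₀ ht.ne', one_smul]
    rw [this, norm_smul, norm_inv, Real.norm_of_nonneg ht.le]
    calc t⁻¹ * ‖ζ - t • ω‖ ≤ t⁻¹ * (ε * t) := by gcongr
      _ = ε := by field_simp
  refine ⟨t, ht, h1, ?_⟩
  have := norm_sub_norm_le ω (t⁻¹ • ζ)
  rw [norm_sub_rev, hω] at this
  linarith

lemma cones (hφ : PhiClass 2 φ) (hs : SNDcond φ) : ∃ (t : Finset (En n)) (cl : En n → En n) (c : ℝ), 0 < c ∧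
    (∀ ξ, cl ξ ∈ t) ∧ ∀ ξ η : En n, ξ ≠ 0 → η ≠ 0 → cl ξ = cl η →
      (∀ ζ ∈ segment ℝ η ξ, ζ ≠ 0) ∧ ∀ x, c * ‖ξ - η‖ ≤ ‖Xg φ x ξ - Xg φ x η‖ := by
  obtain ⟨c, hc, hlow⟩ := Mp_low hφ hs
  obtain ⟨C, hC, hM⟩ := PW_mixed_bd hφ 3
  obtain ⟨ε, hε, hε2, hεc⟩ : ∃ ε : ℝ, 0 < ε ∧ ε ≤ 1 / 2 ∧ n * (n * (n * (2 * C) * ε)) ≤ c / 2 := by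
    refine ⟨min (1/2) (c / 2 / (n * (n * (n * (2 * C))) + 1)), by positivity, min_le_left _ _, ?_⟩
    have h := min_le_right (1/2) (c / 2 / (n * (n * (n * (2 * C))) + 1))
    rw [le_div_iff₀ (by positivity)] at h
    have h0 : 0 < min (1/2) (c / 2 / (n * (n * (n * (2 * C))) + 1)) := by positivity
    nlinarith
  have hcomp : IsCompact (Metric.sphere (0 : En n) 1) := isCompact_sphere _ _
  obtain ⟨t, hts, hcov⟩ := hcomp.elim_nhds_subcover (fun ω => Metric.ball ω ε) (fun ω _ => Metric.ball_mem_nhds ω hε)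
  have hex : ∀ ξ : En n, ξ ≠ 0 → ∃ ω ∈ t, ξ ∈ Cone ω ε := by
    intro ξ hξ
    have hpos := norm_pos_iff.2 hξ
    have hu : ‖ξ‖⁻¹ • ξ ∈ Metric.sphere (0 : En n) 1 := by
      simp [norm_smul, inv_mul_cancel₀ hpos.ne']
    obtain ⟨ω, hω, hb⟩ := Set.mem_iUnion₂.1 (hcov hu)
    refine ⟨ω, hω, ‖ξ‖, hpos, ?_⟩
    rw [mem_ball_iff_norm] at hb
    have : ξ - ‖ξ‖ • ω = ‖ξ‖ • (‖ξ‖⁻¹ • ξ - ω) := by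
      rw [smul_sub, smul_smul, mul_inv_cancel₀ hpos.ne', one_smul]
    rw [this, norm_smul, norm_norm]
    nlinarith
  choose! f hf1 hf2 using hex
  refine ⟨insert 0 t, fun ξ => if ξ = 0 then 0 else f ξ, c / 2, by positivity, ?_, ?_⟩
  · intro ξ
    by_cases h : ξ = 0
    · simp [h]
    · simp [h, hf1 ξ h]
  intro ξ η hξ hη hcl
  simp only [if_neg hξ, if_neg hη] at hcl
  set ω := f ξ with hωd
  have hω : ‖ω‖ = 1 := by simpa using hts _ (hf1 ξ hξ)
  have hω0 : ω ≠ 0 := by intro h; rw [h] at hω; simp at hω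
  have hsub : segment ℝ η ξ ⊆ Cone ω ε := (Cone_convex ω ε).segment_subset (hcl ▸ hf2 η hη) (hf2 ξ hξ)
  have hne : ∀ ζ ∈ segment ℝ η ξ, ζ ≠ 0 := by
    intro ζ hζ h0
    obtain ⟨t, ht, h1, h2⟩ := Cone_norm hω hε2 (hsub hζ)
    rw [h0] at h2; norm_num at h2
  refine ⟨hne, fun x => ?_⟩
  set H := Matrix.toEuclideanCLM (𝕜 := ℝ) (Mp φ ω x).transpose with hH
  -- entries close
  have hent : ∀ ζ ∈ segment ℝ η ξ, ∀ k l, |(Mp φ ζ x - Mp φ ω x) k l| ≤ n * (2 * C) * ε := by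
    intro ζ hζ k l
    obtain ⟨t, ht, h1, h2⟩ := Cone_norm hω hε2 (hsub hζ)
    have hz0 : t⁻¹ • ζ ≠ 0 := by intro h; rw [h] at h2; norm_num at h2
    have hhom : Mp φ ζ x k l = Mp φ (t⁻¹ • ζ) x k l := by
      have := PW_hom hφ (inv_pos.2 ht) [Sum.inr k, Sum.inl l] (x := x) (hne ζ hζ)
      simp only [nr_inr, nr_inl, nr_nil, zero_add, pow_one] at this
      rw [mul_comm] at this
      exact (mul_left_cancel₀ (inv_pos.2 ht).ne' this).symm
    rw [Matrix.sub_apply, hhom]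
    have hb : ∀ θ ∈ segment ℝ ω (t⁻¹ • ζ), 1 / 2 ≤ ‖θ‖ := by
      intro θ hθ
      have hθ2 : θ ∈ Metric.closedBall ω ε :=
        (convex_closedBall ω ε).segment_subset (Metric.mem_closedBall_self hε.le)
          (by rw [mem_closedBall_iff_norm]; exact h1) hθ
      rw [mem_closedBall_iff_norm] at hθ2
      have := norm_sub_norm_le ω θ
      rw [norm_sub_rev, hω] at this
      linarith
    have hb0 : ∀ θ ∈ segment ℝ ω (t⁻¹ • ζ), θ ≠ 0 := fun θ hθ h0 => by
      have := hb θ hθ; rw [h0, norm_zero] at this; norm_num at this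
    refine (mv_seg (M := 2 * C) (g := fun ζ => PW φ [Sum.inr k, Sum.inl l] x ζ) (by positivity)
      (fun θ hθ => PW_dξ hφ _ (hb0 θ hθ)) fun θ hθ i => ?_).trans ?_
    · rw [PWξ_apply]
      refine (hM _ (by simp) (by simp) x θ (hb0 θ hθ)).trans ?_
      have h0 : ‖θ‖ ≠ 0 := norm_ne_zero_iff.2 (hb0 θ hθ)
      have h3 : ‖θ‖⁻¹ ≤ 2 := by
        have := inv_anti₀ (by norm_num) (hb θ hθ); norm_num at this; exact this
      have : ‖θ‖ * ‖θ‖⁻¹ ^ nr ([Sum.inr k, Sum.inl l] ++ [Sum.inr i]) = ‖θ‖⁻¹ := by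
        simp only [nr_append, nr_inr, nr_inl, nr_nil, zero_add, Nat.reduceAdd]; field_simp
      rw [this]; nlinarith
    · gcongr
  have key := mv_seg (M := n * (n * (2 * C) * ε)) (ξ := ξ) (η := η) (by positivity)
    (g := fun ζ => Xg φ x ζ - H ζ)
    (fun ζ hζ => (Xg_diff hφ (hne ζ hζ) x).sub H.hasFDerivAt) (fun ζ hζ k => by
      rw [hH, ← map_sub]
      refine norm_le_coord _ fun l => ?_
      rw [euc_eB]
      exact hent ζ hζ k l)
  have h1 := (hlow ω hω0 x (ξ - η)).2
  have e : Xg φ x ξ - H ξ - (Xg φ x η - H η) = (Xg φ x ξ - Xg φ x η) - H (ξ - η) := by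
    rw [map_sub]; abel
  rw [e] at key
  have h2 := norm_sub_norm_le (H (ξ - η)) (Xg φ x ξ - Xg φ x η)
  rw [norm_sub_rev (H (ξ - η)) (Xg φ x ξ - Xg φ x η)] at h2
  rw [← hH] at h1
  have h3 : n * (n * (n * (2 * C) * ε)) * ‖ξ - η‖ ≤ c / 2 * ‖ξ - η‖ := by gcongr
  linarith

end phase

section nonstat
variable {n : ℕ}

/-- L² functions with controlled twisted derivatives -/
def HH (s : ℝ) (p : Fin n → En n → ℝ) : ℕ → ℝ → (En n → ℂ) → Prop
  | 0, A, h => Continuous h ∧ eLpNorm h 2 volume ≤ ENNReal.ofReal A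
  | N + 1, A, h => (Continuous h ∧ eLpNorm h 2 volume ≤ ENNReal.ofReal A) ∧
      ∀ l, ∃ h' : En n → ℂ, (∀ x, HasLineDerivAt ℝ h (h' x + Complex.I * p l x * h x) x (eB l)) ∧
        HH s p N (s * A) h'

lemma HH.base {s : ℝ} {p : Fin n → En n → ℝ} {N : ℕ} {A : ℝ} {h : En n → ℂ} (H : HH s p N A h) :
    Continuous h ∧ eLpNorm h 2 volume ≤ ENNReal.ofReal A := by
  cases N with
  | zero => exact H
  | succ N => exact H.1

lemma HH.memLp {s : ℝ} {p : Fin n → En n → ℝ} {N : ℕ} {A : ℝ} {h : En n → ℂ} (H : HH s p N A h) :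
    MemLp h 2 volume :=
  ⟨H.base.1.aestronglyMeasurable, H.base.2.trans_lt ENNReal.ofReal_lt_top⟩

lemma HH.pred {s : ℝ} {p : Fin n → En n → ℝ} {N : ℕ} : ∀ {A : ℝ} {h : En n → ℂ}, HH s p (N + 1) A h → HH s p N A h := by
  induction N with
  | zero => intro A h H; exact H.1
  | succ N ih =>
    intro A h H
    refine ⟨H.1, fun l => ?_⟩
    obtain ⟨h', h1, h2⟩ := H.2 l
    exact ⟨h', h1, ih h2⟩

lemma HH.mono {s : ℝ} (hs : 0 ≤ s) {p : Fin n → En n → ℝ} {N : ℕ} : ∀ {A A' : ℝ} {h : En n → ℂ},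
    HH s p N A h → A ≤ A' → HH s p N A' h := by
  induction N with
  | zero => intro A A' h H hA; exact ⟨H.1, H.2.trans (ENNReal.ofReal_le_ofReal hA)⟩
  | succ N ih =>
    intro A A' h H hA
    refine ⟨⟨H.1.1, H.1.2.trans (ENNReal.ofReal_le_ofReal hA)⟩, fun l => ?_⟩
    obtain ⟨h', h1, h2⟩ := H.2 l
    exact ⟨h', h1, ih h2 (mul_le_mul_of_nonneg_left hA hs)⟩

lemma HH.conj {s : ℝ} {p : Fin n → En n → ℝ} {N : ℕ} : ∀ {A : ℝ} {h : En n → ℂ}, HH s p N A h →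
    HH s (fun l x => - p l x) N A (fun x => (starRingEnd ℂ) (h x)) := by
  have hn : ∀ h : En n → ℂ, eLpNorm (fun x => (starRingEnd ℂ) (h x)) 2 volume = eLpNorm h 2 volume := by
    intro h
    exact eLpNorm_congr_norm_ae (Filter.Eventually.of_forall fun x => by simp)
  induction N with
  | zero => intro A h H; exact ⟨Complex.continuous_conj.comp H.1, by rw [hn]; exact H.2⟩
  | succ N ih =>
    intro A h H
    refine ⟨⟨Complex.continuous_conj.comp H.1.1, by rw [hn]; exact H.1.2⟩, fun l => ?_⟩
    obtain ⟨h', h1, h2⟩ := H.2 l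
    refine ⟨fun x => (starRingEnd ℂ) (h' x), fun x => ?_, ih h2⟩
    have := h1 x
    unfold HasLineDerivAt at this ⊢
    have e := this.star
    refine HasDerivAt.congr_deriv e ?_
    simp

lemma int_uhk {u h k : En n → ℂ} {K A A' : ℝ} (hu : Continuous u) (hK : ∀ x, ‖u x‖ ≤ K) (hA : 0 ≤ A) (hA' : 0 ≤ A')
    (hh : MemLp h 2 volume) (hk : MemLp k 2 volume) (h1 : eLpNorm h 2 volume ≤ ENNReal.ofReal A)
    (h2 : eLpNorm k 2 volume ≤ ENNReal.ofReal A') :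
    Integrable (fun x => u x * (h x * k x)) volume ∧ ‖∫ x, u x * (h x * k x)‖ ≤ K * (A * A') := by
  have hK0 : 0 ≤ K := (norm_nonneg _).trans (hK 0)
  have hi : Integrable (fun x => h x * k x) volume := hh.integrable_mul hk
  have hi2 : Integrable (fun x => u x * (h x * k x)) volume :=
    hi.bdd_mul hu.aestronglyMeasurable (Filter.Eventually.of_forall hK)
  refine ⟨hi2, ?_⟩
  have e1 : eLpNorm (fun x => h x * k x) 1 volume ≤ ENNReal.ofReal (A * A') := by
    have := eLpNorm_smul_le_mul_eLpNorm (p := 2) (q := 2) (r := 1) hk.1 hh.1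
    refine (this).trans ?_
    rw [ENNReal.ofReal_mul hA]
    exact mul_le_mul' h1 h2
  have e2 : eLpNorm (fun x => u x * (h x * k x)) 1 volume ≤ ENNReal.ofReal (K * (A * A')) := by
    have : eLpNorm (fun x => u x * (h x * k x)) 1 volume ≤ ENNReal.ofReal K * eLpNorm (fun x => h x * k x) 1 volume :=
      eLpNorm_le_mul_eLpNorm_of_ae_le_mul (Filter.Eventually.of_forall fun x => by
        rw [norm_mul]; exact mul_le_mul_of_nonneg_right (hK x) (norm_nonneg _)) 1
    refine this.trans ?_
    rw [ENNReal.ofReal_mul hK0]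
    gcongr
  rw [eLpNorm_one_eq_lintegral_enorm] at e2
  have := (enorm_integral_le_lintegral_enorm (μ := volume) (fun x => u x * (h x * k x))).trans e2
  rw [← ofReal_norm_eq_enorm] at this
  exact (ENNReal.ofReal_le_ofReal_iff (by positivity)).1 this

/-- constants in nonstationary phase -/
def nsC (n : ℕ) : ℕ → ℝ
  | 0 => 1
  | N + 1 => n * (3 * (2 ^ (N + 1) * nsC n N))

lemma nsC_nonneg (n N : ℕ) : 0 ≤ nsC n N := by
  induction N with
  | zero => simp [nsC]
  | succ N ih => simp only [nsC]; positivity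

theorem nonstat {s W M : ℝ} (hs : 0 ≤ s) (hW : 0 ≤ W) {p q : Fin n → En n → ℝ}
    (hpc : ∀ l, Continuous (fun x => p l x + q l x)) (hpb : ∀ l x, |p l x + q l x| ≤ M)
    {w : Fin n → En n → ℂ} (hw1 : ∀ x, ∑ l, w l x * ((p l x + q l x : ℝ) : ℂ) = 1) (N : ℕ) :
    (∀ l, Cl eB (fun _ _ => s) Set.univ N (fun _ => W) (w l)) →
    ∀ {u h k : En n → ℂ} {K A A' : ℝ}, 0 ≤ A → 0 ≤ A' →
      Cl eB (fun _ _ => s) Set.univ N (fun _ => K) u → HH s p N A h → HH s q N A' k →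
      ‖∫ x, u x * (h x * k x)‖ ≤ nsC n N * K * (W * s) ^ N * (A * A') := by
  induction N with
  | zero =>
    intro _ u h k K A A' hA hA' hu hh hk
    have := (int_uhk (continuousOn_univ.1 hu.cont) (fun x => hu.bd x trivial) hA hA' hh.memLp hk.memLp hh.base.2 hk.base.2).2
    simpa [nsC] using this
  | succ N ih =>
    intro hw u h k K A A' hA hA' hu hh hk
    have hK0 : 0 ≤ K := (norm_nonneg _).trans (hu.bd 0 trivial)
    have hwn : ∀ i : Fin n, ∀ x ∈ (Set.univ : Set (En n)), (0:ℝ) ≤ (fun (_ : Fin n) (_ : En n) => s) i x := fun _ _ _ => hs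
    have hB := fun {u : En n → ℂ} {K : ℝ} (hu : Cl eB (fun _ _ => s) (Set.univ : Set (En n)) N (fun _ => K) u)
      {h k : En n → ℂ} {A A' : ℝ} (hA : 0 ≤ A) (hA' : 0 ≤ A') (hh : HH s p N A h) (hk : HH s q N A' k) =>
      (int_uhk (continuousOn_univ.1 hu.cont) (fun x => hu.bd x trivial) hA hA' hh.memLp hk.memLp hh.base.2 hk.base.2).1
    have step : ∀ l, Integrable (fun x => u x * w l x * ((p l x + q l x : ℝ) : ℂ) * (h x * k x)) volume ∧
        ‖∫ x, u x * w l x * ((p l x + q l x : ℝ) : ℂ) * (h x * k x)‖ ≤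
          3 * (2 ^ (N + 1) * nsC n N) * K * (W * s) ^ (N + 1) * (A * A') := by
      intro l
      have hv := hu.mul hwn (hw l)
      obtain ⟨v', hv1, hv2⟩ := hv.2 l
      obtain ⟨h', hh1, hh2⟩ := hh.2 l
      obtain ⟨k', hk1, hk2⟩ := hk.2 l
      set v := fun x => u x * w l x with hvd
      have i1 := hB hv2 hA hA' hh.pred hk.pred
      have i2 := hB hv.pred (mul_nonneg hs hA) hA' hh2 hk.pred
      have i3 := hB hv.pred hA (mul_nonneg hs hA') hh.pred hk2
      have i0 := hB hv.pred hA hA' hh.pred hk.pred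
      have ip : Integrable (fun x => ((p l x + q l x : ℝ) : ℂ) * (v x * (h x * k x))) volume :=
        i0.bdd_mul (c := M) (Complex.continuous_ofReal.comp (hpc l)).aestronglyMeasurable
          (Filter.Eventually.of_forall fun x => by
            show ‖((p l x + q l x : ℝ) : ℂ)‖ ≤ M
            rw [Complex.norm_real, Real.norm_eq_abs]; exact hpb l x)
      have ig : Integrable (fun x => v x * (h' x * k x) + v x * (h x * k' x) +
          Complex.I * (((p l x + q l x : ℝ) : ℂ) * (v x * (h x * k x)))) volume := (i2.add i3).add (ip.const_mul _)
      have ibp := integral_bilinear_hasLineDerivAt_right_eq_neg_left_of_integrable (μ := volume)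
        (f := v) (f' := v') (g := fun x => h x * k x)
        (g' := fun x => (h' x + Complex.I * p l x * h x) * k x + h x * (k' x + Complex.I * q l x * k x)) (v := eB l)
        (B := ContinuousLinearMap.mul ℝ ℂ) i1
        (ig.congr (Filter.Eventually.of_forall fun x => by
          simp only [ContinuousLinearMap.mul_apply']; push_cast; ring))
        i0 (fun x _ => hv1 x trivial) (fun x _ => (hh1 x).mul' (hk1 x))
      simp only [ContinuousLinearMap.mul_apply'] at ibp
      have e1 : ∫ x, v x * ((h' x + Complex.I * p l x * h x) * k x + h x * (k' x + Complex.I * q l x * k x)) =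
          (∫ x, v x * (h' x * k x)) + (∫ x, v x * (h x * k' x)) +
            Complex.I * ∫ x, ((p l x + q l x : ℝ) : ℂ) * (v x * (h x * k x)) := by
        have i23 : Integrable (fun x => v x * (h' x * k x) + v x * (h x * k' x)) volume := i2.add i3
        rw [← integral_const_mul, ← integral_add i2 i3, ← integral_add i23 (ip.const_mul _)]
        refine integral_congr_ae (Filter.Eventually.of_forall fun x => ?_)
        push_cast; ring
      have e2 : (fun x => u x * w l x * ((p l x + q l x : ℝ) : ℂ) * (h x * k x)) =
          fun x => ((p l x + q l x : ℝ) : ℂ) * (v x * (h x * k x)) := by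
        funext x; simp only [hvd]; ring
      rw [e2]
      refine ⟨ip, ?_⟩
      rw [e1] at ibp
      have e3 : Complex.I * ∫ x, ((p l x + q l x : ℝ) : ℂ) * (v x * (h x * k x)) =
          -(∫ x, v' x * (h x * k x)) - (∫ x, v x * (h' x * k x)) - (∫ x, v x * (h x * k' x)) := by
        linear_combination ibp
      have e4 : ‖∫ x, ((p l x + q l x : ℝ) : ℂ) * (v x * (h x * k x))‖ ≤
          ‖∫ x, v' x * (h x * k x)‖ + ‖∫ x, v x * (h' x * k x)‖ + ‖∫ x, v x * (h x * k' x)‖ := by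
        have : ‖∫ x, ((p l x + q l x : ℝ) : ℂ) * (v x * (h x * k x))‖ =
          ‖Complex.I * ∫ x, ((p l x + q l x : ℝ) : ℂ) * (v x * (h x * k x))‖ := by simp
        rw [this, e3]
        refine (norm_sub_le _ _).trans (add_le_add ((norm_sub_le _ _).trans ?_) le_rfl)
        rw [norm_neg]
      refine e4.trans ?_
      have b1 := ih (fun l => (hw l).pred) hA hA' hv2 hh.pred hk.pred
      have b2 := ih (fun l => (hw l).pred) (mul_nonneg hs hA) hA' hv.pred hh2 hk.pred
      have b3 := ih (fun l => (hw l).pred) hA (mul_nonneg hs hA') hv.pred hh.pred hk2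
      refine (add_le_add (add_le_add b1 b2) b3).trans_eq ?_
      ring
    have e : ∫ x, u x * (h x * k x) = ∑ l, ∫ x, u x * w l x * ((p l x + q l x : ℝ) : ℂ) * (h x * k x) := by
      rw [← integral_finsetSum _ fun l _ => (step l).1]
      refine integral_congr_ae (Filter.Eventually.of_forall fun x => ?_)
      simp only
      rw [← Finset.sum_mul]
      have : ∑ l, u x * w l x * ((p l x + q l x : ℝ) : ℂ) = u x := by
        simp only [mul_assoc]
        rw [← Finset.mul_sum, hw1 x, mul_one]
      rw [this]
    rw [e]
    refine (norm_sum_le _ _).trans ((Finset.sum_le_sum fun l _ => (step l).2).trans_eq ?_)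
    simp [nsC]; ring

end nonstat

section diffint
variable {n : ℕ} {E : Type} [NormedAddCommGroup E] [NormedSpace ℝ E]

lemma slice_meas {D : Set (En n)} (hD : MeasurableSet D) {u : E × En n → ℂ}
    (hu : ContinuousOn u (Set.univ ×ˢ D)) {F : En n → ℂ} (hF : FG D F) (x : E) :
    Measurable (fun ξ => u (x, ξ) * F ξ) := by
  have h0 : ContinuousOn (fun ξ => u (x, ξ)) D :=
    hu.comp (Continuous.continuousOn (by fun_prop)) (fun ξ hξ => ⟨trivial, hξ⟩)
  have h1 := h0.measurable_piecewise (g := fun _ => 0) continuousOn_const hD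
  convert h1.mul hF.meas using 1
  ext ξ
  by_cases hq : ξ ∈ D
  · simp [Set.piecewise_eq_of_mem _ _ _ hq]
  · simp [hF.supp ξ hq]

lemma slice_bd {D : Set (En n)} {u : E × En n → ℂ} {M : ℝ}
    (hM : ∀ p ∈ Set.univ ×ˢ D, ‖u p‖ ≤ M) {F : En n → ℂ} (hF : FG D F) (x : E) (ξ : En n) :
    ‖u (x, ξ) * F ξ‖ ≤ M * ‖F ξ‖ := by
  by_cases hq : ξ ∈ D
  · rw [norm_mul]; exact mul_le_mul_of_nonneg_right (hM (x, ξ) ⟨trivial, hq⟩) (norm_nonneg _)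
  · simp [hF.supp ξ hq]

lemma slice_int {D : Set (En n)} (hD : MeasurableSet D) {u : E × En n → ℂ}
    (hu : ContinuousOn u (Set.univ ×ˢ D)) {M : ℝ}
    (hM : ∀ p ∈ Set.univ ×ˢ D, ‖u p‖ ≤ M) {F : En n → ℂ} (hF : FG D F) (x : E) :
    Integrable (fun ξ => u (x, ξ) * F ξ) volume :=
  (hF.int.norm.const_mul M).mono' (slice_meas hD hu hF x).aestronglyMeasurable
    (Filter.Eventually.of_forall fun ξ => slice_bd hM hF x ξ)

lemma int_cont {D : Set (En n)} (hD : MeasurableSet D) {u : E × En n → ℂ}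
    (hu : ContinuousOn u (Set.univ ×ˢ D)) {M : ℝ}
    (hM : ∀ p ∈ Set.univ ×ˢ D, ‖u p‖ ≤ M) {F : En n → ℂ} (hF : FG D F) :
    Continuous (fun x => ∫ ξ, u (x, ξ) * F ξ) := by
  refine continuous_of_dominated (bound := fun ξ => M * ‖F ξ‖)
    (fun x => (slice_meas hD hu hF x).aestronglyMeasurable)
    (fun x => Filter.Eventually.of_forall fun ξ => slice_bd hM hF x ξ) (hF.int.norm.const_mul M)
    (Filter.Eventually.of_forall fun ξ => ?_)
  by_cases hq : ξ ∈ D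
  · refine Continuous.mul ?_ continuous_const
    rw [← continuousOn_univ]
    exact hu.comp (Continuous.continuousOn (by fun_prop)) (fun x _ => ⟨trivial, hq⟩)
  · simp only [hF.supp ξ hq, mul_zero]; exact continuous_const

lemma int_line {D : Set (En n)} (hD : MeasurableSet D) {u u' : E × En n → ℂ} {v : E}
    (hu : ContinuousOn u (Set.univ ×ˢ D)) {M : ℝ} (hM : ∀ p ∈ Set.univ ×ˢ D, ‖u p‖ ≤ M)
    (hu' : ContinuousOn u' (Set.univ ×ˢ D)) (hM' : ∀ p ∈ Set.univ ×ˢ D, ‖u' p‖ ≤ M)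
    (hd : ∀ p ∈ Set.univ ×ˢ D, HasLineDerivAt ℝ u (u' p) p (v, 0)) {F : En n → ℂ} (hF : FG D F) (x : E) :
    HasLineDerivAt ℝ (fun x => ∫ ξ, u (x, ξ) * F ξ) (∫ ξ, u' (x, ξ) * F ξ) x v := by
  unfold HasLineDerivAt
  have := (hasDerivAt_integral_of_dominated_loc_of_deriv_le (μ := volume) (s := Set.univ) (x₀ := (0:ℝ))
    (F := fun t ξ => u (x + t • v, ξ) * F ξ) (F' := fun t ξ => u' (x + t • v, ξ) * F ξ)
    (bound := fun ξ => M * ‖F ξ‖) Filter.univ_mem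
    (Filter.Eventually.of_forall fun t => (slice_meas hD hu hF _).aestronglyMeasurable)
    (slice_int hD hu hM hF _) (slice_meas hD hu' hF _).aestronglyMeasurable
    (Filter.Eventually.of_forall fun ξ t _ => slice_bd hM' hF _ _) (hF.int.norm.const_mul M)
    (Filter.Eventually.of_forall fun ξ t _ => ?_)).2
  · simpa using this
  · by_cases hq : ξ ∈ D
    · have h1 := hd (x + t • v, ξ) ⟨trivial, hq⟩
      unfold HasLineDerivAt at h1
      have h2 : HasDerivAt (fun τ : ℝ => u (x + τ • v, ξ)) (u' (x + t • v, ξ)) t := by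
        have h3 := HasDerivAt.comp_sub_const t t (by simpa using h1)
        have h4 : (fun τ : ℝ => u (x + τ • v, ξ)) = fun τ : ℝ => u (x + t • v + (τ - t) • v, ξ) := by
          funext τ
          rw [sub_smul]; congr 2; abel
        rw [h4]; exact h3
      exact h2.mul_const _
    · simp only [hF.supp ξ hq, mul_zero]; exact hasDerivAt_const _ _

lemma Cl.restrict {ι ι' : Type} {e : ι → E} {w : ι → E → ℝ} {D : Set E} (σ : ι' → ι) {N : ℕ} :
    ∀ {κ : E → ℝ} {b : E → ℂ}, Cl e w D N κ b → Cl (fun i => e (σ i)) (fun i => w (σ i)) D N κ b := by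
  induction N with
  | zero => intro κ b h; exact h
  | succ N ih =>
    intro κ b h
    refine ⟨h.1, fun i => ?_⟩
    obtain ⟨b', h1, h2⟩ := h.2 (σ i)
    exact ⟨b', h1, ih h2⟩

end diffint

section HHop
variable {n : ℕ} {φ : En n → En n → ℝ}

/-- weights for linear amplitudes -/
def wS (n : ℕ) (s ℓ : ℝ) : Fin n ⊕ Fin n → En n × En n → ℝ
  | Sum.inl _, _ => s
  | Sum.inr _, _ => ℓ⁻¹

/-- local boundedness -/
def LB (φ : En n → En n → ℝ) (ℓ : ℝ) (D : Set (En n)) (B : ℝ) : Prop :=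
  ∀ (b : En n × En n → ℂ) (K : ℝ), 0 ≤ K → Cl eX (fun _ _ => ℓ⁻¹) (Set.univ ×ˢ D) n (fun _ => K) b →
    ∀ F, FG D F → eLpNorm (fun x => ∫ ξ, eP φ x ξ * b (x, ξ) * F ξ) 2 volume ≤
      ENNReal.ofReal (B * K) * eLpNorm F 2 volume

/-- far convex pieces -/
structure FarP (s : ℝ) (D : Set (En n)) (c : En n) : Prop where
  meas : MeasurableSet D
  seg : ∀ ξ ∈ D, ∀ ζ ∈ segment ℝ c ξ, s ≤ ‖ζ‖
  dist : ∀ ξ ∈ D, ‖ξ - c‖ ≤ n * s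
  cen : s ≤ ‖c‖

lemma wS_nonneg {s ℓ : ℝ} (hs : 0 ≤ s) (hℓ : 0 < ℓ) (i : Fin n ⊕ Fin n) (p : En n × En n) : 0 ≤ wS n s ℓ i p := by
  cases i <;> simp [wS, hs, hℓ.le]

lemma wprod_wS {s ℓ : ℝ} (l : List (Fin n ⊕ Fin n)) (p : En n × En n) :
    ∃ k : ℕ, wprod (wS n s ℓ) l p = s ^ k * (ℓ⁻¹) ^ nr l := by
  induction l with
  | nil => exact ⟨0, by simp [wprod]⟩
  | cons i l ih =>
    obtain ⟨k, hk⟩ := ih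
    cases i with
    | inl i => exact ⟨k + 1, by simp only [wprod, List.map_cons, List.prod_cons] at hk ⊢; rw [hk]; simp [wS]; ring⟩
    | inr i => exact ⟨k, by simp only [wprod, List.map_cons, List.prod_cons] at hk ⊢; rw [hk]; simp [wS]; ring⟩

lemma nr_zero {l : List (Fin n ⊕ Fin n)} (h : nr l = 0) : ∃ l' : List (Fin n), l = l'.map Sum.inl := by
  induction l with
  | nil => exact ⟨[], rfl⟩
  | cons i l ih =>
    cases i with
    | inl i => obtain ⟨l', h'⟩ := ih (by simpa using h); exact ⟨i :: l', by simp [h']⟩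
    | inr i => simp at h

/-- phase difference class -/
lemma psi_cl (hφ : PhiClass 2 φ) (N : ℕ) : ∃ C : ℝ, 0 < C ∧ ∀ s ℓ : ℝ, 1 ≤ s → 0 < ℓ → ℓ ≤ s →
    ∀ (D : Set (En n)) (c : En n), FarP s D c → ∀ i, Cl eJ (wS n s ℓ) (Set.univ ×ˢ D) N (fun _ => C * s)
      (fun p => ((PW φ [Sum.inl i] p.1 p.2 - PW φ [Sum.inl i] p.1 c : ℝ) : ℂ)) := by
  obtain ⟨C1, hC1, h1⟩ := PW_mixed_bd hφ (N + 1)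
  obtain ⟨C2, hC2, h2⟩ := x_diff hφ (N + 1)
  refine ⟨C1 + C2 * n, by positivity, fun s ℓ hs hℓ hℓs D c hD i => ?_⟩
  have hs0 : 0 < s := by linarith
  have hc0 : c ≠ 0 := norm_pos_iff.1 (hs0.trans_le hD.cen)
  have hD0 : ∀ ξ ∈ D, ξ ≠ 0 := fun ξ hξ => norm_pos_iff.1 (hs0.trans_le (hD.seg ξ hξ ξ (right_mem_segment ℝ c ξ)))
  set V : List (Fin n ⊕ Fin n) → En n × En n → ℝ := fun l p =>
    if nr l = 0 then PW φ (Sum.inl i :: l) p.1 c else 0 with hV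
  have key := Cl.of_family (e := eJ) (w := wS n s ℓ) (D := Set.univ ×ˢ D) (N := N) (κ := fun _ => (C1 + C2 * n) * s)
    (U := fun l p => ((PW φ (Sum.inl i :: l) p.1 p.2 - V l p : ℝ) : ℂ)) ?_ ?_ ?_
  · simpa [hV] using key
  · intro l _
    refine Complex.continuous_ofReal.comp_continuousOn (ContinuousOn.sub ?_ ?_)
    · exact (PW_contOn hφ _).mono fun p hp => hD0 p.2 hp.2
    · simp only [hV]
      split_ifs
      · exact (PW_contOn hφ (Sum.inl i :: l)).comp (f := fun p : En n × En n => (p.1, c))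
          (Continuous.continuousOn (by fun_prop)) (fun p _ => hc0)
      · exact continuousOn_const
  · intro l _ j p hp
    have e1 := PW_line hφ (Sum.inl i :: l) j (hD0 p.2 hp.2)
    have e2 : HasLineDerivAt ℝ (V l) (V (l ++ [j]) p) p (eJ j) := by
      simp only [hV]
      cases j with
      | inr j =>
        simp only [nr_append, nr_inr, nr_nil]
        rw [if_neg (by omega)]
        unfold HasLineDerivAt
        simp only [eJ, Prod.fst_add, Prod.smul_fst, smul_zero, add_zero]
        exact hasDerivAt_const _ _
      | inl j =>
        simp only [nr_append, nr_inl, nr_nil, add_zero]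
        split_ifs with h
        · have := PW_line hφ (Sum.inl i :: l) (Sum.inl j) (p := (p.1, c)) hc0
          unfold HasLineDerivAt at this ⊢
          simpa [eJ] using this
        · exact hasDerivAt_const _ _
    unfold HasLineDerivAt at e1 e2 ⊢
    exact (e1.sub e2).ofReal_comp
  · intro l hl p hp
    rw [Complex.norm_real, Real.norm_eq_abs]
    obtain ⟨k, hk⟩ := wprod_wS (s := s) (ℓ := ℓ) l p
    rw [hk]
    have hsk : 1 ≤ s ^ k := one_le_pow₀ hs
    simp only [hV]
    split_ifs with h
    · obtain ⟨l', rfl⟩ := nr_zero h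
      have := h2 (i :: l') (by simp) (by simpa using hl) p.2 c (fun ζ hζ => norm_pos_iff.1 (hs0.trans_le (hD.seg p.2 hp.2 ζ hζ))) p.1
      simp only [List.map_cons] at this
      rw [h, pow_zero, mul_one]
      refine this.trans ?_
      have h3 := hD.dist p.2 hp.2
      calc C2 * ‖p.2 - c‖ ≤ C2 * (n * s) := by gcongr
        _ = (C2 * n) * s * 1 := by ring
        _ ≤ (C1 + C2 * n) * s * s ^ k := by gcongr; linarith
    · rw [sub_zero]
      have hn1 : 1 ≤ nr l := by omega
      have hps : s ≤ ‖p.2‖ := hD.seg p.2 hp.2 _ (right_mem_segment ℝ c p.2)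
      have hp0 : 0 < ‖p.2‖ := hs0.trans_le hps
      have hlen : 1 ≤ l.length := hn1.trans (by unfold nr; exact List.countP_le_length)
      refine (h1 (Sum.inl i :: l) (by simpa using hl) (by simpa using hlen) p.1 p.2 (hD0 _ hp.2)).trans ?_
      rw [nr_inl]
      obtain ⟨r, hr⟩ : ∃ r, nr l = r + 1 := ⟨nr l - 1, by omega⟩
      rw [hr, pow_succ, pow_succ]
      have e1 : ‖p.2‖ * (‖p.2‖⁻¹ ^ r * ‖p.2‖⁻¹) = ‖p.2‖⁻¹ ^ r := by field_simp
      rw [e1]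
      have e2 : ‖p.2‖⁻¹ ≤ ℓ⁻¹ := inv_anti₀ hℓ (hℓs.trans hps)
      calc C1 * ‖p.2‖⁻¹ ^ r ≤ C1 * ℓ⁻¹ ^ r := by gcongr
        _ = C1 * ℓ * 1 * (ℓ⁻¹ ^ r * ℓ⁻¹) := by field_simp
        _ ≤ (C1 + C2 * n) * s * s ^ k * (ℓ⁻¹ ^ r * ℓ⁻¹) := by
          gcongr
          have : 0 ≤ C2 * n := by positivity
          linarith
        _ = _ := by ring

theorem HH_op (hφ : PhiClass 2 φ) (N : ℕ) : ∃ C : ℝ, 1 ≤ C ∧ ∀ s ℓ : ℝ, 1 ≤ s → 0 < ℓ → ℓ ≤ s →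
    ∀ (D : Set (En n)) (c : En n), FarP s D c → ∀ B, 0 ≤ B → LB φ ℓ D B → ∀ F a, 0 ≤ a → FG D F →
      eLpNorm F 2 volume ≤ ENNReal.ofReal a → ∀ M ≤ N, ∀ b K, 0 ≤ K →
      Cl eJ (wS n s ℓ) (Set.univ ×ˢ D) (n + M) (fun _ => K) b →
      HH s (fun l x => PW φ [Sum.inl l] x c) M (B * K * a * C ^ M)
        (fun x => ∫ ξ, eP φ x ξ * b (x, ξ) * F ξ) := by
  obtain ⟨C1, hC1, h1⟩ := psi_cl hφ (n + N)
  refine ⟨1 + 2 ^ (n + N) * C1, by have := hC1.le; linarith [show (0:ℝ) ≤ 2 ^ (n + N) * C1 by positivity],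
    fun s ℓ hs hℓ hℓs D c hD B hB hLB F a ha hF hFa M => ?_⟩
  set C := 1 + 2 ^ (n + N) * C1 with hC
  have hC1' : 1 ≤ C := by rw [hC]; linarith [show (0:ℝ) ≤ 2 ^ (n + N) * C1 by positivity]
  have hs0 : 0 < s := by linarith
  have hc0 : c ≠ 0 := norm_pos_iff.1 (hs0.trans_le hD.cen)
  have hD0 : ∀ ξ ∈ D, ξ ≠ 0 := fun ξ hξ => norm_pos_iff.1 (hs0.trans_le (hD.seg ξ hξ ξ (right_mem_segment ℝ c ξ)))
  have heP : ContinuousOn (fun p : En n × En n => eP φ p.1 p.2) (Set.univ ×ˢ D) := by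
    have := (PW_contOn hφ []).mono (s := Unz n) (t := Set.univ ×ˢ D) fun p hp => hD0 p.2 hp.2
    exact Complex.continuous_exp.comp_continuousOn (continuousOn_const.mul
      (Complex.continuous_ofReal.comp_continuousOn this))
  have base : ∀ M b K, 0 ≤ K → Cl eJ (wS n s ℓ) (Set.univ ×ˢ D) (n + M) (fun _ => K) b →
      Continuous (fun x => ∫ ξ, eP φ x ξ * b (x, ξ) * F ξ) ∧
      eLpNorm (fun x => ∫ ξ, eP φ x ξ * b (x, ξ) * F ξ) 2 volume ≤ ENNReal.ofReal (B * K * a) := by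
    intro M b K hK hb
    constructor
    · refine int_cont hD.meas (u := fun p => eP φ p.1 p.2 * b p) (M := K) (heP.mul hb.cont) ?_ hF
      intro p hp
      rw [norm_mul, eP_norm, one_mul]; exact hb.bd p hp
    · refine (hLB b K hK ((hb.le (Nat.le_add_right n M)).restrict Sum.inr) F hF).trans ?_
      rw [ENNReal.ofReal_mul (p := B * K) (by positivity)]
      exact mul_le_mul' le_rfl hFa
  induction M with
  | zero =>
    intro _ b K hK hb
    rw [pow_zero, mul_one]
    exact base 0 b K hK hb
  | succ M ih =>
    intro hM b K hK hb
    have hbase := base (M + 1) b K hK hb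
    refine ⟨⟨hbase.1, hbase.2.trans (ENNReal.ofReal_le_ofReal ?_)⟩, fun l => ?_⟩
    · exact le_mul_of_one_le_right (by positivity) (one_le_pow₀ hC1')
    obtain ⟨d, hd1, hd2⟩ := hb.2 (Sum.inl l)
    set ψ : En n × En n → ℝ := fun p => PW φ [Sum.inl l] p.1 p.2 - PW φ [Sum.inl l] p.1 c with hψ
    have hψc : Cl eJ (wS n s ℓ) (Set.univ ×ˢ D) (n + M) (fun _ => C1 * s) (fun p => (ψ p : ℂ)) :=
      (h1 s ℓ hs hℓ hℓs D c hD l).le (by omega)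
    have hw : ∀ i, ∀ p ∈ (Set.univ ×ˢ D : Set (En n × En n)), 0 ≤ wS n s ℓ i p := fun i p _ => wS_nonneg hs0.le hℓ i p
    have hb' : Cl eJ (wS n s ℓ) (Set.univ ×ˢ D) (n + M) (fun _ => C * s * K)
        (fun p => d p + Complex.I * (ψ p * b p)) := by
      have h3 := hd2.add ((hψc.mul hw hb.pred).const_mul Complex.I)
      refine h3.mono subset_rfl ?_ ?_ hw (fun _ _ _ => le_rfl)
      · intro p hp
        simp only [wS, Complex.norm_I, one_mul]
        have : (2:ℝ) ^ (n + M) ≤ 2 ^ (n + N) := pow_le_pow_right₀ (by norm_num) (by omega)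
        calc K * s + 2 ^ (n + M) * (C1 * s * K) ≤ K * s + 2 ^ (n + N) * (C1 * s * K) := by gcongr
          _ = C * s * K := by rw [hC]; ring
      · intro p hp
        simp only [wS, Complex.norm_I, one_mul]
        positivity
    refine ⟨fun x => ∫ ξ, eP φ x ξ * (d (x, ξ) + Complex.I * (ψ (x, ξ) * b (x, ξ))) * F ξ, fun x => ?_, ?_⟩
    · -- derivative
      set r : En n × En n → ℝ := fun p => PW φ [] p.1 p.2 - PW φ [] p.1 c with hr
      have hrc : ContinuousOn r (Set.univ ×ˢ D) := by
        refine ContinuousOn.sub ?_ ?_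
        · exact (PW_contOn hφ _).mono fun p hp => hD0 p.2 hp.2
        · exact (PW_contOn hφ []).comp (f := fun p : En n × En n => (p.1, c))
            (Continuous.continuousOn (by fun_prop)) (fun p _ => hc0)
      have hec : ContinuousOn (fun p => Complex.exp (Complex.I * Complex.ofReal (r p))) (Set.univ ×ˢ D) :=
        Complex.continuous_exp.comp_continuousOn (continuousOn_const.mul
          (Complex.continuous_ofReal.comp_continuousOn hrc))
      have hen : ∀ p, ‖Complex.exp (Complex.I * Complex.ofReal (r p))‖ = 1 := fun p => by
        rw [mul_comm]; exact Complex.norm_exp_ofReal_mul_I _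
      have hrl : ∀ p ∈ (Set.univ ×ˢ D : Set (En n × En n)), HasLineDerivAt ℝ r (ψ p) p (eB l, 0) := by
        intro p hp
        have e1 := PW_line hφ [] (Sum.inl l) (hD0 p.2 hp.2)
        have e2 := PW_line hφ [] (Sum.inl l) (p := (p.1, c)) hc0
        unfold HasLineDerivAt at e1 e2 ⊢
        have := e1.sub e2
        simpa [hr, hψ, eJ, Pi.sub_def] using this
      have hg := int_line hD.meas (v := eB l) (u := fun p => Complex.exp (Complex.I * Complex.ofReal (r p)) * b p)
        (u' := fun p => Complex.exp (Complex.I * Complex.ofReal (r p)) * (d p + Complex.I * (ψ p * b p)))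
        (M := max K (C * s * K)) (hec.mul hb.cont)
        (fun p hp => by
          rw [norm_mul, hen, one_mul]; exact (hb.bd p hp).trans (le_max_left _ _))
        (hec.mul hb'.cont)
        (fun p hp => by
          rw [norm_mul, hen, one_mul]; exact (hb'.bd p hp).trans (le_max_right _ _))
        (fun p hp => by
          have := ((hrl p hp).exp').mul' (hd1 p hp)
          have h7 : Complex.exp (Complex.I * Complex.ofReal (r p)) * (d p + Complex.I * (ψ p * b p)) =
            Complex.I * (ψ p) * Complex.exp (Complex.I * Complex.ofReal (r p)) * b p +
              Complex.exp (Complex.I * Complex.ofReal (r p)) * d p := by ring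
          show HasLineDerivAt ℝ _ (Complex.exp (Complex.I * Complex.ofReal (r p)) * (d p + Complex.I * (ψ p * b p))) _ _
          rw [h7]; exact this) hF x
      have hce : HasLineDerivAt ℝ (fun x => eP φ x c) (Complex.I * PW φ [Sum.inl l] x c * eP φ x c) x (eB l) := by
        refine HasLineDerivAt.exp' ?_
        have e2 := PW_line hφ [] (Sum.inl l) (p := (x, c)) hc0
        unfold HasLineDerivAt at e2 ⊢
        simpa [PW, wd, eJ] using e2
      have hfin := hce.mul' hg
      have hre : ∀ x ξ, eP φ x ξ = eP φ x c * Complex.exp (Complex.I * Complex.ofReal (r (x, ξ))) := by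
        intro x ξ
        simp only [eP, hr]
        rw [← Complex.exp_add]
        congr 1
        simp only [PW, wd]
        push_cast; ring
      have hpull : ∀ (g : En n × En n → ℂ) x, ∫ ξ, eP φ x ξ * g (x, ξ) * F ξ =
          eP φ x c * ∫ ξ, Complex.exp (Complex.I * Complex.ofReal (r (x, ξ))) * g (x, ξ) * F ξ := by
        intro g x
        rw [← integral_const_mul]
        refine integral_congr_ae (Filter.Eventually.of_forall fun ξ => ?_)
        simp only []
        rw [hre x ξ]; ring
      have e5 := hpull b
      have e6 := hpull (fun p => d p + Complex.I * (ψ p * b p)) x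
      show HasLineDerivAt ℝ _ ((∫ ξ, eP φ x ξ * (d (x, ξ) + Complex.I * (ψ (x, ξ) * b (x, ξ))) * F ξ) +
        Complex.I * PW φ [Sum.inl l] x c * ∫ ξ, eP φ x ξ * b (x, ξ) * F ξ) _ _
      have e7 : (fun x => ∫ ξ, eP φ x ξ * b (x, ξ) * F ξ) = fun x => eP φ x c *
        ∫ ξ, Complex.exp (Complex.I * Complex.ofReal (r (x, ξ))) * b (x, ξ) * F ξ := funext e5
      have e8 : (∫ ξ, eP φ x ξ * (d (x, ξ) + Complex.I * (ψ (x, ξ) * b (x, ξ))) * F ξ) +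
        Complex.I * PW φ [Sum.inl l] x c * (∫ ξ, eP φ x ξ * b (x, ξ) * F ξ) =
          (Complex.I * PW φ [Sum.inl l] x c * eP φ x c) *
          (∫ ξ, Complex.exp (Complex.I * Complex.ofReal (r (x, ξ))) * b (x, ξ) * F ξ) +
          eP φ x c * (∫ ξ, Complex.exp (Complex.I * Complex.ofReal (r (x, ξ))) * (d (x, ξ) + Complex.I * (ψ (x, ξ) * b (x, ξ))) * F ξ) := by
        rw [e5 x]
        refine (congrArg (· + _) e6).trans ?_
        ring
      rw [e8, e7]
      exact hfin
    · have h4 := ih (by omega) (fun p => d p + Complex.I * (ψ p * b p)) (C * s * K) (by positivity) hb'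
      convert h4 using 1
      ring

end HHop

section cubes
variable {n : ℕ} {φ : En n → En n → ℝ}

/-- grid cubes -/
def Qc (s : ℝ) (ν : Fin n → ℤ) : Set (En n) := bx fun i => Set.Ico (s * ν i) (s * (ν i + 1))

/-- their centers -/
def cQ (s : ℝ) (ν : Fin n → ℤ) : En n := WithLp.toLp 2 fun i => s * (ν i + 1 / 2)

/-- far cubes -/
def Far (ν : Fin n → ℤ) : Prop := ∃ i, ν i < -1 ∨ 0 < ν i

lemma Qc_meas (s : ℝ) (ν : Fin n → ℤ) : MeasurableSet (Qc s ν) := bx_meas fun _ => measurableSet_Ico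

lemma cQ_mem {s : ℝ} (hs : 0 < s) (ν : Fin n → ℤ) : cQ s ν ∈ Qc s ν := by
  intro i
  show s * (ν i + 1 / 2) ∈ _
  constructor <;> nlinarith

lemma Qc_seg {s : ℝ} {ν : Fin n → ℤ} {ξ η ζ : En n} (hξ : ξ ∈ Qc s ν) (hη : η ∈ Qc s ν)
    (hζ : ζ ∈ segment ℝ ξ η) : ζ ∈ Qc s ν := by
  intro i
  obtain ⟨a, b, ha, hb, hab, rfl⟩ := hζ
  have := (convex_Ico (s * ν i) (s * (ν i + 1))) (hξ i) (hη i) ha hb hab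
  simpa using this

lemma Qc_far {s : ℝ} (hs : 0 < s) {ν : Fin n → ℤ} (h : Far ν) {ξ : En n} (hξ : ξ ∈ Qc s ν) : s ≤ ‖ξ‖ := by
  obtain ⟨i, hi⟩ := h
  refine le_trans ?_ (coord_le ξ i)
  have h1 := hξ i
  rcases hi with hi | hi
  · have : (ν i : ℝ) + 1 ≤ -1 := by
      have : ν i + 1 ≤ -1 := by omega
      exact_mod_cast this
    rw [le_abs]; right
    have := h1.2
    nlinarith
  · have : (1 : ℝ) ≤ ν i := by exact_mod_cast hi
    rw [le_abs]; left
    have := h1.1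
    nlinarith

lemma Qc_dist {s : ℝ} (hs : 0 < s) {ν : Fin n → ℤ} {ξ : En n} (hξ : ξ ∈ Qc s ν) : ‖ξ - cQ s ν‖ ≤ n * s := by
  refine norm_le_coord _ fun i => ?_
  have h1 := hξ i
  simp only [Set.mem_Ico] at h1
  show |ξ i - s * (ν i + 1 / 2)| ≤ s
  rw [abs_le]
  constructor <;> nlinarith [h1.1, h1.2]

lemma Qc_farP {s : ℝ} (hs : 0 < s) {ν : Fin n → ℤ} (h : Far ν) {Y : Set (En n)} (hY : MeasurableSet Y) :
    FarP s (Qc s ν ∩ Y) (cQ s ν) where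
  meas := (Qc_meas s ν).inter hY
  seg := fun ξ hξ ζ hζ => Qc_far hs h (Qc_seg (cQ_mem hs ν) hξ.1 hζ)
  dist := fun ξ hξ => Qc_dist hs hξ.1
  cen := Qc_far hs h (cQ_mem hs ν)

lemma Cl.sum {E ι κι : Type} [NormedAddCommGroup E] [NormedSpace ℝ E] {e : ι → E} {w : ι → E → ℝ} {D : Set E} {N : ℕ}
    (hw : ∀ i, ∀ p ∈ D, 0 ≤ w i p) (S : Finset κι) {κ : E → ℝ} {b : κι → E → ℂ}
    (h : ∀ j ∈ S, Cl e w D N κ (b j)) : Cl e w D N (fun p => S.card * κ p) (fun p => ∑ j ∈ S, b j p) := by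
  induction S using Finset.induction_on with
  | empty => simpa using Cl.zero (fun _ _ => le_rfl) hw
  | insert j S hj ih =>
    simp only [Finset.sum_insert hj, Finset.card_insert_of_notMem hj]
    have := (h j (by simp)).add (ih fun i hi => h i (by simp [hi]))
    have e : (fun p => ((S.card + 1 : ℕ) : ℝ) * κ p) = fun p => κ p + S.card * κ p := by
      funext p; push_cast; ring
    rw [e]; exact this

/-- decay weights -/
def dw (ν : Fin n → ℤ) : ℝ := ∏ i, ((1 + |(ν i : ℝ)|) ^ 2)⁻¹

theorem offdiag (hφ : PhiClass 2 φ) {cc : ℝ} (hcc : 0 < cc) : ∃ C : ℝ, 0 < C ∧ ∀ s : ℝ, 1 ≤ s →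
    ∀ ν μ : Fin n → ℤ, Far ν → Far μ → (∀ ζ ∈ segment ℝ (cQ s μ) (cQ s ν), ζ ≠ 0) →
    (∀ x, cc * ‖cQ s ν - cQ s μ‖ ≤ ‖Xg φ x (cQ s ν) - Xg φ x (cQ s μ)‖) →
    ∀ h k A A', 0 ≤ A → 0 ≤ A' → HH s (fun l x => PW φ [Sum.inl l] x (cQ s ν)) (2 * n) A h →
      HH s (fun l x => PW φ [Sum.inl l] x (cQ s μ)) (2 * n) A' k →
      ‖∫ x, h x * (starRingEnd ℂ) (k x)‖ ≤ C * (A * A') * dw (ν - μ) := by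
  set N := 2 * n with hN
  obtain ⟨C2, hC2, h2⟩ := x_diff hφ (N + 1)
  set C3 : ℝ := n * (2 ^ N * (C2 * C2)) * (cc ^ 2)⁻¹ with hC3
  have hC30 : 0 ≤ C3 := by positivity
  set C4 : ℝ := 2 ^ N * (C2 * (invC C3 N * (cc ^ 2)⁻¹)) with hC4
  have hinv := invC_pos hC30 N
  have hC40 : 0 ≤ C4 := by positivity
  have hns := nsC_nonneg n N
  refine ⟨1 + nsC n N * C4 ^ N * 4 ^ n, by positivity, ?_⟩
  intro s hs ν μ hν hμ hseg hlow h k A A' hA hA' hh hk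
  have hs0 : 0 < s := by linarith
  have hdw : 0 ≤ dw (ν - μ) := Finset.prod_nonneg fun i _ => by positivity
  by_cases hne : ν = μ
  · subst hne
    have e1 : dw (ν - ν) = 1 := by simp [dw]
    have := (int_uhk (u := fun _ => 1) (K := 1) continuous_const (by simp) hA hA' hh.memLp hk.conj.memLp hh.base.2 hk.conj.base.2).2
    simp only [one_mul] at this
    rw [e1, mul_one]
    refine this.trans ?_
    have : 0 ≤ nsC n N * C4 ^ N * 4 ^ n := by positivity
    nlinarith [mul_nonneg hA hA']
  set Δ := ‖cQ s ν - cQ s μ‖ with hΔ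
  have hΔi : ∀ i, s * |((ν - μ) i : ℝ)| ≤ Δ := by
    intro i
    refine le_trans (le_of_eq ?_) (coord_le _ i)
    show _ = |s * (ν i + 1 / 2) - s * (μ i + 1 / 2)|
    rw [← mul_sub, abs_mul, abs_of_pos hs0]; simp
  have hΔs : s ≤ Δ := by
    obtain ⟨i, hi⟩ := Function.ne_iff.1 hne
    refine le_trans ?_ (hΔi i)
    have : (1:ℝ) ≤ |((ν - μ) i : ℝ)| := by
      have : 1 ≤ |(ν - μ) i| := Int.one_le_abs (sub_ne_zero.2 hi)
      exact_mod_cast this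
    nlinarith
  have hΔ0 : 0 < Δ := by linarith
  have hcν : cQ s ν ≠ 0 := norm_pos_iff.1 (hs0.trans_le (Qc_far hs0 hν (cQ_mem hs0 ν)))
  have hcμ : cQ s μ ≠ 0 := norm_pos_iff.1 (hs0.trans_le (Qc_far hs0 hμ (cQ_mem hs0 μ)))
  set q : Fin n → En n → ℝ := fun l x => PW φ [Sum.inl l] x (cQ s ν) + -PW φ [Sum.inl l] x (cQ s μ) with hq
  have hw : ∀ i : Fin n, ∀ p ∈ (Set.univ : Set (En n)), (0:ℝ) ≤ (fun (_ : Fin n) (_ : En n) => s) i p := fun _ _ _ => hs0.le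
  have hqc : ∀ l, Cl eB (fun _ _ => s) Set.univ N (fun _ => C2 * Δ) (fun x => (q l x : ℂ)) := by
    intro l
    have key := Cl.of_family (e := eB) (w := fun (_ : Fin n) (_ : En n) => s) (D := Set.univ) (N := N) (κ := fun _ => C2 * Δ)
      (U := fun l' x => ((PW φ ((l :: l').map Sum.inl) x (cQ s ν) + -PW φ ((l :: l').map Sum.inl) x (cQ s μ) : ℝ) : ℂ)) ?_ ?_ ?_
    · exact key
    · intro l' _
      refine Complex.continuous_ofReal.comp_continuousOn (ContinuousOn.add ?_ (ContinuousOn.neg ?_))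
      · exact (PW_contOn hφ _).comp (f := fun x : En n => (x, cQ s ν))
          (Continuous.continuousOn (by fun_prop)) (fun p _ => hcν)
      · exact (PW_contOn hφ _).comp (f := fun x : En n => (x, cQ s μ))
          (Continuous.continuousOn (by fun_prop)) (fun p _ => hcμ)
    · intro l' _ i x _
      have e1 := PW_line hφ ((l :: l').map Sum.inl) (Sum.inl i) (p := (x, cQ s ν)) hcν
      have e2 := PW_line hφ ((l :: l').map Sum.inl) (Sum.inl i) (p := (x, cQ s μ)) hcμ
      unfold HasLineDerivAt at e1 e2 ⊢
      have := (e1.add e2.neg).ofReal_comp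
      simpa [eJ] using this
    · intro l' hl' x _
      rw [Complex.norm_real, Real.norm_eq_abs, ← sub_eq_add_neg]
      refine (h2 (l :: l') (by simp) (by simpa using hl') _ _ hseg x).trans ?_
      refine le_mul_of_one_le_right (by positivity) ?_
      simp only [wprod, List.map_const', List.prod_replicate]
      exact one_le_pow₀ hs
  have hS : Cl eB (fun _ _ => s) Set.univ N (fun _ => C3 * (cc ^ 2 * Δ ^ 2)) (fun x => ∑ l, (q l x : ℂ) * (q l x : ℂ)) := by
    have := Cl.sum hw Finset.univ (fun l _ => (hqc l).mul hw (hqc l))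
    refine this.mono subset_rfl (fun p _ => le_of_eq ?_) (fun p _ => by positivity) hw (fun _ _ _ => le_rfl)
    simp only [Finset.card_univ, Fintype.card_fin, hC3]
    field_simp
  have hSr : ∀ x, ∑ l, (q l x : ℂ) * (q l x : ℂ) = ((∑ l, q l x * q l x : ℝ) : ℂ) := fun x => by push_cast; rfl
  have hSl : ∀ x, cc ^ 2 * Δ ^ 2 ≤ ∑ l, q l x * q l x := by
    intro x
    have h5 := hlow x
    have h6 : ‖Xg φ x (cQ s ν) - Xg φ x (cQ s μ)‖ ^ 2 = ∑ l, q l x * q l x := by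
      rw [EuclideanSpace.norm_sq_eq]
      refine Finset.sum_congr rfl fun l _ => ?_
      show ‖PW φ [Sum.inl l] x (cQ s ν) - PW φ [Sum.inl l] x (cQ s μ)‖ ^ 2 = _
      rw [Real.norm_eq_abs, sq_abs, hq]; ring
    rw [← h6, ← mul_pow]
    exact pow_le_pow_left₀ (by positivity) h5 2
  have hκ : 0 < cc ^ 2 * Δ ^ 2 := by positivity
  have hI := Cl.inv hC30 hw (κ := fun _ => cc ^ 2 * Δ ^ 2) (fun _ _ => hκ) (fun x _ => by
    rw [hSr, Complex.norm_real]; exact (hSl x).trans (le_abs_self _)) hS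
  have hW : ∀ l, Cl eB (fun _ _ => s) Set.univ N (fun _ => C4 * Δ⁻¹) (fun x => (q l x : ℂ) * (∑ l, (q l x : ℂ) * (q l x : ℂ))⁻¹) := by
    intro l
    refine ((hqc l).mul hw hI).mono subset_rfl (fun p _ => le_of_eq ?_) (fun p _ => by positivity) hw (fun _ _ _ => le_rfl)
    rw [hC4]; field_simp
  have hcontq : ∀ l, Continuous (q l) := by
    intro l
    have := continuousOn_univ.1 (hqc l).cont
    have h7 := Complex.continuous_re.comp this
    simpa [Function.comp_def] using h7
  have main := nonstat hs0.le (by positivity : 0 ≤ C4 * Δ⁻¹) (p := fun l x => PW φ [Sum.inl l] x (cQ s ν))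
    (q := fun l x => - PW φ [Sum.inl l] x (cQ s μ)) (M := C2 * Δ) hcontq (fun l x => by
      have := (hqc l).bd x trivial
      rwa [Complex.norm_real, Real.norm_eq_abs] at this) (fun x => by
      have h8 : (∑ l, (q l x : ℂ) * (q l x : ℂ)) ≠ 0 := by
        rw [hSr]; exact_mod_cast (hκ.trans_le (hSl x)).ne'
      have : ∀ l, (q l x : ℂ) * (∑ l, (q l x : ℂ) * (q l x : ℂ))⁻¹ * (q l x : ℂ) =
        (q l x : ℂ) * (q l x : ℂ) * (∑ l, (q l x : ℂ) * (q l x : ℂ))⁻¹ := fun l => by ring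
      show ∑ l, (q l x : ℂ) * (∑ l, (q l x : ℂ) * (q l x : ℂ))⁻¹ * (q l x : ℂ) = 1
      simp_rw [this]
      rw [← Finset.sum_mul, mul_inv_cancel₀ h8]) N hW (u := fun _ => 1) (K := 1) hA hA'
      (Cl.const 1 (by simp) hw) hh hk.conj
  simp only [one_mul, mul_one] at main
  refine main.trans ?_
  have hfin : (C4 * Δ⁻¹ * s) ^ N ≤ C4 ^ N * (4 ^ n * dw (ν - μ)) := by
    rw [mul_assoc, mul_pow]
    gcongr
    have e1 : ∀ z : ℝ, z ^ n = ∏ _i : Fin n, z := fun z => by simp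
    rw [hN, pow_mul, dw, e1, e1, ← Finset.prod_mul_distrib]
    refine Finset.prod_le_prod (fun i _ => by positivity) fun i _ => ?_
    have h9 := hΔi i
    have h10 : Δ⁻¹ * s ≤ 2 * (1 + |((ν - μ) i : ℝ)|)⁻¹ := by
      rw [← div_eq_mul_inv, inv_mul_eq_div, div_le_div_iff₀ hΔ0 (by positivity)]
      nlinarith
    calc (Δ⁻¹ * s) ^ 2 ≤ (2 * (1 + |((ν - μ) i : ℝ)|)⁻¹) ^ 2 := by gcongr
      _ = _ := by rw [mul_pow, inv_pow]; norm_num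
  calc nsC n N * (C4 * Δ⁻¹ * s) ^ N * (A * A') ≤ nsC n N * (C4 ^ N * (4 ^ n * dw (ν - μ))) * (A * A') := by
        gcongr
    _ = (nsC n N * C4 ^ N * 4 ^ n) * (A * A') * dw (ν - μ) := by ring
    _ ≤ _ := by
      gcongr; linarith
end cubes

section schur
variable {n : ℕ} {φ : En n → En n → ℝ}

lemma dw_sum_one : ∃ D : ℝ, 0 < D ∧ ∀ T : Finset ℤ, ∑ k ∈ T, ((1 + |(k : ℝ)|) ^ 2)⁻¹ ≤ D := by
  have h0 : Summable (fun m : ℕ => ((1 + (m : ℝ)) ^ 2)⁻¹) := by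
    have h1 : Summable (fun m : ℕ => ((m : ℝ) ^ 2)⁻¹) := Real.summable_nat_pow_inv.2 (by norm_num)
    have h2 := (summable_nat_add_iff 1).2 h1
    refine h2.congr fun m => ?_
    push_cast; rw [add_comm]
  have h : Summable (fun k : ℤ => ((1 + |(k : ℝ)|) ^ 2)⁻¹) := by
    refine Summable.of_nat_of_neg ?_ ?_ <;> simpa using h0
  refine ⟨1 + ∑' k : ℤ, ((1 + |(k : ℝ)|) ^ 2)⁻¹, ?_, fun T => ?_⟩
  · have : 0 ≤ ∑' k : ℤ, ((1 + |(k : ℝ)|) ^ 2)⁻¹ := tsum_nonneg fun k => by positivity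
    linarith
  · have := h.sum_le_tsum T (fun k _ => by positivity)
    linarith

lemma dw_nonneg (ν : Fin n → ℤ) : 0 ≤ dw ν := Finset.prod_nonneg fun i _ => by positivity

lemma dw_neg (ν : Fin n → ℤ) : dw (-ν) = dw ν := by simp [dw]

lemma dw_sum (n : ℕ) : ∃ D : ℝ, 0 < D ∧ ∀ S : Finset (Fin n → ℤ), ∑ ν ∈ S, dw ν ≤ D := by
  obtain ⟨D, hD, h⟩ := dw_sum_one
  refine ⟨D ^ n, by positivity, fun S => ?_⟩
  have h1 : S ⊆ Fintype.piFinset fun i => S.image fun ν => ν i := by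
    intro ν hν
    rw [Fintype.mem_piFinset]
    exact fun i => Finset.mem_image_of_mem _ hν
  refine (Finset.sum_le_sum_of_subset_of_nonneg h1 fun ν _ _ => dw_nonneg ν).trans ?_
  have h2 := Finset.prod_univ_sum (R := ℝ) (fun i : Fin n => S.image fun ν : Fin n → ℤ => ν i) (fun (_ : Fin n) (k : ℤ) => ((1 + |(k : ℝ)|) ^ 2)⁻¹)
  simp only [dw]
  rw [← h2]
  calc _ ≤ ∏ _i : Fin n, D := Finset.prod_le_prod (fun i _ => Finset.sum_nonneg fun k _ => by positivity) fun i _ => h _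
    _ = D ^ n := by simp

lemma schur_real {D : ℝ} (hD : ∀ S : Finset (Fin n → ℤ), ∑ ν ∈ S, dw ν ≤ D) (S : Finset (Fin n → ℤ)) (a : (Fin n → ℤ) → ℝ) :
    ∑ ν ∈ S, ∑ μ ∈ S, a ν * a μ * dw (ν - μ) ≤ D * ∑ ν ∈ S, a ν ^ 2 := by
  have h1 : ∀ ν, ∑ μ ∈ S, dw (ν - μ) ≤ D := by
    intro ν
    have := hD (S.image fun μ => ν - μ)
    rwa [Finset.sum_image fun x _ y _ h => sub_right_injective h] at this
  have h2 : ∀ μ, ∑ ν ∈ S, dw (ν - μ) ≤ D := by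
    intro μ
    have := hD (S.image fun ν => ν - μ)
    rwa [Finset.sum_image fun x _ y _ h => sub_left_injective h] at this
  calc ∑ ν ∈ S, ∑ μ ∈ S, a ν * a μ * dw (ν - μ)
      ≤ ∑ ν ∈ S, ∑ μ ∈ S, (a ν ^ 2 / 2 * dw (ν - μ) + a μ ^ 2 / 2 * dw (ν - μ)) := by
        refine Finset.sum_le_sum fun ν _ => Finset.sum_le_sum fun μ _ => ?_
        rw [← add_mul]
        exact mul_le_mul_of_nonneg_right (by nlinarith [sq_nonneg (a ν - a μ)]) (dw_nonneg _)
    _ = ∑ ν ∈ S, a ν ^ 2 / 2 * ∑ μ ∈ S, dw (ν - μ) + ∑ μ ∈ S, a μ ^ 2 / 2 * ∑ ν ∈ S, dw (ν - μ) := by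
        simp_rw [Finset.sum_add_distrib, Finset.mul_sum]
        congr 1
        exact Finset.sum_comm
    _ ≤ ∑ ν ∈ S, a ν ^ 2 / 2 * D + ∑ μ ∈ S, a μ ^ 2 / 2 * D := by
        refine add_le_add ?_ ?_ <;> refine Finset.sum_le_sum fun ν _ => mul_le_mul_of_nonneg_left ?_ (by positivity)
        · exact h1 ν
        · exact h2 ν
    _ = D * ∑ ν ∈ S, a ν ^ 2 := by
        rw [← Finset.sum_add_distrib, Finset.mul_sum]
        exact Finset.sum_congr rfl fun ν _ => by ring

lemma schur_one {ι : Type} (S : Finset ι) (h : ι → En n → ℂ) (hm : ∀ ν ∈ S, MemLp (h ν) 2 volume)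
    (R : ι → ι → ℝ) (hR : ∀ ν ∈ S, ∀ μ ∈ S, ‖∫ x, h ν x * (starRingEnd ℂ) (h μ x)‖ ≤ R ν μ) :
    (eLpNorm (fun x => ∑ ν ∈ S, h ν x) 2 volume) ^ 2 ≤ ENNReal.ofReal (∑ ν ∈ S, ∑ μ ∈ S, R ν μ) := by
  have hH : MemLp (fun x => ∑ ν ∈ S, h ν x) 2 volume := memLp_finsetSum S hm
  have hcj : ∀ ν ∈ S, MemLp (fun x => (starRingEnd ℂ) (h ν x)) 2 volume := fun ν hν => (hm ν hν).star
  have hIntg : ∀ ν ∈ S, ∀ μ ∈ S, Integrable (fun x => h ν x * (starRingEnd ℂ) (h μ x)) volume :=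
    fun ν hν μ hμ => (hm ν hν).integrable_mul (hcj μ hμ)
  have e1 : ∫ x, ((‖∑ ν ∈ S, h ν x‖ ^ 2 : ℝ) : ℂ) = ∑ ν ∈ S, ∑ μ ∈ S, ∫ x, h ν x * (starRingEnd ℂ) (h μ x) := by
    have : ∀ x, ((‖∑ ν ∈ S, h ν x‖ ^ 2 : ℝ) : ℂ) = ∑ ν ∈ S, ∑ μ ∈ S, h ν x * (starRingEnd ℂ) (h μ x) := by
      intro x
      push_cast
      rw [← Complex.mul_conj', map_sum, Finset.sum_mul_sum]
    simp_rw [this]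
    rw [integral_finsetSum _ fun ν hν => integrable_finsetSum _ fun μ hμ => hIntg ν hν μ hμ]
    exact Finset.sum_congr rfl fun ν hν => integral_finsetSum _ fun μ hμ => hIntg ν hν μ hμ
  have hint2 : Integrable (fun x => ‖∑ ν ∈ S, h ν x‖ ^ 2) volume := hH.integrable_norm_pow (by norm_num)
  rw [eLpNorm_two_sq]
  have e2 : ∫⁻ x, ‖∑ ν ∈ S, h ν x‖ₑ ^ 2 = ENNReal.ofReal (∫ x, ‖∑ ν ∈ S, h ν x‖ ^ 2) := by
    rw [ofReal_integral_eq_lintegral_ofReal hint2 (Filter.Eventually.of_forall fun x => by positivity)]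
    refine lintegral_congr fun x => ?_
    rw [ENNReal.ofReal_pow (norm_nonneg _), ofReal_norm]
  rw [e2]
  refine ENNReal.ofReal_le_ofReal ?_
  have e3 : (∫ x, ‖∑ ν ∈ S, h ν x‖ ^ 2) = ‖∫ x, ((‖∑ ν ∈ S, h ν x‖ ^ 2 : ℝ) : ℂ)‖ := by
    have h9 : ∫ x, ((‖∑ ν ∈ S, h ν x‖ ^ 2 : ℝ) : ℂ) = ((∫ x, ‖∑ ν ∈ S, h ν x‖ ^ 2 : ℝ) : ℂ) := integral_ofReal (𝕜 := ℂ)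
    rw [h9, Complex.norm_real, Real.norm_of_nonneg]
    exact integral_nonneg fun x => by positivity
  rw [e3, e1]
  refine (norm_sum_le _ _).trans (Finset.sum_le_sum fun ν hν => (norm_sum_le _ _).trans (Finset.sum_le_sum fun μ hμ => hR ν hν μ hμ))

/-- Cauchy-Schwarz for finite sums -/
lemma sum_sq_le {ι : Type} (t : Finset ι) (H : ι → En n → ℂ) (hm : ∀ c ∈ t, AEStronglyMeasurable (H c) volume) :
    (eLpNorm (fun x => ∑ c ∈ t, H c x) 2 volume) ^ 2 ≤ t.card * ∑ c ∈ t, (eLpNorm (H c) 2 volume) ^ 2 := by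
  simp only [eLpNorm_two_sq]
  rw [← lintegral_finsetSum' t fun c hc => (hm c hc).enorm.pow_const 2, ← lintegral_const_mul' _ _ (by simp)]
  refine lintegral_mono fun x => ?_
  have h1 : ‖∑ c ∈ t, H c x‖ₑ ≤ ∑ c ∈ t, ‖H c x‖ₑ := enorm_sum_le _ _
  have h2 : (∑ c ∈ t, ‖H c x‖ₑ) ^ 2 ≤ t.card * ∑ c ∈ t, ‖H c x‖ₑ ^ 2 := by
    have h3 : (∑ c ∈ t, ‖H c x‖) ^ 2 ≤ t.card * ∑ c ∈ t, ‖H c x‖ ^ 2 := sq_sum_le_card_mul_sum_sq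
    have h4 := ENNReal.ofReal_le_ofReal h3
    rw [ENNReal.ofReal_pow (by positivity), ENNReal.ofReal_mul (by positivity), ENNReal.ofReal_sum_of_nonneg (fun _ _ => by positivity),
      ENNReal.ofReal_sum_of_nonneg (fun _ _ => by positivity)] at h4
    simpa only [ENNReal.ofReal_pow (norm_nonneg _), ofReal_norm, ENNReal.ofReal_natCast] using h4
  exact (pow_le_pow_left₀ (zero_le) h1 2).trans h2

/-- disjoint pieces -/
lemma pieces_sq {ι : Type} (S : Finset ι) (P : ι → Set (En n)) (hP : ∀ i ∈ S, MeasurableSet (P i))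
    (hd : Set.PairwiseDisjoint (S : Set ι) P) (F : En n → ℂ) :
    ∑ i ∈ S, (eLpNorm ((P i).indicator F) 2 volume) ^ 2 ≤ (eLpNorm F 2 volume) ^ 2 := by
  simp only [eLpNorm_two_sq]
  have : ∀ i ∈ S, ∫⁻ x, ‖(P i).indicator F x‖ₑ ^ 2 = ∫⁻ x in P i, ‖F x‖ₑ ^ 2 := by
    intro i hi
    rw [← lintegral_indicator (hP i hi)]
    refine lintegral_congr fun x => ?_
    by_cases hx : x ∈ P i <;> simp [hx]
  rw [Finset.sum_congr rfl this, ← lintegral_biUnion_finset hd hP]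
  exact setLIntegral_le_lintegral _ _

lemma FG.ind {D P : Set (En n)} {F : En n → ℂ} (h : FG D F) (hP : MeasurableSet P) : FG (P ∩ D) (P.indicator F) where
  meas := h.meas.indicator hP
  int := h.int.indicator hP
  l2 := h.l2.indicator hP
  supp := fun ξ hξ => by
    by_cases hx : ξ ∈ P
    · rw [Set.indicator_of_mem hx]; exact h.supp ξ fun hD => hξ ⟨hx, hD⟩
    · exact Set.indicator_of_notMem hx _

lemma FG.mono {D D' : Set (En n)} {F : En n → ℂ} (h : FG D F) (hD : D ⊆ D') : FG D' F :=
  ⟨h.meas, h.int, h.l2, fun ξ hξ => h.supp ξ fun h' => hξ (hD h')⟩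

/-- cube index -/
def idx (s : ℝ) (ξ : En n) : Fin n → ℤ := fun i => ⌊ξ i / s⌋

lemma mem_Qc {s : ℝ} (hs : 0 < s) {ν : Fin n → ℤ} {ξ : En n} : ξ ∈ Qc s ν ↔ idx s ξ = ν := by
  rw [funext_iff]
  refine forall_congr' fun i => ?_
  simp only [idx, Set.mem_Ico]
  rw [Int.floor_eq_iff, le_div_iff₀ hs, div_lt_iff₀ hs, mul_comm s, mul_comm s]

lemma Qc_disj {s : ℝ} (hs : 0 < s) : Pairwise (Function.onFun Disjoint (Qc (n := n) s)) := by
  intro ν μ h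
  rw [Function.onFun, Set.disjoint_left]
  intro ξ h1 h2
  exact h (((mem_Qc hs).1 h1).symm.trans ((mem_Qc hs).1 h2))

lemma ind_sum {ι : Type} (S : Finset ι) (P : ι → Set (En n)) (hd : Set.PairwiseDisjoint (S : Set ι) P) {F : En n → ℂ}
    (hF : ∀ ξ, F ξ ≠ 0 → ∃ i ∈ S, ξ ∈ P i) (ξ : En n) : F ξ = ∑ i ∈ S, (P i).indicator F ξ := by
  by_cases h0 : F ξ = 0
  · rw [h0]; symm
    refine Finset.sum_eq_zero fun i _ => ?_
    by_cases hx : ξ ∈ P i <;> simp [hx, h0]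
  · obtain ⟨i, hi, hx⟩ := hF ξ h0
    rw [Finset.sum_eq_single i]
    · simp [hx]
    · intro j hj hji
      refine Set.indicator_of_notMem (fun hxj => ?_) _
      exact Set.disjoint_left.1 (hd hj hi hji) hxj hx
    · exact fun h => absurd hi h

theorem orth (hφ : PhiClass 2 φ) (hsn : SNDcond φ) : ∃ C : ℝ, 0 < C ∧ ∀ s ℓ : ℝ, 1 ≤ s → 0 < ℓ → ℓ ≤ s →
    ∀ Y : Set (En n), MeasurableSet Y → ∀ B K : ℝ, 0 ≤ B → 0 ≤ K → (∀ ν, Far ν → LB φ ℓ (Qc s ν ∩ Y) B) →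
    ∀ b, (∀ ν, Far ν → Cl eJ (wS n s ℓ) (Set.univ ×ˢ (Qc s ν ∩ Y)) (n + 2 * n) (fun _ => K) b) →
    ∀ S : Finset (Fin n → ℤ), (∀ ν ∈ S, Far ν) → ∀ F, FG Y F → (∀ ξ, F ξ ≠ 0 → ∃ ν ∈ S, ξ ∈ Qc s ν) →
    eLpNorm (fun x => ∫ ξ, eP φ x ξ * b (x, ξ) * F ξ) 2 volume ≤ ENNReal.ofReal (C * B * K) * eLpNorm F 2 volume := by
  obtain ⟨t, cl, cc, hcc, hclt, hcone⟩ := cones hφ hsn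
  obtain ⟨C1, hC1, hop⟩ := HH_op hφ (2 * n)
  obtain ⟨C2, hC2, hoff⟩ := offdiag hφ hcc
  obtain ⟨D, hD, hDs⟩ := dw_sum n
  set E : ℝ := t.card * (C2 * (C1 ^ (2 * n)) ^ 2 * D) with hE
  have hC10 : 0 < C1 := by linarith
  have hE0 : 0 ≤ E := by positivity
  refine ⟨Real.sqrt E + 1, by positivity, ?_⟩
  intro s ℓ hs hℓ hℓs Y hY B K hB hK hLB b hb S hS F hF hsupp
  have hs0 : 0 < s := by linarith
  have hdisj : Set.PairwiseDisjoint (S : Set (Fin n → ℤ)) (Qc s) := fun ν _ μ _ h => Qc_disj hs0 h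
  set Fν : (Fin n → ℤ) → En n → ℂ := fun ν => (Qc s ν).indicator F with hFν
  have hFG : ∀ ν, FG (Qc s ν ∩ Y) (Fν ν) := fun ν => hF.ind (Qc_meas s ν)
  set a : (Fin n → ℤ) → ℝ := fun ν => (eLpNorm (Fν ν) 2 volume).toReal with ha
  have hae : ∀ ν, eLpNorm (Fν ν) 2 volume = ENNReal.ofReal (a ν) := fun ν =>
    (ENNReal.ofReal_toReal (hFG ν).l2.eLpNorm_ne_top).symm
  have ha0 : ∀ ν, 0 ≤ a ν := fun ν => ENNReal.toReal_nonneg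
  set h : (Fin n → ℤ) → En n → ℂ := fun ν x => ∫ ξ, eP φ x ξ * b (x, ξ) * Fν ν ξ with hh
  have hHH : ∀ ν ∈ S, HH s (fun l x => PW φ [Sum.inl l] x (cQ s ν)) (2 * n) (B * K * a ν * C1 ^ (2 * n)) (h ν) := by
    intro ν hν
    exact hop s ℓ hs hℓ hℓs _ _ (Qc_farP hs0 (hS ν hν) hY) B hB (hLB ν (hS ν hν)) (Fν ν) (a ν) (ha0 ν) (hFG ν)
      (hae ν).le (2 * n) le_rfl b K hK (hb ν (hS ν hν))
  have hTsum : (fun x => ∫ ξ, eP φ x ξ * b (x, ξ) * F ξ) = fun x => ∑ c ∈ t, ∑ ν ∈ S with cl (cQ s ν) = c, h ν x := by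
    funext x
    rw [Finset.sum_fiberwise_of_maps_to (fun ν _ => hclt (cQ s ν))]
    rw [hh]
    simp only
    have hIntg : ∀ ν ∈ S, Integrable (fun ξ => eP φ x ξ * b (x, ξ) * Fν ν ξ) volume := by
      intro ν hν
      have hQ := Qc_farP hs0 (hS ν hν) hY
      refine slice_int (u := fun p => eP φ p.1 p.2 * b p) (M := K) hQ.meas (ContinuousOn.mul ?_ (hb ν (hS ν hν)).cont) ?_ (hFG ν) x
      · have := (PW_contOn hφ []).mono (s := Unz n) (t := Set.univ ×ˢ (Qc s ν ∩ Y)) fun p hp =>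
          norm_pos_iff.1 (hs0.trans_le (Qc_far hs0 (hS ν hν) hp.2.1))
        exact Complex.continuous_exp.comp_continuousOn (continuousOn_const.mul
          (Complex.continuous_ofReal.comp_continuousOn this))
      · intro p hp
        rw [norm_mul, eP_norm, one_mul]; exact (hb ν (hS ν hν)).bd p hp
    rw [← integral_finsetSum _ hIntg]
    refine integral_congr_ae (Filter.Eventually.of_forall fun ξ => ?_)
    simp only
    rw [← Finset.mul_sum, ← ind_sum S _ hdisj hsupp ξ]
  have hcls : ∀ c ∈ t, (eLpNorm (fun x => ∑ ν ∈ S with cl (cQ s ν) = c, h ν x) 2 volume) ^ 2 ≤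
      ENNReal.ofReal (C2 * (C1 ^ (2 * n)) ^ 2 * D * (B * K) ^ 2) * ∑ ν ∈ S with cl (cQ s ν) = c, (eLpNorm (Fν ν) 2 volume) ^ 2 := by
    intro c hc
    have h1 := schur_one (S.filter fun ν => cl (cQ s ν) = c) h (fun ν hν => (hHH ν (Finset.mem_filter.1 hν).1).memLp)
      (fun ν μ => C2 * ((B * K * a ν * C1 ^ (2 * n)) * (B * K * a μ * C1 ^ (2 * n))) * dw (ν - μ)) (by
        intro ν hν μ hμ
        rw [Finset.mem_filter] at hν hμ
        have hcν : cQ s ν ≠ 0 := norm_pos_iff.1 (hs0.trans_le (Qc_far hs0 (hS ν hν.1) (cQ_mem hs0 ν)))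
        have hcμ : cQ s μ ≠ 0 := norm_pos_iff.1 (hs0.trans_le (Qc_far hs0 (hS μ hμ.1) (cQ_mem hs0 μ)))
        have h2 := hcone _ _ hcν hcμ (hν.2.trans hμ.2.symm)
        exact hoff s hs ν μ (hS ν hν.1) (hS μ hμ.1) h2.1 h2.2 _ _ _ _ (by have := ha0 ν; positivity)
          (by have := ha0 μ; positivity) (hHH ν hν.1) (hHH μ hμ.1))
    refine h1.trans ?_
    have h3 : ∑ ν ∈ S with cl (cQ s ν) = c, (eLpNorm (Fν ν) 2 volume) ^ 2 =
        ENNReal.ofReal (∑ ν ∈ S with cl (cQ s ν) = c, a ν ^ 2) := by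
      rw [ENNReal.ofReal_sum_of_nonneg fun ν _ => by positivity]
      refine Finset.sum_congr rfl fun ν _ => ?_
      rw [hae, ENNReal.ofReal_pow (ha0 ν)]
    rw [h3, ← ENNReal.ofReal_mul (by positivity)]
    refine ENNReal.ofReal_le_ofReal ?_
    have h4 := schur_real hDs (S.filter fun ν => cl (cQ s ν) = c) a
    calc _ = C2 * (C1 ^ (2 * n)) ^ 2 * (B * K) ^ 2 * ∑ ν ∈ S with cl (cQ s ν) = c, ∑ μ ∈ S with cl (cQ s μ) = c, a ν * a μ * dw (ν - μ) := by
          rw [Finset.mul_sum]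
          refine Finset.sum_congr rfl fun ν _ => ?_
          rw [Finset.mul_sum]
          refine Finset.sum_congr rfl fun μ _ => ?_
          ring
      _ ≤ C2 * (C1 ^ (2 * n)) ^ 2 * (B * K) ^ 2 * (D * ∑ ν ∈ S with cl (cQ s ν) = c, a ν ^ 2) := by gcongr
      _ = _ := by ring
  have hEE : (t.card : ℝ) * (C2 * (C1 ^ (2 * n)) ^ 2 * D * (B * K) ^ 2) = E * (B * K) ^ 2 := by rw [hE]; ring
  clear_value E
  have hX : 0 ≤ (Real.sqrt E + 1) * B * K :=
    mul_nonneg (mul_nonneg (add_nonneg (Real.sqrt_nonneg E) zero_le_one) hB) hK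
  have hfin : (eLpNorm (fun x => ∫ ξ, eP φ x ξ * b (x, ξ) * F ξ) 2 volume) ^ 2 ≤
      (ENNReal.ofReal ((Real.sqrt E + 1) * B * K) * eLpNorm F 2 volume) ^ 2 := by
    rw [hTsum]
    refine (sum_sq_le t _ fun c hc => (memLp_finsetSum _ fun ν hν => (hHH ν (Finset.mem_filter.1 hν).1).memLp).1).trans ?_
    calc _ ≤ (t.card : ℝ≥0∞) * ∑ c ∈ t, ENNReal.ofReal (C2 * (C1 ^ (2 * n)) ^ 2 * D * (B * K) ^ 2) *
            ∑ ν ∈ S with cl (cQ s ν) = c, (eLpNorm (Fν ν) 2 volume) ^ 2 := by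
          gcongr with c hc
          exact hcls c hc
      _ = ENNReal.ofReal (E * (B * K) ^ 2) * ∑ ν ∈ S, (eLpNorm (Fν ν) 2 volume) ^ 2 := by
          rw [← Finset.mul_sum, Finset.sum_fiberwise_of_maps_to (fun ν _ => hclt (cQ s ν)), ← mul_assoc,
            ← ENNReal.ofReal_natCast, ← ENNReal.ofReal_mul (Nat.cast_nonneg t.card), hEE]
      _ ≤ ENNReal.ofReal (((Real.sqrt E + 1) * B * K) ^ 2) * (eLpNorm F 2 volume) ^ 2 := by
          refine mul_le_mul' (ENNReal.ofReal_le_ofReal ?_) (pieces_sq S _ (fun ν _ => Qc_meas s ν) hdisj F)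
          rw [mul_assoc (Real.sqrt E + 1), mul_pow (Real.sqrt E + 1)]
          refine mul_le_mul_of_nonneg_right ?_ (sq_nonneg _)
          nlinarith [Real.sq_sqrt hE0, Real.sqrt_nonneg E]
      _ = _ := by rw [ENNReal.ofReal_pow hX, mul_pow]
  exact (ENNReal.pow_le_pow_left_iff (by norm_num)).1 hfin

end schur

section orthfull
variable {n : ℕ} {φ : En n → En n → ℝ}

lemma op_int (hφ : PhiClass 2 φ) {Y : Set (En n)} (hY : MeasurableSet Y) {b : En n × En n → ℂ}
    (hb : ContinuousOn b (Set.univ ×ˢ Y)) {K : ℝ} (hK : ∀ p ∈ Set.univ ×ˢ Y, ‖b p‖ ≤ K) {F : En n → ℂ} (hF : FG Y F)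
    (x : En n) : Integrable (fun ξ => eP φ x ξ * b (x, ξ) * F ξ) volume := by
  have h1 := slice_int hY hb hK hF x
  have h2 : Measurable (fun ξ => eP φ x ξ) := (eP_meas (phi_meas hφ)).comp measurable_prodMk_left
  have h3 := h1.bdd_mul h2.aestronglyMeasurable (c := 1) (Filter.Eventually.of_forall fun ξ => (eP_norm x ξ).le)
  refine h3.congr (Filter.Eventually.of_forall fun ξ => ?_)
  simp only; ring

lemma op_meas (hφ : PhiClass 2 φ) {Y : Set (En n)} (hY : MeasurableSet Y) {b : En n × En n → ℂ}
    (hb : ContinuousOn b (Set.univ ×ˢ Y)) {F : En n → ℂ} (hF : FG Y F) :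
    Measurable (fun x => ∫ ξ, eP φ x ξ * b (x, ξ) * F ξ) := by
  have h1 : Measurable (Function.uncurry fun (x ξ : En n) => eP φ x ξ * Y.indicator (fun ξ => b (x, ξ)) ξ) :=
    (eP_meas (phi_meas hφ)).mul (meas_ind hY hb)
  have h2 := T_meas h1 hF.meas
  have h3 : (fun x => ∫ ξ, eP φ x ξ * b (x, ξ) * F ξ) =
      fun x => ∫ ξ, eP φ x ξ * Y.indicator (fun ξ => b (x, ξ)) ξ * F ξ := by
    funext x
    refine integral_congr_ae (Filter.Eventually.of_forall fun ξ => ?_)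
    by_cases hξ : ξ ∈ Y
    · simp only [Set.indicator_of_mem hξ]
    · simp only [hF.supp ξ hξ, mul_zero]
  rw [h3]; exact h2

lemma op_sum (hφ : PhiClass 2 φ) {Y : Set (En n)} (hY : MeasurableSet Y) {b : En n × En n → ℂ}
    (hb : ContinuousOn b (Set.univ ×ˢ Y)) {K : ℝ} (hK : ∀ p ∈ Set.univ ×ˢ Y, ‖b p‖ ≤ K) {F : En n → ℂ}
    {ι : Type} (S : Finset ι) {G : ι → En n → ℂ} (hG : ∀ i ∈ S, FG Y (G i)) (hFG : ∀ ξ, F ξ = ∑ i ∈ S, G i ξ) (x : En n) :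
    ∫ ξ, eP φ x ξ * b (x, ξ) * F ξ = ∑ i ∈ S, ∫ ξ, eP φ x ξ * b (x, ξ) * G i ξ := by
  rw [← integral_finsetSum _ fun i hi => op_int hφ hY hb hK (hG i hi) x]
  refine integral_congr_ae (Filter.Eventually.of_forall fun ξ => ?_)
  simp only
  rw [hFG, Finset.mul_sum]

/-- near cubes -/
def N0 (n : ℕ) : Finset (Fin n → ℤ) := Fintype.piFinset fun _ => {-1, 0}

lemma N0_iff (ν : Fin n → ℤ) : ν ∈ N0 n ↔ ¬ Far ν := by
  simp only [N0, Fintype.mem_piFinset, Far, not_exists, Finset.mem_insert, Finset.mem_singleton]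
  refine forall_congr' fun i => ?_
  omega

lemma N0_card : (N0 n).card = 2 ^ n := by
  simp [N0]

/-- far region -/
def FarSet (n : ℕ) (s : ℝ) : Set (En n) := (⋃ ν ∈ N0 n, Qc s ν)ᶜ

lemma FarSet_meas (s : ℝ) : MeasurableSet (FarSet n s) :=
  (Finset.measurableSet_biUnion _ fun ν _ => Qc_meas s ν).compl

lemma mem_FarSet {s : ℝ} (hs : 0 < s) {ξ : En n} : ξ ∈ FarSet n s ↔ Far (idx s ξ) := by
  simp only [FarSet, Set.mem_compl_iff, Set.mem_iUnion, mem_Qc hs, exists_prop]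
  constructor
  · intro h
    by_contra hf
    exact h ⟨_, (N0_iff _).2 hf, rfl⟩
  · rintro h ⟨ν, hν, rfl⟩
    exact (N0_iff _).1 hν h

theorem orth_full (hφ : PhiClass 2 φ) (hsn : SNDcond φ) : ∃ C : ℝ, 0 < C ∧ ∀ s ℓ : ℝ, 1 ≤ s → 0 < ℓ → ℓ ≤ s →
    ∀ Y : Set (En n), MeasurableSet Y → ∀ B K : ℝ, 0 ≤ B → 0 ≤ K → (∀ ν, Far ν → LB φ ℓ (Qc s ν ∩ Y) B) →
    ∀ b, ContinuousOn b (Set.univ ×ˢ Y) → (∀ p ∈ Set.univ ×ˢ Y, ‖b p‖ ≤ K) →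
    (∀ ν, Far ν → Cl eJ (wS n s ℓ) (Set.univ ×ˢ (Qc s ν ∩ Y)) (n + 2 * n) (fun _ => K) b) →
    (∀ ν ∈ N0 n, ∀ F, FG (Qc s ν ∩ Y) F → eLpNorm (fun x => ∫ ξ, eP φ x ξ * b (x, ξ) * F ξ) 2 volume ≤
      ENNReal.ofReal (B * K) * eLpNorm F 2 volume) →
    ∀ F, FG Y F →
    eLpNorm (fun x => ∫ ξ, eP φ x ξ * b (x, ξ) * F ξ) 2 volume ≤ ENNReal.ofReal (C * B * K) * eLpNorm F 2 volume := by
  obtain ⟨C, hC, H⟩ := orth hφ hsn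
  refine ⟨C + 2 ^ n, by positivity, ?_⟩
  intro s ℓ hs hℓ hℓs Y hY B K hB hK hLB b hbc hbK hb hnear F hF
  have hs0 : 0 < s := by linarith
  have hind : ∀ (P : Set (En n)), eLpNorm (P.indicator F) 2 volume ≤ eLpNorm F 2 volume := fun P =>
    eLpNorm_indicator_le F
  have hY' : ∀ P : Set (En n), MeasurableSet P → FG Y (P.indicator F) := fun P hP =>
    (hF.ind hP).mono Set.inter_subset_right
  -- far part
  have hfar : eLpNorm (fun x => ∫ ξ, eP φ x ξ * b (x, ξ) * (FarSet n s).indicator F ξ) 2 volume ≤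
      ENNReal.ofReal (C * B * K) * eLpNorm F 2 volume := by
    set F0 := (FarSet n s).indicator F with hF0
    have hF0g : FG Y F0 := hY' _ (FarSet_meas s)
    set Sk : ℕ → Finset (Fin n → ℤ) := fun k => (Fintype.piFinset fun _ => Finset.Icc (-(k:ℤ)) k).filter Far with hSk
    set Pk : ℕ → Set (En n) := fun k => ⋃ ν ∈ Sk k, Qc s ν with hPk
    have hPm : ∀ k, MeasurableSet (Pk k) := fun k => Finset.measurableSet_biUnion _ fun ν _ => Qc_meas s ν
    have hmemP : ∀ k ξ, ξ ∈ Pk k ↔ idx s ξ ∈ Sk k := by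
      intro k ξ
      simp only [hPk, Set.mem_iUnion, mem_Qc hs0, exists_prop]
      simp
    refine fatou_bd (f := fun k x => ∫ ξ, eP φ x ξ * b (x, ξ) * (Pk k).indicator F0 ξ) ?_ ?_ ?_
    · intro k
      exact (op_meas hφ hY hbc ((hF0g.ind (hPm k)).mono Set.inter_subset_right)).aestronglyMeasurable
    · intro x
      refine tendsto_integral_of_dominated_convergence (fun ξ => ‖eP φ x ξ * b (x, ξ) * F0 ξ‖)
        (fun k => (op_int hφ hY hbc hbK ((hF0g.ind (hPm k)).mono Set.inter_subset_right) x).1)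
        (op_int hφ hY hbc hbK hF0g x).norm ?_ ?_
      · intro k
        refine Filter.Eventually.of_forall fun ξ => ?_
        rw [norm_mul, norm_mul _ (F0 ξ)]
        exact mul_le_mul_of_nonneg_left (norm_indicator_le_norm_self _ _) (norm_nonneg _)
      · refine Filter.Eventually.of_forall fun ξ => ?_
        refine tendsto_const_nhds.congr' ?_
        by_cases hξ : ξ ∈ FarSet n s
        · obtain ⟨k0, hk0⟩ : ∃ k0 : ℕ, ∀ i, |idx s ξ i| ≤ k0 := by
            refine ⟨∑ i, (idx s ξ i).natAbs, fun i => ?_⟩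
            have := Finset.single_le_sum (f := fun i => (idx s ξ i).natAbs) (fun _ _ => Nat.zero_le _) (Finset.mem_univ i)
            rw [Int.abs_eq_natAbs]
            exact_mod_cast this
          filter_upwards [Filter.eventually_ge_atTop k0] with k hk
          rw [Set.indicator_of_mem]
          rw [hmemP, hSk, Finset.mem_filter, Fintype.mem_piFinset]
          refine ⟨fun i => ?_, (mem_FarSet hs0).1 hξ⟩
          have h1 := abs_le.1 (hk0 i)
          rw [Finset.mem_Icc]
          constructor <;> [skip; skip] <;> omega
        · have h0 : F0 ξ = 0 := Set.indicator_of_notMem hξ _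
          refine Filter.Eventually.of_forall fun k => ?_
          have h1 : (Pk k).indicator F0 ξ = 0 := by
            by_cases h : ξ ∈ Pk k <;> simp [h, h0]
          simp only [h0, h1]
    · intro k
      refine (H s ℓ hs hℓ hℓs Y hY B K hB hK hLB b hb (Sk k) (fun ν hν => (Finset.mem_filter.1 hν).2) _
        ((hF0g.ind (hPm k)).mono Set.inter_subset_right) ?_).trans ?_
      · intro ξ hξ
        have : ξ ∈ Pk k := by
          by_contra h
          exact hξ (Set.indicator_of_notMem h _)
        exact ⟨idx s ξ, (hmemP k ξ).1 this, (mem_Qc hs0).2 rfl⟩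
      · exact mul_le_mul' le_rfl ((eLpNorm_indicator_le F0).trans (hind _))
  have hsum : ∀ ξ, F ξ = (FarSet n s).indicator F ξ + ∑ ν ∈ N0 n, (Qc s ν).indicator F ξ := by
    intro ξ
    by_cases hξ : ξ ∈ FarSet n s
    · rw [Set.indicator_of_mem hξ, Finset.sum_eq_zero, add_zero]
      intro ν hν
      refine Set.indicator_of_notMem (fun h => hξ ?_) _
      exact Set.mem_biUnion hν h
    · rw [Set.indicator_of_notMem hξ, zero_add]
      have hN : idx s ξ ∈ N0 n := by
        rw [N0_iff]; exact fun h => hξ ((mem_FarSet hs0).2 h)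
      rw [Finset.sum_eq_single_of_mem (idx s ξ) hN]
      · rw [Set.indicator_of_mem ((mem_Qc hs0).2 rfl)]
      · intro ν _ hne
        exact Set.indicator_of_notMem (fun h => hne ((mem_Qc hs0).1 h).symm) _
  have hT : (fun x => ∫ ξ, eP φ x ξ * b (x, ξ) * F ξ) = (fun x => ∫ ξ, eP φ x ξ * b (x, ξ) * (FarSet n s).indicator F ξ) +
      ∑ ν ∈ N0 n, (fun x => ∫ ξ, eP φ x ξ * b (x, ξ) * (Qc s ν).indicator F ξ) := by
    funext x
    rw [Pi.add_apply, Finset.sum_apply, ← integral_finsetSum _ fun ν _ => op_int hφ hY hbc hbK (hY' _ (Qc_meas s ν)) x,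
      ← integral_add (op_int hφ hY hbc hbK (hY' _ (FarSet_meas s)) x)
        (integrable_finsetSum _ fun ν _ => op_int hφ hY hbc hbK (hY' _ (Qc_meas s ν)) x)]
    refine integral_congr_ae (Filter.Eventually.of_forall fun ξ => ?_)
    simp only
    rw [← Finset.mul_sum, ← mul_add, ← hsum ξ]
  have hm : ∀ P : Set (En n), MeasurableSet P →
      AEStronglyMeasurable (fun x => ∫ ξ, eP φ x ξ * b (x, ξ) * P.indicator F ξ) volume := fun P hP =>
    (op_meas hφ hY hbc (hY' P hP)).aestronglyMeasurable
  rw [hT]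
  refine (eLpNorm_add_le (hm _ (FarSet_meas s)) (Finset.aestronglyMeasurable_sum _ fun ν _ => hm _ (Qc_meas s ν))
    (by norm_num)).trans ?_
  have h2 : eLpNorm (∑ ν ∈ N0 n, (fun x => ∫ ξ, eP φ x ξ * b (x, ξ) * (Qc s ν).indicator F ξ)) 2 volume ≤
      ENNReal.ofReal (2 ^ n * (B * K)) * eLpNorm F 2 volume := by
    refine (eLpNorm_sum_le (fun ν _ => hm _ (Qc_meas s ν)) (by norm_num)).trans ?_
    calc _ ≤ ∑ _ν ∈ N0 n, ENNReal.ofReal (B * K) * eLpNorm F 2 volume := by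
          refine Finset.sum_le_sum fun ν hν => (hnear ν hν _ (hF.ind (Qc_meas s ν))).trans ?_
          exact mul_le_mul' le_rfl (hind _)
      _ = _ := by
          rw [Finset.sum_const, N0_card, nsmul_eq_mul, ← mul_assoc, ENNReal.ofReal_mul (p := 2 ^ n) (by positivity),
            ENNReal.ofReal_pow (by norm_num)]
          simp
  refine (add_le_add hfar h2).trans (le_of_eq ?_)
  rw [← add_mul, ← ENNReal.ofReal_add (by positivity) (by positivity)]
  congr 2; ring

end orthfull

section baseA
variable {n : ℕ} {φ : En n → En n → ℝ}

/-- residual phase -/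
def rs (φ : En n → En n → ℝ) (c : En n) (p : En n × En n) : ℝ := φ p.1 p.2 - ⟪Gp φ c p.1, p.2⟫

lemma eP_rs (c x ξ : En n) : eP φ x ξ = eP (fun x ξ => ⟪Gp φ c x, ξ⟫) x ξ *
    Complex.exp (Complex.I * Complex.ofReal (rs φ c (x, ξ))) := by
  unfold eP rs
  rw [← Complex.exp_add]
  congr 1
  push_cast; ring

lemma Gp_cont (hφ : PhiClass 2 φ) {c : En n} (hc : c ≠ 0) : Continuous (Gp φ c) :=
  continuous_iff_continuousAt.2 fun x => (Gp_diff hφ hc x).continuousAt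

lemma rs_cont (hφ : PhiClass 2 φ) {c : En n} (hc : c ≠ 0) : ContinuousOn (rs φ c) (Unz n) := by
  refine ContinuousOn.sub (PW_contOn hφ []) (Continuous.continuousOn ?_)
  exact ((Gp_cont hφ hc).comp continuous_fst).inner continuous_snd

lemma rs_line (hφ : PhiClass 2 φ) {c : En n} (i : Fin n) {p : En n × En n} (hp : p.2 ≠ 0) :
    HasLineDerivAt ℝ (rs φ c) (PW φ [Sum.inr i] p.1 p.2 - PW φ [Sum.inr i] p.1 c) p (eX i) := by
  have h1 := PW_line hφ [] (Sum.inr i) hp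
  unfold HasLineDerivAt at h1 ⊢
  refine HasDerivAt.sub (f := fun t : ℝ => φ (p + t • eX i).1 (p + t • eX i).2)
    (g := fun t : ℝ => ⟪Gp φ c (p + t • eX i).1, (p + t • eX i).2⟫) h1 ?_
  have h2 : (fun t : ℝ => ⟪Gp φ c (p + t • eX i).1, (p + t • eX i).2⟫) =
      fun t : ℝ => ⟪Gp φ c p.1, p.2⟫ + t * PW φ [Sum.inr i] p.1 c := by
    funext t
    simp only [eX, Prod.fst_add, Prod.snd_add, Prod.smul_fst, Prod.smul_snd, smul_zero, add_zero, inner_add_right,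
      real_inner_smul_right]
    congr 2
    rw [eB, EuclideanSpace.inner_single_right]
    simp [Gp]
  rw [h2]
  simpa using ((hasDerivAt_id (0:ℝ)).mul_const (PW φ [Sum.inr i] p.1 c)).const_add (⟪Gp φ c p.1, p.2⟫)

lemma rder_cl (hφ : PhiClass 2 φ) (N : ℕ) : ∃ C : ℝ, 0 < C ∧ ∀ (c : En n) (D : Set (En n)), c ≠ 0 →
    (∀ ξ ∈ D, ξ ≠ 0 ∧ 0 ≤ ⟪ξ, c⟫) → ∀ i, Cl eX (fun _ p => ‖p.2‖⁻¹) (Set.univ ×ˢ D) N (fun _ => C)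
      (fun p => ((PW φ [Sum.inr i] p.1 p.2 - PW φ [Sum.inr i] p.1 c : ℝ) : ℂ)) := by
  obtain ⟨C1, hC1, h1⟩ := PW_mixed_bd hφ (N + 1)
  obtain ⟨C2, hC2, h2⟩ := grad_osc hφ
  refine ⟨C1 + C2, by positivity, fun c D hc hD i => ?_⟩
  set V : List (Fin n) → En n × En n → ℝ := fun l p =>
    if l = [] then PW φ [Sum.inr i] p.1 c else 0 with hV
  have key := Cl.of_family (e := eX) (w := fun _ p => ‖p.2‖⁻¹) (D := Set.univ ×ˢ D) (N := N) (κ := fun _ => C1 + C2)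
    (U := fun l p => ((PW φ (Sum.inr i :: l.map Sum.inr) p.1 p.2 - V l p : ℝ) : ℂ)) ?_ ?_ ?_
  · simpa [hV] using key
  · intro l _
    refine Complex.continuous_ofReal.comp_continuousOn (ContinuousOn.sub ?_ ?_)
    · exact (PW_contOn hφ _).mono fun p hp => (hD p.2 hp.2).1
    · simp only [hV]
      split_ifs
      · exact (PW_contOn hφ [Sum.inr i]).comp (f := fun p : En n × En n => (p.1, c))
          (Continuous.continuousOn (by fun_prop)) (fun p _ => hc)
      · exact continuousOn_const
  · intro l _ j p hp
    have e1 := PW_line hφ (Sum.inr i :: l.map Sum.inr) (Sum.inr j) (hD p.2 hp.2).1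
    have e2 : HasLineDerivAt ℝ (V l) (V (l ++ [j]) p) p (eX j) := by
      simp only [hV]
      rw [if_neg (by simp)]
      unfold HasLineDerivAt
      simp only [eX, Prod.fst_add, Prod.smul_fst, smul_zero, add_zero]
      exact hasDerivAt_const _ _
    unfold HasLineDerivAt at e1 e2 ⊢
    have e3 := (HasDerivAt.sub e1 e2).ofReal_comp
    simpa [eJ, eX, Pi.sub_def] using e3
  · intro l hl p hp
    rw [Complex.norm_real, Real.norm_eq_abs]
    have hw : wprod (fun (_ : Fin n) (p : En n × En n) => ‖p.2‖⁻¹) l p = ‖p.2‖⁻¹ ^ l.length := by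
      simp [wprod]
    rw [hw]
    obtain ⟨hp0, hpc⟩ := hD p.2 hp.2
    have hpos : 0 < ‖p.2‖ := norm_pos_iff.2 hp0
    by_cases hl0 : l = []
    · subst hl0
      simp only [hV, List.map_nil, if_true, List.length_nil, pow_zero, mul_one]
      exact (h2 p.2 c hp0 hc hpc p.1 i).trans (by linarith)
    · simp only [hV, if_neg hl0, sub_zero]
      have hlen : 1 ≤ l.length := List.length_pos_iff.2 hl0
      refine (h1 _ (by simp; omega) (by simp; omega) p.1 p.2 hp0).trans ?_
      have hnr : nr (Sum.inr i :: l.map Sum.inr : List (Fin n ⊕ Fin n)) = l.length + 1 := by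
        rw [nr_inr]; congr 1
        unfold nr
        rw [List.countP_eq_length.2]
        · simp
        · simp
      rw [hnr, pow_succ']
      have : ‖p.2‖ * (‖p.2‖⁻¹ * ‖p.2‖⁻¹ ^ l.length) = ‖p.2‖⁻¹ ^ l.length := by
        rw [← mul_assoc, mul_inv_cancel₀ hpos.ne', one_mul]
      rw [this]
      have : 0 ≤ ‖p.2‖⁻¹ ^ l.length := by positivity
      nlinarith

lemma eP_lin_meas (hφ : PhiClass 2 φ) {c : En n} (hc : c ≠ 0) :
    Measurable (Function.uncurry (eP fun x ξ => ⟪Gp φ c x, ξ⟫)) :=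
  eP_meas (((Gp_cont hφ hc).comp continuous_fst).inner continuous_snd).measurable

lemma Qc_inner {s : ℝ} (hs : 0 < s) {ν : Fin n → ℤ} {ξ : En n} (hξ : ξ ∈ Qc s ν) : 0 ≤ ⟪ξ, cQ s ν⟫ := by
  rw [PiLp.inner_apply]
  refine Finset.sum_nonneg fun i _ => ?_
  have h1 := hξ i
  simp only [Set.mem_Ico] at h1
  have h2 : cQ s ν i = s * (ν i + 1 / 2) := rfl
  rw [h2]
  simp only [RCLike.inner_apply, conj_trivial]
  rcases le_or_gt 0 (ν i) with h | h
  · have h3 : (0:ℝ) ≤ ν i := by exact_mod_cast h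
    have h4 : 0 ≤ ξ i := le_trans (by positivity) h1.1
    positivity
  · have h3 : (ν i : ℝ) + 1 ≤ 0 := by exact_mod_cast h
    have h4 : ξ i ≤ 0 := by nlinarith [h1.2]
    have h5 : s * ((ν i : ℝ) + 1 / 2) ≤ 0 := by nlinarith
    nlinarith

lemma far_unit (hφ : PhiClass 2 φ) (hs : SNDcond φ) : ∃ B : ℝ, 0 ≤ B ∧ ∀ ν, Far ν → LB φ 1 (Qc 1 ν) B := by
  obtain ⟨C, hC, hr⟩ := rder_cl hφ n
  obtain ⟨B0, hB0, hb0⟩ := base_lin hφ hs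
  refine ⟨B0.toReal * (2 ^ n * expC C n) * 2 ^ n, by have := expC_pos hC.le n; positivity, fun ν hν b K hK hb F hF => ?_⟩
  have hD0 : ∀ ξ ∈ Qc 1 ν, ξ ≠ 0 := fun ξ hξ => norm_pos_iff.1 (one_pos.trans_le (Qc_far one_pos hν hξ))
  have hc0 : cQ 1 ν ≠ 0 := hD0 _ (cQ_mem one_pos ν)
  have h1 : Cl eX (fun _ _ => (1:ℝ)⁻¹) (Set.univ ×ˢ Qc 1 ν) n (fun _ => expC C n)
      (fun p => Complex.exp (Complex.I * Complex.ofReal (rs φ (cQ 1 ν) p))) := by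
    refine Cl.exp (N := n) hC.le (by simp) ((rs_cont hφ hc0).mono fun p hp => hD0 p.2 hp.2) (fun i => ?_) n (by omega)
    refine ⟨_, fun p hp => rs_line hφ i (hD0 p.2 hp.2), ?_⟩
    refine (hr _ _ hc0 (fun ξ hξ => ⟨hD0 ξ hξ, Qc_inner one_pos hξ⟩) i).mono subset_rfl (by simp) (by simp [hC.le])
      (by intro i p hp; positivity) ?_
    intro j p hp
    exact inv_anti₀ one_pos (Qc_far one_pos hν hp.2)
  have h2 := hb.mul (by simp) h1
  have h3 := ftc_cl (eP_lin_meas hφ hc0) (fun x ξ => (eP_norm x ξ).le) (fun _ => measurableSet_Ico)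
    (fun i => Set.ordConnected_Ico) one_pos (fun i => by simp) (fun F hF => hb0 _ hc0 F (hF.mono (Set.subset_univ _))) h2 hF
  have h4 : (fun x => ∫ ξ, eP φ x ξ * b (x, ξ) * F ξ) = fun x => ∫ ξ, eP (fun x ξ => ⟪Gp φ (cQ 1 ν) x, ξ⟫) x ξ *
      (b (x, ξ) * Complex.exp (Complex.I * Complex.ofReal (rs φ (cQ 1 ν) (x, ξ)))) * F ξ := by
    funext x
    refine integral_congr_ae (Filter.Eventually.of_forall fun ξ => ?_)
    simp only
    rw [eP_rs (cQ 1 ν) x ξ]; ring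
  rw [h4]
  refine h3.trans (le_of_eq ?_)
  congr 1
  have := expC_pos hC.le n
  conv_lhs => rw [← ENNReal.ofReal_toReal hB0, ← ENNReal.ofReal_mul (by positivity)]
  rw [show (2 ^ n : ℝ≥0∞) = ENNReal.ofReal (2 ^ n) by rw [ENNReal.ofReal_pow (by norm_num)]; simp,
    ← ENNReal.ofReal_mul (by positivity)]
  congr 1; ring

end baseA

section baseN
variable {n : ℕ} {φ : En n → En n → ℝ}

/-- near weights -/
def wN (n : ℕ) (t : ℝ) : ℝ := |t| ^ ((n : ℝ)⁻¹ - 1)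

lemma wN_int (hn : 1 ≤ n) : IntegrableOn (wN n) (Set.Ioc (-1) 1) := by
  have hr : -1 < (n : ℝ)⁻¹ - 1 := by
    have : 0 < (n : ℝ)⁻¹ := by positivity
    linarith
  have h1 : IntervalIntegrable (wN n) volume 0 1 := by
    refine (intervalIntegral.intervalIntegrable_rpow' hr (a := 0) (b := 1)).congr fun t ht => ?_
    rw [Set.uIoc_of_le zero_le_one] at ht
    simp only [wN, abs_of_pos ht.1]
  have h2 : IntervalIntegrable (wN n) volume (-1) 0 := by
    rw [IntervalIntegrable.iff_comp_neg]
    simp only [wN, abs_neg, neg_neg, neg_zero]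
    exact h1.symm
  have := h2.trans h1
  rwa [intervalIntegrable_iff_integrableOn_Ioc_of_le (by norm_num)] at this

lemma wp_low (hn : 1 ≤ n) {ξ : En n} (h0 : ∀ i, ξ i ≠ 0) (l : List (Fin n)) :
    (‖ξ‖ ^ ((n : ℝ)⁻¹ - 1)) ^ l.length ≤ wp (fun _ => wN n) l ξ := by
  induction l with
  | nil => simp [wp]
  | cons i l ih =>
    have h1 : 0 < |ξ i| := abs_pos.2 (h0 i)
    have h2 : ‖ξ‖ ^ ((n : ℝ)⁻¹ - 1) ≤ wN n (ξ i) := by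
      refine Real.rpow_le_rpow_of_nonpos h1 (coord_le ξ i) ?_
      have : (n : ℝ)⁻¹ ≤ 1 := inv_le_one_of_one_le₀ (by exact_mod_cast hn)
      linarith
    have h3 : wp (fun _ => wN n) (i :: l) ξ = wN n (ξ i) * wp (fun _ => wN n) l ξ := by simp [wp]
    rw [h3, List.length_cons, pow_succ']
    exact mul_le_mul h2 ih (by positivity) (le_trans (by positivity) h2)

lemma pow_low (hn : 1 ≤ n) {t : ℝ} (ht : 0 < t) (htn : t ≤ n) (k : ℕ) (hk : k + 1 ≤ n) :
    t⁻¹ ^ k ≤ n * (t ^ ((n : ℝ)⁻¹ - 1)) ^ (k + 1) := by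
  have hn0 : (0:ℝ) < n := by positivity
  have hn1 : (1:ℝ) ≤ n := by exact_mod_cast hn
  rw [← Real.rpow_mul_natCast ht.le]
  have e : t⁻¹ ^ k = t ^ (1 - ((k + 1 : ℕ) : ℝ) / n) * t ^ (((n : ℝ)⁻¹ - 1) * ((k + 1 : ℕ) : ℝ)) := by
    rw [← Real.rpow_add ht, inv_pow, ← Real.rpow_natCast, ← Real.rpow_neg ht.le]
    congr 1
    push_cast
    field_simp; ring
  rw [e]
  refine mul_le_mul_of_nonneg_right ?_ (by positivity)
  have h1 : 0 ≤ 1 - ((k + 1 : ℕ) : ℝ) / n := by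
    rw [sub_nonneg, div_le_one hn0]; exact_mod_cast hk
  calc t ^ (1 - ((k + 1 : ℕ) : ℝ) / n) ≤ (n:ℝ) ^ (1 - ((k + 1 : ℕ) : ℝ) / n) := Real.rpow_le_rpow ht.le htn h1
    _ ≤ (n:ℝ) ^ (1:ℝ) := Real.rpow_le_rpow_of_exponent_le hn1 (by
        have : 0 ≤ ((k + 1 : ℕ) : ℝ) / n := by positivity
        linarith)
    _ = n := Real.rpow_one _

/-- open near box -/
def Jo (ν : Fin n → ℤ) (i : Fin n) : Set ℝ := Set.Ioo (ν i : ℝ) (ν i + 1)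

lemma Jo_sub {ν : Fin n → ℤ} : bx (Jo ν) ⊆ Qc 1 ν := fun ξ hξ i => by
  have := hξ i
  simp only [Jo, Set.mem_Ioo] at this
  simp only [one_mul, Set.mem_Ico]
  exact ⟨this.1.le, this.2⟩

lemma near_open (hn : 1 ≤ n) (hφ : PhiClass 2 φ) (hs : SNDcond φ) : ∃ B : ℝ, 0 ≤ B ∧ ∀ ν ∈ N0 n, ∀ F, FG (bx (Jo ν)) F →
    eLpNorm (fun x => ∫ ξ, eP φ x ξ * F ξ) 2 volume ≤ ENNReal.ofReal B * eLpNorm F 2 volume := by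
  obtain ⟨C, hC, hr⟩ := rder_cl hφ n
  obtain ⟨B0, hB0, hb0⟩ := base_lin hφ hs
  set W : ℝ≥0∞ := ∫⁻ t in Set.Ioc (-1:ℝ) 1, ENNReal.ofReal (wN n t) with hW
  have hWt : W ≠ ⊤ := by
    have := (wN_int hn).lintegral_lt_top
    exact this.ne
  set X := expC (C * n) n with hX
  have hX0 : 0 < X := expC_pos (by positivity) n
  set K : ℝ := 1 + 2 ^ n * (C * X) * n with hK
  have hKt : B0 * ENNReal.ofReal K * (1 + W) ^ n ≠ ⊤ :=
    ENNReal.mul_ne_top (ENNReal.mul_ne_top hB0 ENNReal.ofReal_ne_top) (ENNReal.pow_ne_top (by simp [hWt]))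
  refine ⟨(B0 * ENNReal.ofReal K * (1 + W) ^ n).toReal, ENNReal.toReal_nonneg, fun ν hν F hF => ?_⟩
  rw [ENNReal.ofReal_toReal hKt]
  have hcoord : ∀ ξ ∈ bx (Jo ν), ∀ i, ξ i ≠ 0 ∧ |ξ i| ≤ 1 := by
    intro ξ hξ i
    have h1 := hξ i
    simp only [Jo, Set.mem_Ioo] at h1
    have h2 : ν i = -1 ∨ ν i = 0 := by
      have := (Fintype.mem_piFinset.1 hν) i
      simpa using this
    rw [abs_le]
    rcases h2 with h2 | h2
    · rw [h2] at h1; push_cast at h1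
      exact ⟨by linarith [h1.2] |> fun h : ξ i < 0 => h.ne, by linarith, by linarith⟩
    · rw [h2] at h1; push_cast at h1
      exact ⟨by linarith [h1.1] |> fun h : 0 < ξ i => h.ne', by linarith, by linarith⟩
  have hD0 : ∀ ξ ∈ bx (Jo ν), ξ ≠ 0 := by
    intro ξ hξ h
    exact (hcoord ξ hξ ⟨0, hn⟩).1 (by rw [h]; rfl)
  have hDn : ∀ ξ ∈ bx (Jo ν), ‖ξ‖ ≤ n := by
    intro ξ hξ
    simpa using norm_le_coord ξ fun i => (hcoord ξ hξ i).2
  have hcm : cQ 1 ν ∈ bx (Jo ν) := by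
    intro i
    have h2 : cQ 1 ν i = 1 * (ν i + 1 / 2) := rfl
    rw [h2]
    simp only [Jo, Set.mem_Ioo]
    constructor <;> linarith
  have hsub : ∀ i, Jo ν i ⊆ Set.Ioc (-1 : ℝ) 1 := by
    intro i t ht
    simp only [Jo, Set.mem_Ioo] at ht
    have h2 : ν i = -1 ∨ ν i = 0 := by
      have := (Fintype.mem_piFinset.1 hν) i
      simpa using this
    rcases h2 with h2 | h2 <;> rw [h2] at ht <;> push_cast at ht <;> constructor <;> linarith [ht.1, ht.2]
  set c := cQ 1 ν with hc
  have hc0 : c ≠ 0 := hD0 _ hcm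
  have hDc : ∀ ξ ∈ bx (Jo ν), ξ ≠ 0 ∧ 0 ≤ ⟪ξ, c⟫ := fun ξ hξ => ⟨hD0 ξ hξ, Qc_inner one_pos (Jo_sub hξ)⟩
  have hwnn : ∀ i : Fin n, ∀ p ∈ (Set.univ : Set (En n)) ×ˢ bx (Jo ν), 0 ≤ (fun (_ : Fin n) (p : En n × En n) => ‖p.2‖⁻¹) i p :=
    fun i p _ => by positivity
  have h1 : Cl eX (fun _ p => ‖p.2‖⁻¹) (Set.univ ×ˢ bx (Jo ν)) n (fun _ => X)
      (fun p => Complex.exp (Complex.I * Complex.ofReal (rs φ c p))) := by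
    refine Cl.exp (N := n) (by positivity) hwnn ((rs_cont hφ hc0).mono fun p hp => hD0 p.2 hp.2) (fun i => ?_) n (by omega)
    refine ⟨_, fun p hp => rs_line hφ i (hD0 p.2 hp.2), ?_⟩
    refine (hr _ _ hc0 hDc i).mono subset_rfl ?_ (fun _ _ => hC.le) hwnn (fun _ _ _ => le_rfl)
    intro p hp
    have hp0 : 0 < ‖p.2‖ := norm_pos_iff.2 (hD0 p.2 hp.2)
    have h3 := hDn p.2 hp.2
    rw [mul_assoc]
    refine le_mul_of_one_le_right hC.le ?_
    rw [← div_eq_mul_inv, one_le_div hp0]; exact h3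
  have h2 : ∀ i, Cl eX (fun _ p => ‖p.2‖⁻¹) (Set.univ ×ˢ bx (Jo ν)) n (fun _ => 2 ^ n * ((‖Complex.I‖ * C) * X))
      (fun p => Complex.I * ((PW φ [Sum.inr i] p.1 p.2 - PW φ [Sum.inr i] p.1 c : ℝ) : ℂ) *
        Complex.exp (Complex.I * Complex.ofReal (rs φ c p))) := fun i =>
    (((hr _ _ hc0 hDc i).const_mul Complex.I).mul hwnn h1)
  choose Ui hU0 hU1 hU2 hU3 using fun i => (h2 i).family
  set U : List (Fin n) → En n × En n → ℂ := fun l => match l with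
    | [] => fun p => Complex.exp (Complex.I * Complex.ofReal (rs φ c p))
    | i :: l => Ui i l with hU
  have h3 := ftc_lin (eP_lin_meas hφ hc0) (fun x ξ => (eP_norm x ξ).le) (J := Jo ν) (fun _ => measurableSet_Ioo)
    (fun i => Set.ordConnected_Ioo) (fun i => c i) hcm (w := fun _ => wN n) (fun _ t => by unfold wN; positivity)
    (fun _ => by unfold wN; fun_prop) (W := W) ?_ ?_ (fun F hF => hb0 _ hc0 F (hF.mono (Set.subset_univ _)))
    (fun l x ξ => U l (x, ξ)) K ?_ ?_ ?_ hF
  · refine le_trans (le_of_eq ?_) h3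
    congr 1
    funext x
    refine integral_congr_ae (Filter.Eventually.of_forall fun ξ => ?_)
    simp only [hU]
    rw [eP_rs c x ξ]
  · intro i
    exact (wN_int hn).mono_set (hsub i)
  · intro i
    exact lintegral_mono_set (hsub i)
  · intro l hl
    refine meas_ind (bx_meas fun _ => measurableSet_Ioo) ?_
    cases l with
    | nil => exact h1.cont
    | cons i l => exact hU1 i l (by simp at hl; omega)
  · intro l j hl x ξ hξ
    refine line_slice (b := U l) ?_
    cases l with
    | nil =>
      have := (rs_line hφ (c := c) j (p := (x, ξ)) (hD0 ξ hξ)).exp'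
      show HasLineDerivAt ℝ _ (Ui j [] (x, ξ)) _ _
      rw [hU0]
      exact this
    | cons i l => exact hU2 i l (by simp at hl; omega) j (x, ξ) ⟨trivial, hξ⟩
  · intro l hl x ξ hξ
    cases l with
    | nil =>
      have := (Complex.norm_exp_ofReal_mul_I (rs φ c (x, ξ)))
      simp only [hU, wp, List.map_nil, List.prod_nil, mul_one]
      rw [mul_comm, this, hK]
      have : 0 ≤ 2 ^ n * (C * X) * n := by positivity
      linarith
    | cons i l =>
      have hlen : l.length + 1 ≤ n := by simpa using hl.length_le_card
      have h4 := (hU3 i l (by omega)).bd (x, ξ) ⟨trivial, hξ⟩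
      have h5 : wprod (fun (_ : Fin n) (p : En n × En n) => ‖p.2‖⁻¹) l (x, ξ) = ‖ξ‖⁻¹ ^ l.length := by
        simp [wprod]
      rw [h5] at h4
      refine h4.trans ?_
      have h6 := wp_low hn (fun i => (hcoord ξ hξ i).1) (i :: l)
      have h7 := pow_low hn (norm_pos_iff.2 (hD0 ξ hξ)) (hDn ξ hξ) l.length hlen
      rw [Complex.norm_I, one_mul]
      have h8 : 0 ≤ wp (fun _ => wN n) (i :: l) ξ := le_trans (by positivity) h6
      calc 2 ^ n * (C * X) * ‖ξ‖⁻¹ ^ l.length ≤ 2 ^ n * (C * X) * (n * wp (fun _ => wN n) (i :: l) ξ) := by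
            refine mul_le_mul_of_nonneg_left (h7.trans ?_) (by positivity)
            exact mul_le_mul_of_nonneg_left h6 (by positivity)
        _ = (2 ^ n * (C * X) * n) * wp (fun _ => wN n) (i :: l) ξ := by ring
        _ ≤ K * wp (fun _ => wN n) (i :: l) ξ := mul_le_mul_of_nonneg_right (by rw [hK]; linarith) h8

end baseN

section basea
variable {n : ℕ} {φ : En n → En n → ℝ}

lemma LB.mono_B {ℓ : ℝ} {D : Set (En n)} {B B' : ℝ} (h : LB φ ℓ D B) (hB : B ≤ B') : LB φ ℓ D B' := by
  intro b K hK hb F hF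
  refine (h b K hK hb F hF).trans ?_
  gcongr

lemma coord_null (i : Fin n) (c : ℝ) : volume {ξ : En n | ξ i = c} = 0 := by
  have h2 : {ξ : En n | ξ i = c} = (fun ξ : En n => (MeasurableEquiv.toLp 2 (Fin n → ℝ)).symm ξ) ⁻¹' {v | v i = c} := by
    ext ξ; rfl
  rw [h2]
  have h3 := (EuclideanSpace.volume_preserving_symm_measurableEquiv_toLp (Fin n)).measure_preimage_equiv {v : Fin n → ℝ | v i = c}
  refine h3.trans ?_
  rw [volume_pi]
  exact Measure.pi_hyperplane (fun _ : Fin n => (volume : Measure ℝ)) i c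

theorem base_A (hn : 1 ≤ n) (hφ : PhiClass 2 φ) (hs : SNDcond φ) : ∃ B : ℝ, 0 < B ∧
    BaseBd (eP φ) Set.univ (ENNReal.ofReal B) := by
  obtain ⟨C, hC, H⟩ := orth_full hφ hs
  obtain ⟨B1, hB1, h1⟩ := far_unit hφ hs
  obtain ⟨B2, hB2, h2⟩ := near_open hn hφ hs
  refine ⟨C * (B1 + B2) * 1 + 1, by positivity, fun F hF => ?_⟩
  have h3 := H 1 1 le_rfl one_pos le_rfl Set.univ MeasurableSet.univ (B1 + B2) 1 (by positivity) zero_le_one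
    (fun ν hν => by rw [Set.inter_univ]; exact (h1 ν hν).mono_B (by linarith)) (fun _ => 1) continuousOn_const
    (fun _ _ => by simp) (fun ν _ => Cl.const 1 (fun _ _ => by simp) fun i p _ => wS_nonneg zero_le_one one_pos i p) ?_ F hF
  · simp only [mul_one] at h3 ⊢
    refine h3.trans ?_
    gcongr
    linarith
  · intro ν hν F hF
    rw [Set.inter_univ] at hF
    have hm : MeasurableSet (bx (Jo ν)) := bx_meas fun _ => measurableSet_Ioo
    have hae : (bx (Jo ν)).indicator F =ᵐ[volume] F := by
      have hz : volume (⋃ i, {ξ : En n | ξ i = ν i}) = 0 := measure_iUnion_null fun i => coord_null i _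
      have := compl_mem_ae_iff.2 hz
      filter_upwards [this] with ξ hξ
      by_cases h0 : ξ ∈ bx (Jo ν)
      · rw [Set.indicator_of_mem h0]
      · rw [Set.indicator_of_notMem h0, eq_comm]
        refine hF.supp ξ fun hq => h0 fun i => ?_
        have h5 := hq i
        simp only [one_mul, Set.mem_Ico] at h5
        simp only [Set.mem_compl_iff, Set.mem_iUnion, Set.mem_setOf_eq, not_exists] at hξ
        exact ⟨lt_of_le_of_ne h5.1 (Ne.symm (hξ i)), h5.2⟩
    have h6 := h2 ν hν _ ((hF.ind hm).mono Set.inter_subset_left)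
    rw [eLpNorm_congr_ae hae] at h6
    have h7 : ∀ x, ∫ ξ, eP φ x ξ * (bx (Jo ν)).indicator F ξ = ∫ ξ, eP φ x ξ * 1 * F ξ := by
      intro x
      refine integral_congr_ae ?_
      filter_upwards [hae] with ξ hξ
      rw [hξ, mul_one]
    simp only [h7] at h6
    refine h6.trans ?_
    gcongr
    linarith

end basea

section linL
variable {n : ℕ} {φ : En n → En n → ℝ}

lemma bx_inter (J J' : Fin n → Set ℝ) : bx J ∩ bx J' = bx fun i => J i ∩ J' i := by
  ext ξ
  simp only [bx, Set.mem_inter_iff, Set.mem_setOf_eq, forall_and]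

/-- ℓ-cubes meeting an s-cube -/
def subQ (s ℓ : ℝ) (ν : Fin n → ℤ) : Finset (Fin n → ℤ) :=
  Fintype.piFinset fun i => Finset.Icc ⌊s * ν i / ℓ⌋ ⌊s * (ν i + 1) / ℓ⌋

lemma mem_subQ {s ℓ : ℝ} (hℓ : 0 < ℓ) {ν : Fin n → ℤ} {ξ : En n} (hξ : ξ ∈ Qc s ν) : idx ℓ ξ ∈ subQ s ℓ ν := by
  rw [subQ, Fintype.mem_piFinset]
  intro i
  rw [Finset.mem_Icc]
  have h := hξ i
  simp only [Set.mem_Ico] at h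
  exact ⟨Int.floor_le_floor (by gcongr; exact h.1), Int.floor_le_floor (by gcongr; exact h.2.le)⟩

lemma subQ_card {s ℓ : ℝ} (hℓ : 0 < ℓ) (hs : ℓ ≤ s) (ν : Fin n → ℤ) : ((subQ s ℓ ν).card : ℝ) ≤ (3 * (s / ℓ)) ^ n := by
  rw [subQ, Fintype.card_piFinset]
  push_cast
  have h1 : 1 ≤ s / ℓ := (one_le_div hℓ).2 hs
  calc _ ≤ ∏ _i : Fin n, (3 * (s / ℓ)) := by
        refine Finset.prod_le_prod (fun i _ => by positivity) fun i _ => ?_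
        rw [Int.card_Icc]
        have h2 : ⌊s * ν i / ℓ⌋ ≤ ⌊s * (ν i + 1) / ℓ⌋ := Int.floor_le_floor (by
          have h0 : 0 ≤ s := hℓ.le.trans hs
          gcongr; linarith)
        have h3 : (((⌊s * (ν i + 1) / ℓ⌋ + 1 - ⌊s * ν i / ℓ⌋).toNat : ℤ) : ℝ) = ((⌊s * (ν i + 1) / ℓ⌋ + 1 - ⌊s * ν i / ℓ⌋ : ℤ) : ℝ) := by
          rw [Int.toNat_of_nonneg (by omega)]
        have h4 := Int.floor_le (s * (ν i + 1) / ℓ)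
        have h5 := Int.lt_floor_add_one (s * ν i / ℓ)
        have h6 : s * (ν i + 1) / ℓ = s * ν i / ℓ + s / ℓ := by ring
        push_cast at h3
        rw [h3]
        linarith
    _ = _ := by simp

lemma pieces_sum {ι : Type} (S : Finset ι) (P : ι → Set (En n)) (hP : ∀ i ∈ S, MeasurableSet (P i))
    (hd : Set.PairwiseDisjoint (S : Set ι) P) (F : En n → ℂ) {M : ℝ} (hM : (S.card : ℝ) ≤ M) :
    ∑ i ∈ S, eLpNorm ((P i).indicator F) 2 volume ≤ ENNReal.ofReal (Real.sqrt M) * eLpNorm F 2 volume := by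
  have hM0 : 0 ≤ M := (Nat.cast_nonneg _).trans hM
  have h1 := pieces_sq S P hP hd F
  have h2 : (∑ i ∈ S, eLpNorm ((P i).indicator F) 2 volume) ^ 2 ≤ S.card * ∑ i ∈ S, (eLpNorm ((P i).indicator F) 2 volume) ^ 2 := by
    have h3 := ENNReal.inner_le_Lp_mul_Lq S (fun _ => (1:ℝ≥0∞)) (fun i => eLpNorm ((P i).indicator F) 2 volume) Real.HolderConjugate.two_two
    simp only [one_mul, ENNReal.one_rpow, Finset.sum_const, nsmul_eq_mul, mul_one] at h3
    refine (pow_le_pow_left₀ zero_le h3 2).trans (le_of_eq ?_)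
    rw [mul_pow, ← ENNReal.rpow_natCast, ← ENNReal.rpow_mul, ← ENNReal.rpow_natCast (_ ^ _), ← ENNReal.rpow_mul]
    norm_num
  refine (ENNReal.pow_le_pow_left_iff two_ne_zero).1 (h2.trans ?_)
  rw [mul_pow, ← ENNReal.ofReal_pow (Real.sqrt_nonneg _), Real.sq_sqrt hM0]
  gcongr
  rw [← ENNReal.ofReal_natCast]
  exact ENNReal.ofReal_le_ofReal hM

lemma LB_cube (hn : 1 ≤ n) (hφ : PhiClass 2 φ) {A : ℝ} (hA : 0 < A) (hbase : BaseBd (eP φ) Set.univ (ENNReal.ofReal A))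
    {s ℓ : ℝ} (hℓ : 0 < ℓ) (hs : ℓ ≤ s) {J : Fin n → Set ℝ} (hJm : ∀ i, MeasurableSet (J i))
    (hJo : ∀ i, (J i).OrdConnected) (ν : Fin n → ℤ) :
    LB φ ℓ (Qc s ν ∩ bx J) (A * 2 ^ n * Real.sqrt ((3 * (s / ℓ)) ^ n)) := by
  intro b K hK hb F hF
  have hDm : MeasurableSet (Qc s ν ∩ bx J) := (Qc_meas s ν).inter (bx_meas hJm)
  have hdisj : Set.PairwiseDisjoint (subQ s ℓ ν : Set (Fin n → ℤ)) (Qc ℓ) := fun ν _ μ _ h => Qc_disj hℓ h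
  have hFs : ∀ κ, FG (Qc ℓ κ ∩ (Qc s ν ∩ bx J)) ((Qc ℓ κ).indicator F) := fun κ => hF.ind (Qc_meas ℓ κ)
  have hsum : (fun x => ∫ ξ, eP φ x ξ * b (x, ξ) * F ξ) = ∑ κ ∈ subQ s ℓ ν, fun x => ∫ ξ, eP φ x ξ * b (x, ξ) * (Qc ℓ κ).indicator F ξ := by
    funext x
    rw [Finset.sum_apply]
    refine op_sum hφ hDm hb.cont hb.bd _ (fun κ _ => (hFs κ).mono Set.inter_subset_right) (fun ξ => ?_) x
    refine ind_sum _ _ hdisj (fun ξ hξ => ?_) ξ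
    have h1 : ξ ∈ Qc s ν ∩ bx J := by
      by_contra h; exact hξ (hF.supp ξ h)
    exact ⟨idx ℓ ξ, mem_subQ hℓ h1.1, (mem_Qc hℓ).2 rfl⟩
  rw [hsum]
  have hone : ∀ κ, eLpNorm (fun x => ∫ ξ, eP φ x ξ * b (x, ξ) * (Qc ℓ κ).indicator F ξ) 2 volume ≤
      ENNReal.ofReal (A * 2 ^ n * K) * eLpNorm ((Qc ℓ κ).indicator F) 2 volume := by
    intro κ
    have h1 := hFs κ
    have h2 : Qc ℓ κ ∩ (Qc s ν ∩ bx J) = bx fun i => Set.Ico (ℓ * κ i) (ℓ * (κ i + 1)) ∩ (Set.Ico (s * ν i) (s * (ν i + 1)) ∩ J i) := by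
      unfold Qc; rw [bx_inter, bx_inter]
    rw [h2] at h1
    have h3 := ftc_cl (eP_meas (phi_meas hφ)) (fun x ξ => (eP_norm x ξ).le) 
      (fun i => measurableSet_Ico.inter (measurableSet_Ico.inter (hJm i)))
      (fun i => Set.ordConnected_Ico.inter (Set.ordConnected_Ico.inter (hJo i))) hℓ (fun i => ?_)
      (fun F hF => hbase F (hF.mono (Set.subset_univ _))) (hb.mono (D' := Set.univ ×ˢ (bx fun i => Set.Ico (ℓ * κ i) (ℓ * (κ i + 1)) ∩ (Set.Ico (s * ν i) (s * (ν i + 1)) ∩ J i))) ?_ (fun _ _ => le_rfl) (fun _ _ => hK) (fun _ _ _ => by positivity) (fun _ _ _ => le_rfl)) h1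
    · refine h3.trans (le_of_eq ?_)
      congr 1
      rw [ENNReal.ofReal_mul (by positivity), ENNReal.ofReal_mul (by positivity), ENNReal.ofReal_pow (by norm_num), ENNReal.ofReal_ofNat]
      ring
    · refine (measure_mono Set.inter_subset_left).trans ?_
      rw [Real.volume_Ico]
      exact ENNReal.ofReal_le_ofReal (by linarith)
    · rw [← h2]
      exact Set.prod_mono subset_rfl Set.inter_subset_right
  refine (eLpNorm_sum_le (fun κ _ => (op_meas hφ hDm hb.cont ((hFs κ).mono Set.inter_subset_right)).aestronglyMeasurable) (by norm_num)).trans ?_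
  refine (Finset.sum_le_sum fun κ _ => hone κ).trans ?_
  rw [← Finset.mul_sum]
  refine (mul_le_mul_right (pieces_sum _ _ (fun κ _ => Qc_meas ℓ κ) hdisj F (subQ_card hℓ hs ν)) _).trans (le_of_eq ?_)
  rw [← mul_assoc, ← ENNReal.ofReal_mul (by positivity)]
  congr 2
  ring

theorem lin_L (hn : 1 ≤ n) (hφ : PhiClass 2 φ) (hsn : SNDcond φ) : ∃ C : ℝ, 0 < C ∧ ∀ s ℓ : ℝ, 1 ≤ s → 0 < ℓ → ℓ ≤ s →
    ∀ J : Fin n → Set ℝ, (∀ i, MeasurableSet (J i)) → (∀ i, (J i).OrdConnected) → ∀ K : ℝ, 0 ≤ K →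
    ∀ b, Cl eJ (wS n s ℓ) (Set.univ ×ˢ bx J) (n + 2 * n) (fun _ => K) b →
    ∀ F, FG (bx J) F →
    eLpNorm (fun x => ∫ ξ, eP φ x ξ * b (x, ξ) * F ξ) 2 volume ≤
      ENNReal.ofReal (C * Real.sqrt ((s / ℓ) ^ n) * K) * eLpNorm F 2 volume := by
  obtain ⟨C, hC, H⟩ := orth_full hφ hsn
  obtain ⟨A, hA, hbase⟩ := base_A hn hφ hsn
  refine ⟨C * (A * 2 ^ n * Real.sqrt (3 ^ n)), by positivity, ?_⟩
  intro s ℓ hs hℓ hℓs J hJm hJo K hK b hb F hF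
  have hbν : ∀ ν, Cl eJ (wS n s ℓ) (Set.univ ×ˢ (Qc s ν ∩ bx J)) (n + 2 * n) (fun _ => K) b := fun ν =>
    hb.mono (Set.prod_mono subset_rfl Set.inter_subset_right) (fun _ _ => le_rfl) (fun _ _ => hK)
      (fun i p _ => wS_nonneg (by linarith) hℓ i p) (fun _ _ _ => le_rfl)
  have h1 := H s ℓ hs hℓ hℓs (bx J) (bx_meas hJm) (A * 2 ^ n * Real.sqrt ((3 * (s / ℓ)) ^ n)) K (by positivity) hK
    (fun ν _ => LB_cube hn hφ hA hbase hℓ hℓs hJm hJo ν) b hb.cont hb.bd (fun ν _ => hbν ν) (fun ν _ F hF => ?_) F hF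
  · refine h1.trans (le_of_eq ?_)
    congr 2
    rw [mul_pow, Real.sqrt_mul (by positivity)]
    ring
  · refine LB_cube hn hφ hA hbase hℓ hℓs hJm hJo ν b K hK ?_ F hF
    exact ((hbν ν).le (by omega)).restrict Sum.inr

end linL

section bil
variable {n : ℕ} {a : En n → En n → En n → ℂ}

/-- derivative words of the amplitude -/
def aU (a : En n → En n → En n → ℂ) (l : List (Fin n ⊕ (Fin n ⊕ Fin n))) : En n × En n × En n → ℂ :=
  wd e3 l (fun q : En n × En n × En n => a q.1 q.2.1 q.2.2)

/-- words in the first frequency -/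
def kx (l : List (Fin n)) : List (Fin n ⊕ (Fin n ⊕ Fin n)) := l.map fun i => Sum.inr (Sum.inl i)

/-- embedding of the other directions -/
def tau : Fin n ⊕ Fin n → Fin n ⊕ (Fin n ⊕ Fin n)
  | Sum.inl i => Sum.inl i
  | Sum.inr i => Sum.inr (Sum.inr i)

lemma aU_cont {m ρ δ : ℝ} (ha : HormS2 m ρ δ a) (l : List (Fin n ⊕ (Fin n ⊕ Fin n))) : Continuous (aU a l) :=
  (wd_smooth' e3 l ha.1).continuous

lemma aU_line {m ρ δ : ℝ} (ha : HormS2 m ρ δ a) (l : List (Fin n ⊕ (Fin n ⊕ Fin n))) (i : Fin n ⊕ (Fin n ⊕ Fin n))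
    (p : En n × En n × En n) : HasLineDerivAt ℝ (aU a l) (aU a (l ++ [i]) p) p (e3 i) :=
  wd_line e3 isOpen_univ l ha.1.contDiffOn i (Set.mem_univ p)

lemma line_comp {E E' : Type} [NormedAddCommGroup E] [NormedSpace ℝ E] [NormedAddCommGroup E'] [NormedSpace ℝ E']
    {u : E → ℂ} {u' : ℂ} {p v : E} (T : E' → E) {p' v' : E'} (h : HasLineDerivAt ℝ u u' p v)
    (hT : ∀ t : ℝ, T (p' + t • v') = p + t • v) : HasLineDerivAt ℝ (fun q => u (T q)) u' p' v' := by
  unfold HasLineDerivAt at h ⊢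
  simp only [hT]
  exact h

lemma Bk_ge_one (p : En n × En n × En n) : 1 ≤ Bk p := by
  unfold Bk
  have := norm_nonneg p.2.1
  have := norm_nonneg p.2.2
  linarith

lemma w3_nonneg (ρ δ : ℝ) (i : Fin n ⊕ (Fin n ⊕ Fin n)) (p : En n × En n × En n) : 0 ≤ w3 ρ δ i p := by
  have := Bk_pos p
  cases i <;> simp only [w3] <;> positivity

lemma wprod_le {ι ι' E E' : Type} (w : ι → E → ℝ) (w' : ι' → E' → ℝ) (g : ι' → ι) (p : E) (p' : E')
    (h0 : ∀ i, 0 ≤ w i p) (h : ∀ i, w (g i) p ≤ w' i p') (l : List ι') : wprod w (l.map g) p ≤ wprod w' l p' := by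
  induction l with
  | nil => simp [wprod]
  | cons i l ih =>
    simp only [wprod, List.map_cons, List.prod_cons] at ih ⊢
    refine mul_le_mul (h i) ih ?_ ((h0 _).trans (h i))
    refine List.prod_nonneg fun x hx => ?_
    obtain ⟨i, _, rfl⟩ := List.mem_map.1 hx
    exact h0 i

lemma wprod_kx {ρ δ : ℝ} (l : List (Fin n)) (p : En n × En n × En n) :
    wprod (w3 ρ δ) (kx l) p = (Bk p ^ (-ρ)) ^ l.length :=
  wprod_map_const _ _ _ _ _ fun _ => rfl

/-- amplitude with ξ frozen -/
lemma amp_cl {m ρ δ : ℝ} (ha : HormS2 m ρ δ a) (hm : m ≤ 0) (hρ : 0 ≤ ρ) (hδ0 : 0 ≤ δ) (hδ : δ ≤ 1) (M : ℕ) :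
    ∃ C : ℝ, 0 < C ∧ (∀ l : List (Fin n), l.length ≤ M → ∀ p, ‖aU a (kx l) p‖ ≤ C) ∧
      ∀ R c : ℝ, 1 ≤ R → 1 ≤ c → ∀ (ξ : En n) (D : Set (En n)), (∀ x, ∀ η ∈ D, R ≤ Bk (x, ξ, η) ∧ Bk (x, ξ, η) ≤ c * R) →
      ∀ (l : List (Fin n)) (N : ℕ), l.length + N ≤ M →
      Cl eJ (wS n (c * R ^ δ) (R ^ ρ)) (Set.univ ×ˢ D) N (fun _ => C * (R ^ m * ((R ^ ρ)⁻¹) ^ l.length))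
        (fun p => aU a (kx l) (p.1, ξ, p.2)) := by
  obtain ⟨C, hC, hbd⟩ := amp_bd ha M
  refine ⟨C, hC, fun l hl p => ?_, fun R c hR hc ξ D hD l N hlN => ?_⟩
  · refine (hbd (kx l) (by simpa [kx] using hl) p).trans ?_
    rw [wprod_kx]
    have h1 := Bk_ge_one p
    have h2 : Bk p ^ m ≤ 1 := Real.rpow_le_one_of_one_le_of_nonpos h1 hm
    have h3 : Bk p ^ (-ρ) ≤ 1 := Real.rpow_le_one_of_one_le_of_nonpos h1 (by linarith)
    have h4 := Bk_pos p
    refine mul_le_of_le_one_right hC.le (mul_le_one₀ h2 (by positivity) (pow_le_one₀ (by positivity) h3))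
  · suffices h : Cl eJ (wS n (c * R ^ δ) (R ^ ρ)) (Set.univ ×ˢ D) N (fun _ => C * (R ^ m * ((R ^ ρ)⁻¹) ^ l.length))
        ((fun (l' : List (Fin n ⊕ Fin n)) (p : En n × En n) => aU a (kx l ++ l'.map tau) (p.1, ξ, p.2)) []) by simpa using h
    refine Cl.of_family (U := fun (l' : List (Fin n ⊕ Fin n)) (p : En n × En n) => aU a (kx l ++ l'.map tau) (p.1, ξ, p.2)) ?_ ?_ ?_
    · intro l' _
      exact ((aU_cont ha _).comp (by fun_prop)).continuousOn
    · intro l' _ i p hp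
      have h1 := aU_line ha (kx l ++ l'.map tau) (tau i) (p.1, ξ, p.2)
      have h2 := line_comp (fun q : En n × En n => (q.1, ξ, q.2)) (p' := p) (v' := eJ i) h1 (by
        intro t
        cases i <;> simp [eJ, e3, tau])
      simpa using h2
    · intro l' hl' p hp
      refine (hbd _ (by simp [kx]; omega) _).trans ?_
      set q : En n × En n × En n := (p.1, ξ, p.2) with hq
      obtain ⟨h1, h2⟩ := hD p.1 p.2 hp.2
      rw [← hq] at h1 h2
      have hR0 : 0 < R := by linarith
      have h4 := Bk_pos q
      have h5 : Bk q ^ (-ρ) ≤ (R ^ ρ)⁻¹ := by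
        rw [← Real.rpow_neg hR0.le]
        exact Real.rpow_le_rpow_of_nonpos hR0 h1 (by linarith)
      have h6 : Bk q ^ δ ≤ c * R ^ δ := by
        calc Bk q ^ δ ≤ (c * R) ^ δ := Real.rpow_le_rpow h4.le h2 hδ0
          _ = c ^ δ * R ^ δ := Real.mul_rpow (by linarith) hR0.le
          _ ≤ c * R ^ δ := by
            gcongr
            simpa using Real.rpow_le_rpow_of_exponent_le hc hδ
      have h7 : wprod (w3 ρ δ) (l'.map tau) q ≤ wprod (wS n (c * R ^ δ) (R ^ ρ)) l' p := by
        refine wprod_le _ _ _ _ _ (fun i => w3_nonneg _ _ _ _) (fun i => ?_) l'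
        cases i
        · exact h6
        · exact h5
      have h8 : 0 ≤ wprod (w3 ρ δ) (l'.map tau) q := by
        refine List.prod_nonneg fun x hx => ?_
        obtain ⟨i, _, rfl⟩ := List.mem_map.1 hx
        exact w3_nonneg _ _ _ _
      rw [wprod_append, wprod_kx]
      have h9 : Bk q ^ m ≤ R ^ m := Real.rpow_le_rpow_of_nonpos hR0 h1 hm
      rw [mul_assoc, mul_assoc]
      gcongr

end bil

section blk
variable {n : ℕ} {a : En n → En n → En n → ℂ} {φ₁ φ₂ : En n → En n → ℝ}

/-- inner integral -/
def Vb (φ₂ : En n → En n → ℝ) (a : En n → En n → En n → ℂ) (G : En n → ℂ) (l : List (Fin n)) (x ξ : En n) : ℂ :=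
  ∫ η, eP φ₂ x η * aU a (kx l) (x, ξ, η) * G η

lemma Vb_meas {m ρ δ : ℝ} (ha : HormS2 m ρ δ a) (hφ₂ : PhiClass 2 φ₂) {G : En n → ℂ} (hG : Measurable G) (l : List (Fin n)) :
    Measurable (fun q : En n × En n => Vb φ₂ a G l q.1 q.2) := by
  have h1 : Measurable (fun p : (En n × En n) × En n => eP φ₂ p.1.1 p.2 * aU a (kx l) (p.1.1, p.1.2, p.2) * G p.2) := by
    refine (Measurable.mul ?_ ?_).mul (hG.comp measurable_snd)
    · exact (eP_meas (phi_meas hφ₂)).comp (by fun_prop : Measurable fun p : (En n × En n) × En n => (p.1.1, p.2))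
    · exact ((aU_cont ha (kx l)).comp (by fun_prop : Continuous fun p : (En n × En n) × En n => (p.1.1, p.1.2, p.2))).measurable
  exact h1.stronglyMeasurable.integral_prod_right'.measurable

lemma Vb_bd {C : ℝ} {l : List (Fin n)} (hC : ∀ p, ‖aU a (kx l) p‖ ≤ C) {D : Set (En n)} {G : En n → ℂ}
    (hG : FG D G) (x ξ : En n) : ‖Vb φ₂ a G l x ξ‖ ≤ C * ∫ η, ‖G η‖ := by
  unfold Vb
  rw [← integral_const_mul]
  refine norm_integral_le_of_norm_le (hG.int.norm.const_mul C) (Filter.Eventually.of_forall fun η => ?_)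
  rw [norm_mul, norm_mul, eP_norm, one_mul]
  exact mul_le_mul_of_nonneg_right (hC _) (norm_nonneg _)

lemma wp_const (c : ℝ) (l : List (Fin n)) (ξ : En n) : wp (fun _ _ => c) l ξ = c ^ l.length := by
  simp [wp]

lemma fv_blk (hn : 1 ≤ n) (hφ₂ : PhiClass 2 φ₂) (hs₂ : SNDcond φ₂) {m ρ δ : ℝ} (ha : HormS2 m ρ δ a) (hm : m ≤ 0) (hρ : 0 ≤ ρ)
    (hρδ : ρ ≤ δ) (hδ : δ ≤ 1) : ∃ C : ℝ, 0 < C ∧ ∀ R : ℝ, 1 ≤ R → ∀ (J : Fin n → Set ℝ) (μ : Fin n → ℤ), (∀ i, MeasurableSet (J i)) →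
    (∀ ξ ∈ bx J, ∀ η ∈ Qc R μ, R ≤ 1 + ‖ξ‖ + ‖η‖ ∧ 1 + ‖ξ‖ + ‖η‖ ≤ (1 + 4 * n) * R) → ∀ G, FG (Qc R μ) G →
    FV J (fun _ _ => (R ^ ρ)⁻¹) (List.finRange n) (Vb φ₂ a G)
      (ENNReal.ofReal (C * Real.sqrt ((R ^ δ / R ^ ρ) ^ n) * R ^ m) * eLpNorm G 2 volume) := by
  obtain ⟨C1, hC1, hbd, hcl⟩ := amp_cl ha hm hρ (hρ.trans hρδ) hδ (n + (n + 2 * n))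
  obtain ⟨C2, hC2, hL⟩ := lin_L hn hφ₂ hs₂
  refine ⟨C2 * Real.sqrt ((1 + 4 * n) ^ n) * C1, by positivity, ?_⟩
  intro R hR J μ hJm hB G hG
  have hR0 : 0 < R := by linarith
  have hlen : ∀ l : List (Fin n), l.Sublist (List.finRange n) → l.length ≤ n := fun l hl => by
    simpa using hl.length_le
  have hℓ : 0 < R ^ ρ := by positivity
  have hbd' : ∀ l : List (Fin n), l.Sublist (List.finRange n) → ∀ p, ‖aU a (kx l) p‖ ≤ C1 := fun l hl =>
    hbd l (by have := hlen l hl; omega)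
  refine ⟨?_, ?_, ?_, ?_, ?_⟩
  · intro l hl
    have h1 := (Vb_meas ha hφ₂ hG.meas l).indicator (MeasurableSet.univ.prod (bx_meas hJm) : MeasurableSet ((Set.univ : Set (En n)) ×ˢ bx J))
    have h2 : (fun q : En n × En n => (bx J).indicator (Vb φ₂ a G l q.1) q.2) =
        ((Set.univ : Set (En n)) ×ˢ bx J).indicator (fun q : En n × En n => Vb φ₂ a G l q.1 q.2) := by
      funext q
      by_cases hq : q.2 ∈ bx J
      · rw [Set.indicator_of_mem hq, Set.indicator_of_mem (by exact ⟨trivial, hq⟩)]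
      · rw [Set.indicator_of_notMem hq, Set.indicator_of_notMem (fun h => hq h.2)]
    rw [h2]; exact h1
  · intro l j hl x ξ hξ
    have hGx : FG (Qc R μ) (fun η => eP φ₂ x η * G η) := hG.mul_bdd
      ((eP_meas (phi_meas hφ₂)).comp measurable_prodMk_left) fun η => (eP_norm x η).le
    have hl' : l.Sublist (List.finRange n) := (List.sublist_append_left l [j]).trans hl
    have h1 := int_line (E := En n) (Qc_meas R μ) (u := fun p => aU a (kx l) (x, p.1, p.2)) (u' := fun p => aU a (kx (l ++ [j])) (x, p.1, p.2))
      (v := eB j) ((aU_cont ha _).comp (by fun_prop)).continuousOn (M := C1) (fun p _ => hbd' l hl' _)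
      ((aU_cont ha _).comp (by fun_prop)).continuousOn (fun p _ => hbd' _ hl _) (fun p _ => ?_) hGx ξ
    · have e1 : ∀ l ξ, Vb φ₂ a G l x ξ = ∫ η, aU a (kx l) (x, ξ, η) * (eP φ₂ x η * G η) := by
        intro l ξ
        unfold Vb
        congr 1; funext η; ring
      have e2 : Vb φ₂ a G l x = fun ξ => ∫ η, aU a (kx l) (x, ξ, η) * (eP φ₂ x η * G η) := funext (e1 l)
      rw [e1, e2]
      exact h1
    · have h2 := aU_line ha (kx l) (Sum.inr (Sum.inl j)) (x, p.1, p.2)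
      have h3 := line_comp (fun q : En n × En n => (x, q.1, q.2)) (p' := p) (v' := (eB j, 0)) h2 (by
        intro t; simp [e3, Prod.ext_iff])
      have h4 : kx l ++ [Sum.inr (Sum.inl j)] = kx (l ++ [j]) := by simp [kx]
      rw [h4] at h3
      exact h3
  · intro l hl ξ hξ
    have hl1 := hlen l hl
    have hc1 : (1:ℝ) ≤ 1 + 4 * n := by
      have : (0:ℝ) ≤ n := by positivity
      linarith
    have h1 := hcl R (1 + 4 * n) hR hc1 ξ (Qc R μ) (fun x η hη => hB ξ hξ η hη) l (n + 2 * n) (by omega)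
    have hRδ : R ^ ρ ≤ R ^ δ := Real.rpow_le_rpow_of_exponent_le hR hρδ
    have hδ1 : 1 ≤ R ^ δ := Real.one_le_rpow hR (hρ.trans hρδ)
    have h2 := hL ((1 + 4 * n) * R ^ δ) (R ^ ρ) (one_le_mul_of_one_le_of_one_le hc1 hδ1) hℓ
      (hRδ.trans (le_mul_of_one_le_left (by linarith) hc1)) _ (fun _ => measurableSet_Ico) (fun _ => Set.ordConnected_Ico)
      _ (by positivity) _ h1 G hG
    refine h2.trans (le_of_eq ?_)
    rw [wp_const, mul_right_comm (ENNReal.ofReal _) (eLpNorm G 2 volume), ← ENNReal.ofReal_mul (by positivity)]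
    congr 2
    rw [mul_div_assoc, mul_pow, Real.sqrt_mul (by positivity)]
    ring
  · intro x
    refine ⟨C1 * (∫ η, ‖G η‖) * (R ^ ρ) ^ n, fun l hl ξ hξ => ?_⟩
    refine (Vb_bd (hbd' l hl) hG x ξ).trans ?_
    rw [wp_const, mul_assoc]
    refine le_mul_of_one_le_right (mul_nonneg hC1.le (integral_nonneg fun _ => norm_nonneg _)) ?_
    rw [inv_pow, ← div_eq_mul_inv, one_le_div (by positivity)]
    exact pow_le_pow_right₀ (Real.one_le_rpow hR hρ) (hlen l hl)
  · intro l hl x ξ _ ξ' _ h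
    have : ξ = ξ' := by
      ext j; exact h j (List.mem_finRange j)
    rw [this]

theorem blk (hn : 1 ≤ n) (hφ₁ : PhiClass 2 φ₁) (hφ₂ : PhiClass 2 φ₂) (hs₁ : SNDcond φ₁) (hs₂ : SNDcond φ₂)
    {m ρ δ : ℝ} (ha : HormS2 m ρ δ a) (hm : m ≤ 0) (hρ : 0 ≤ ρ) (hρδ : ρ ≤ δ) (hδ : δ ≤ 1) :
    ∃ C : ℝ, 0 < C ∧ ∀ R : ℝ, 1 ≤ R → ∀ (ν μ : Fin n → ℤ),
    (∀ ξ ∈ Qc R ν, ∀ η ∈ Qc R μ, R ≤ 1 + ‖ξ‖ + ‖η‖ ∧ 1 + ‖ξ‖ + ‖η‖ ≤ (1 + 4 * n) * R) → ∀ F G, FG (Qc R ν) F → FG (Qc R μ) G →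
    eLpNorm (fun x => ∫ ξ, eP φ₁ x ξ * Vb φ₂ a G [] x ξ * F ξ) 1 volume ≤
      ENNReal.ofReal (C * (R ^ m * Real.sqrt ((R / R ^ ρ) ^ n) * Real.sqrt ((R ^ δ / R ^ ρ) ^ n))) *
        (eLpNorm F 2 volume * eLpNorm G 2 volume) := by
  obtain ⟨C1, hC1, hfv⟩ := fv_blk hn hφ₂ hs₂ ha hm hρ hρδ hδ
  obtain ⟨A, hA, hbase⟩ := base_A hn hφ₁ hs₁
  obtain ⟨C0, hC0, hbd, -⟩ := amp_cl ha hm hρ (hρ.trans hρδ) hδ 0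
  refine ⟨A * C1 * 2 ^ n * Real.sqrt (3 ^ n), by positivity, ?_⟩
  intro R hR ν μ hB F G hF hG
  have hR0 : 0 < R := by linarith
  have hℓ : 0 < R ^ ρ := by positivity
  have hℓR : R ^ ρ ≤ R := by simpa using Real.rpow_le_rpow_of_exponent_le hR (hρδ.trans hδ)
  set ℓ := R ^ ρ with hℓd
  set S := subQ R ℓ ν with hS
  have hdisj : Set.PairwiseDisjoint (S : Set (Fin n → ℤ)) (Qc ℓ) := fun ν _ μ _ h => Qc_disj hℓ h
  have hFs : ∀ κ, FG (Qc ℓ κ ∩ Qc R ν) ((Qc ℓ κ).indicator F) := fun κ => hF.ind (Qc_meas ℓ κ)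
  have hVm := Vb_meas ha hφ₂ hG.meas []
  have hem : Measurable (Function.uncurry fun x ξ => eP φ₁ x ξ * Vb φ₂ a G [] x ξ) := (eP_meas (phi_meas hφ₁)).mul hVm
  have hIntg : ∀ κ x, Integrable (fun ξ => eP φ₁ x ξ * Vb φ₂ a G [] x ξ * (Qc ℓ κ).indicator F ξ) volume := by
    intro κ x
    refine (hFs κ).int.bdd_mul (hem.comp measurable_prodMk_left).aestronglyMeasurable
      (c := C0 * ∫ η, ‖G η‖) (Filter.Eventually.of_forall fun ξ => ?_)
    show ‖eP φ₁ x ξ * Vb φ₂ a G [] x ξ‖ ≤ _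
    rw [norm_mul, eP_norm, one_mul]
    exact Vb_bd (hbd [] le_rfl) hG x ξ
  have hsum : (fun x => ∫ ξ, eP φ₁ x ξ * Vb φ₂ a G [] x ξ * F ξ) =
      ∑ κ ∈ S, fun x => ∫ ξ, eP φ₁ x ξ * Vb φ₂ a G [] x ξ * (Qc ℓ κ).indicator F ξ := by
    funext x
    rw [Finset.sum_apply, ← integral_finsetSum _ fun κ _ => hIntg κ x]
    congr 1; funext ξ
    rw [← Finset.mul_sum, ← ind_sum S (Qc ℓ) hdisj (fun ξ hξ => ?_) ξ]
    have h1 : ξ ∈ Qc R ν := by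
      by_contra h; exact hξ (hF.supp ξ h)
    exact ⟨idx ℓ ξ, mem_subQ hℓ h1, (mem_Qc hℓ).2 rfl⟩
  rw [hsum]
  set K := C1 * Real.sqrt ((R ^ δ / ℓ) ^ n) * R ^ m with hK
  have hK0 : 0 ≤ K := by positivity
  have hone : ∀ κ, eLpNorm (fun x => ∫ ξ, eP φ₁ x ξ * Vb φ₂ a G [] x ξ * (Qc ℓ κ).indicator F ξ) 1 volume ≤
      ENNReal.ofReal (A * K * 2 ^ n) * eLpNorm G 2 volume * eLpNorm ((Qc ℓ κ).indicator F) 2 volume := by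
    intro κ
    have h1 := hFs κ
    have h2 : Qc ℓ κ ∩ Qc R ν = bx fun i => Set.Ico (ℓ * κ i) (ℓ * (κ i + 1)) ∩ Set.Ico (R * ν i) (R * (ν i + 1)) := by
      unfold Qc; rw [bx_inter]
    by_cases hne : (Qc ℓ κ ∩ Qc R ν).Nonempty
    swap
    · rw [base_empty hne h1]; simp
    obtain ⟨p, hp⟩ := hne
    rw [h2] at h1 hp
    have hJm : ∀ i, MeasurableSet (Set.Ico (ℓ * κ i) (ℓ * (κ i + 1)) ∩ Set.Ico (R * ν i) (R * (ν i + 1))) :=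
      fun i => measurableSet_Ico.inter measurableSet_Ico
    have hvol : ∀ i, volume (Set.Ico (ℓ * κ i) (ℓ * (κ i + 1)) ∩ Set.Ico (R * ν i) (R * (ν i + 1))) ≤ ENNReal.ofReal ℓ := by
      intro i
      refine (measure_mono Set.inter_subset_left).trans ?_
      rw [Real.volume_Ico]
      exact ENNReal.ofReal_le_ofReal (by linarith)
    have h4 := hfv R hR _ μ hJm (fun ξ hξ η hη => hB ξ (by rw [← h2] at hξ; exact hξ.2) η hη) G hG
    have h3 := ftc_main (eP_meas (phi_meas hφ₁)) (fun x ξ => (eP_norm x ξ).le) hJm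
      (fun i => Set.ordConnected_Ico.inter Set.ordConnected_Ico) (fun i => p i) hp (w := fun _ _ => ℓ⁻¹) (fun _ _ => by positivity)
      (fun _ => measurable_const) (fun i => integrableOn_const ((hvol i).trans_lt ENNReal.ofReal_lt_top).ne) (W := 1) (fun i => ?_)
      (fun F hF => hbase F (hF.mono (Set.subset_univ _))) (List.finRange n) (List.nodup_finRange n) _ _ h4 _ h1
    · rw [eLpNorm_one_eq_lintegral_enorm]
      refine h3.trans (le_of_eq ?_)
      rw [List.length_finRange, ENNReal.ofReal_mul (p := A * K) (by positivity), ENNReal.ofReal_mul (p := A) hA.le, ENNReal.ofReal_pow (by norm_num), ENNReal.ofReal_ofNat]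
      rw [one_add_one_eq_two]
      ring
    · rw [lintegral_const, Measure.restrict_apply MeasurableSet.univ, Set.univ_inter]
      refine (mul_le_mul_right (hvol i) _).trans (le_of_eq ?_)
      rw [← ENNReal.ofReal_mul (by positivity), inv_mul_cancel₀ hℓ.ne', ENNReal.ofReal_one]
  refine (eLpNorm_sum_le (fun κ _ => (T_meas hem (hFs κ).meas).aestronglyMeasurable) le_rfl).trans ?_
  refine (Finset.sum_le_sum fun κ _ => hone κ).trans ?_
  rw [← Finset.mul_sum]
  refine (mul_le_mul_right (pieces_sum _ _ (fun κ _ => Qc_meas ℓ κ) hdisj F (subQ_card hℓ hℓR ν)) _).trans (le_of_eq ?_)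
  rw [mul_pow, Real.sqrt_mul (by positivity)]
  have e1 : A * C1 * 2 ^ n * Real.sqrt (3 ^ n) * (R ^ m * Real.sqrt ((R / ℓ) ^ n) * Real.sqrt ((R ^ δ / ℓ) ^ n)) =
      A * K * 2 ^ n * (Real.sqrt (3 ^ n) * Real.sqrt ((R / ℓ) ^ n)) := by rw [hK]; ring
  rw [e1, ENNReal.ofReal_mul (p := A * K * 2 ^ n) (by positivity)]
  ring

end blk

section asm
variable {n : ℕ} {a : En n → En n → En n → ℂ} {φ₁ φ₂ : En n → En n → ℝ}

lemma fatou_one {f : ℕ → En n → ℂ} {g : En n → ℂ} {C : ℝ≥0∞} (hf : ∀ k, AEStronglyMeasurable (f k) volume)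
    (hlim : ∀ x, Filter.Tendsto (fun k => f k x) Filter.atTop (nhds (g x)))
    (hC : ∀ k, eLpNorm (f k) 1 volume ≤ C) : eLpNorm g 1 volume ≤ C := by
  refine (Lp.eLpNorm_lim_le_liminf_eLpNorm hf g (Filter.Eventually.of_forall hlim)).trans ?_
  calc Filter.liminf (fun k => eLpNorm (f k) 1 volume) Filter.atTop
      ≤ Filter.liminf (fun _ : ℕ => C) Filter.atTop := Filter.liminf_le_liminf (Filter.Eventually.of_forall hC)
    _ = C := Filter.liminf_const C

/-- bilinear integrand -/
def Hk (a : En n → En n → En n → ℂ) (φ₁ φ₂ : En n → En n → ℝ) (F G : En n → ℂ) (x : En n) (w : En n × En n) : ℂ :=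
  a x w.1 w.2 * Complex.exp (Complex.I * Complex.ofReal (φ₁ x w.1 + φ₂ x w.2)) * F w.1 * G w.2

lemma Hk_eq (F G : En n → ℂ) (x ξ η : En n) :
    Hk a φ₁ φ₂ F G x (ξ, η) = eP φ₁ x ξ * (eP φ₂ x η * a x ξ η * G η) * F ξ := by
  unfold Hk eP
  simp only [Complex.ofReal_add, mul_add, Complex.exp_add]
  ring

lemma Hk_meas {m ρ δ : ℝ} (ha : HormS2 m ρ δ a) (hφ₁ : PhiClass 2 φ₁) (hφ₂ : PhiClass 2 φ₂) {F G : En n → ℂ}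
    (hF : Measurable F) (hG : Measurable G) :
    Measurable (fun p : En n × (En n × En n) => Hk a φ₁ φ₂ F G p.1 p.2) := by
  have e : (fun p : En n × (En n × En n) => Hk a φ₁ φ₂ F G p.1 p.2) =
      fun p => eP φ₁ p.1 p.2.1 * (eP φ₂ p.1 p.2.2 * a p.1 p.2.1 p.2.2 * G p.2.2) * F p.2.1 := by
    funext p; exact Hk_eq F G p.1 p.2.1 p.2.2
  rw [e]
  refine Measurable.mul (Measurable.mul ?_ (Measurable.mul (Measurable.mul ?_ ?_) ?_)) ?_
  · exact (eP_meas (phi_meas hφ₁)).comp (by fun_prop : Measurable fun p : En n × (En n × En n) => (p.1, p.2.1))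
  · exact (eP_meas (phi_meas hφ₂)).comp (by fun_prop : Measurable fun p : En n × (En n × En n) => (p.1, p.2.2))
  · exact ha.1.continuous.measurable
  · exact hG.comp (by fun_prop)
  · exact hF.comp (by fun_prop)

lemma Hk_int {m ρ δ : ℝ} (ha : HormS2 m ρ δ a) (hφ₁ : PhiClass 2 φ₁) (hφ₂ : PhiClass 2 φ₂) {D D' : Set (En n)} {F G : En n → ℂ}
    (hF : FG D F) (hG : FG D' G) {C : ℝ} (hC : ∀ x ξ η, ‖a x ξ η‖ ≤ C) (x : En n) :
    Integrable (Hk a φ₁ φ₂ F G x) volume := by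
  have h1 : Integrable (fun w : En n × En n => F w.1 * G w.2) volume := hF.int.mul_prod hG.int
  refine (h1.norm.const_mul C).mono' ((Hk_meas ha hφ₁ hφ₂ hF.meas hG.meas).comp measurable_prodMk_left).aestronglyMeasurable
    (Filter.Eventually.of_forall fun w => ?_)
  show ‖Hk a φ₁ φ₂ F G x w‖ ≤ _
  have := Hk_eq (a := a) (φ₁ := φ₁) (φ₂ := φ₂) F G x w.1 w.2
  rw [show Hk a φ₁ φ₂ F G x w = _ from this]
  simp only [norm_mul, eP_norm, one_mul]
  rw [mul_assoc, mul_comm ‖G w.2‖]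
  exact mul_le_mul_of_nonneg_right (hC _ _ _) (by positivity)

lemma Hk_ind (F G : En n → ℂ) (P Q : Set (En n)) (x : En n) :
    (P ×ˢ Q).indicator (Hk a φ₁ φ₂ F G x) = Hk a φ₁ φ₂ (P.indicator F) (Q.indicator G) x := by
  funext w
  unfold Hk
  by_cases h1 : w.1 ∈ P
  · by_cases h2 : w.2 ∈ Q
    · rw [Set.indicator_of_mem (by exact ⟨h1, h2⟩), Set.indicator_of_mem h1, Set.indicator_of_mem h2]
    · rw [Set.indicator_of_notMem (fun h => h2 h.2), Set.indicator_of_notMem h2, mul_zero]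
  · rw [Set.indicator_of_notMem (fun h => h1 h.1), Set.indicator_of_notMem h1, mul_zero, zero_mul]

lemma Hk_nested {m ρ δ : ℝ} (ha : HormS2 m ρ δ a) (hφ₁ : PhiClass 2 φ₁) (hφ₂ : PhiClass 2 φ₂) {D D' : Set (En n)} {F G : En n → ℂ}
    (hF : FG D F) (hG : FG D' G) {C : ℝ} (hC : ∀ x ξ η, ‖a x ξ η‖ ≤ C) (x : En n) :
    ∫ w, Hk a φ₁ φ₂ F G x w = ∫ ξ, eP φ₁ x ξ * Vb φ₂ a G [] x ξ * F ξ := by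
  rw [show (volume : Measure (En n × En n)) = (volume : Measure (En n)).prod volume from rfl,
    integral_prod _ (Hk_int ha hφ₁ hφ₂ hF hG hC x)]
  congr 1; funext ξ
  unfold Vb
  rw [← integral_const_mul, ← integral_mul_const]
  congr 1; funext η
  exact Hk_eq F G x ξ η

/-- the four-fold index block -/
def M4 (n : ℕ) : Finset (Fin n → ℤ) := Fintype.piFinset fun _ => Finset.Icc (-2) 1

lemma N0_sub {ν : Fin n → ℤ} (h : ν ∈ N0 n) : ν ∈ M4 n := by
  simp only [N0, M4, Fintype.mem_piFinset, Finset.mem_insert, Finset.mem_singleton, Finset.mem_Icc] at *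
  intro i; have := h i; omega

lemma idx_double {s : ℝ} (hs : 0 < s) (ξ : En n) : idx (2 * s) ξ ∈ N0 n ↔ idx s ξ ∈ M4 n := by
  simp only [N0, M4, Fintype.mem_piFinset, Finset.mem_insert, Finset.mem_singleton, Finset.mem_Icc, idx]
  refine forall_congr' fun i => ?_
  rw [Int.floor_eq_iff, Int.floor_eq_iff, Int.le_floor, ← Int.lt_add_one_iff, Int.floor_lt, le_div_iff₀ (by positivity),
    div_lt_iff₀ (by positivity), le_div_iff₀ (by positivity), div_lt_iff₀ (by positivity), le_div_iff₀ hs, div_lt_iff₀ hs]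
  push_cast
  constructor
  · rintro (⟨h1, h2⟩ | ⟨h1, h2⟩) <;> constructor <;> linarith
  · rintro ⟨h1, h2⟩
    rcases lt_or_ge (ξ i) 0 with h | h
    · left; constructor <;> linarith
    · right; constructor <;> linarith

lemma ind_pairs {s : ℝ} (hs : 0 < s) (P : Finset ((Fin n → ℤ) × (Fin n → ℤ))) (H : En n × En n → ℂ) (w : En n × En n) :
    ∑ p ∈ P, (Qc s p.1 ×ˢ Qc s p.2).indicator H w = if (idx s w.1, idx s w.2) ∈ P then H w else 0 := by
  rw [← Finset.sum_ite_eq P (idx s w.1, idx s w.2) fun _ => H w]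
  refine Finset.sum_congr rfl fun p _ => ?_
  rw [Set.indicator_apply]
  refine if_congr ?_ rfl rfl
  rw [Set.mem_prod, mem_Qc hs, mem_Qc hs, Prod.ext_iff]

/-- truncated frequency region -/
def EJ (n : ℕ) (J : ℕ) : Set (En n × En n) := {w | idx (2 ^ J) w.1 ∈ N0 n ∧ idx (2 ^ J) w.2 ∈ N0 n}

/-- new blocks -/
def PJ (n : ℕ) : Finset ((Fin n → ℤ) × (Fin n → ℤ)) := (M4 n ×ˢ M4 n).filter fun p => ¬ (p.1 ∈ N0 n ∧ p.2 ∈ N0 n)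

lemma EJ_succ (J : ℕ) (H : En n × En n → ℂ) (w : En n × En n) :
    (EJ n (J + 1)).indicator H w = (EJ n J).indicator H w + ∑ p ∈ PJ n, (Qc (2 ^ J) p.1 ×ˢ Qc (2 ^ J) p.2).indicator H w := by
  have hs : (0:ℝ) < 2 ^ J := by positivity
  rw [ind_pairs hs, Set.indicator_apply, Set.indicator_apply]
  simp only [EJ, PJ, Set.mem_setOf_eq, pow_succ', idx_double hs, Finset.mem_filter, Finset.mem_product]
  by_cases h1 : idx (2 ^ J) w.1 ∈ N0 n ∧ idx (2 ^ J) w.2 ∈ N0 n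
  · have h2 := N0_sub h1.1
    have h3 := N0_sub h1.2
    simp [h1, h2, h3]
  · by_cases h2 : idx (2 ^ J) w.1 ∈ M4 n ∧ idx (2 ^ J) w.2 ∈ M4 n
    · simp only [h1, h2, and_self, if_true, if_false, not_false_eq_true, zero_add]
    · simp only [h1, h2, if_false, false_and, zero_add]

lemma EJ_zero (H : En n × En n → ℂ) (w : En n × En n) :
    (EJ n 0).indicator H w = ∑ p ∈ N0 n ×ˢ N0 n, (Qc 1 p.1 ×ˢ Qc 1 p.2).indicator H w := by
  rw [ind_pairs one_pos, Set.indicator_apply]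
  simp [EJ]

lemma EJ_meas (J : ℕ) : MeasurableSet (EJ n J) := by
  have hs : (0:ℝ) < 2 ^ J := by positivity
  have : EJ n J = (⋃ ν ∈ N0 n, Qc (2 ^ J) ν) ×ˢ (⋃ ν ∈ N0 n, Qc (2 ^ J) ν) := by
    ext w
    simp only [EJ, Set.mem_setOf_eq, Set.mem_prod, Set.mem_iUnion, mem_Qc hs, exists_prop, exists_eq_right']
  rw [this]
  have h := Finset.measurableSet_biUnion (N0 n) fun ν _ => Qc_meas (n := n) (2 ^ J) ν
  exact h.prod h

lemma EJ_ev (w : En n × En n) : ∀ᶠ J in Filter.atTop, w ∈ EJ n J := by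
  have key : ∀ ξ : En n, ∀ᶠ J : ℕ in Filter.atTop, idx (2 ^ J) ξ ∈ N0 n := by
    intro ξ
    have h1 : Filter.Tendsto (fun J : ℕ => (2:ℝ) ^ J) Filter.atTop Filter.atTop := tendsto_pow_atTop_atTop_of_one_lt one_lt_two
    filter_upwards [h1.eventually_gt_atTop ‖ξ‖] with J hJ
    rw [N0_iff]
    intro hf
    have := Qc_far (by positivity : (0:ℝ) < 2 ^ J) hf ((mem_Qc (by positivity)).2 rfl)
    linarith
  filter_upwards [key w.1, key w.2] with J h1 h2
  exact ⟨h1, h2⟩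

lemma Qc_upper {s : ℝ} (hs : 0 < s) {ν : Fin n → ℤ} (h : ν ∈ M4 n) {ξ : En n} (hξ : ξ ∈ Qc s ν) : ‖ξ‖ ≤ n * (2 * s) := by
  refine norm_le_coord ξ fun i => ?_
  have h1 := hξ i
  simp only [M4, Fintype.mem_piFinset, Finset.mem_Icc] at h
  have h2 : (-2:ℝ) ≤ ν i := by exact_mod_cast (h i).1
  have h3 : (ν i : ℝ) ≤ 1 := by exact_mod_cast (h i).2
  rw [abs_le]
  constructor
  · nlinarith [h1.1]
  · nlinarith [h1.2]

end asm

section fin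
variable {n : ℕ} {a : En n → En n → En n → ℂ} {φ₁ φ₂ : En n → En n → ℝ}

lemma blk_exp {R : ℝ} (hR : 0 < R) (m ρ δ : ℝ) (n : ℕ) :
    R ^ m * Real.sqrt ((R / R ^ ρ) ^ n) * Real.sqrt ((R ^ δ / R ^ ρ) ^ n) =
      R ^ (m + n * (1 - ρ) / 2 + n * (δ - ρ) / 2) := by
  have h : ∀ t : ℝ, Real.sqrt ((R ^ t / R ^ ρ) ^ n) = R ^ ((n:ℝ) * (t - ρ) / 2) := by
    intro t
    rw [← Real.rpow_sub hR, ← Real.rpow_natCast, ← Real.rpow_mul hR.le, Real.sqrt_eq_rpow, ← Real.rpow_mul hR.le]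
    congr 1; ring
  have h1 := h 1
  rw [Real.rpow_one] at h1
  rw [h1, h δ, Real.rpow_add hR, Real.rpow_add hR]

theorem main_pos (hn : 1 ≤ n) (hφ₁ : PhiClass 2 φ₁) (hφ₂ : PhiClass 2 φ₂) (hs₁ : SNDcond φ₁) (hs₂ : SNDcond φ₂)
    {m ρ δ : ℝ} (ha : HormS2 m ρ δ a) (hρ : 0 ≤ ρ) (hρδ : ρ ≤ δ) (hδ : δ ≤ 1)
    (hm : m + n * (1 - ρ) / 2 + n * (δ - ρ) / 2 < 0) :
    ∃ C : ℝ, 0 < C ∧ ∀ F G : En n → ℂ, FG Set.univ F → FG Set.univ G →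
      eLpNorm (fun x => ∫ w, Hk a φ₁ φ₂ F G x w) 1 volume ≤
        ENNReal.ofReal C * (eLpNorm F 2 volume * eLpNorm G 2 volume) := by
  have hm0 : m ≤ 0 := by
    have h1 : (0:ℝ) ≤ n * (1 - ρ) := mul_nonneg (by positivity) (by linarith)
    have h2 : (0:ℝ) ≤ n * (δ - ρ) := mul_nonneg (by positivity) (by linarith)
    linarith
  obtain ⟨C1, hC1, hblk⟩ := blk hn hφ₁ hφ₂ hs₁ hs₂ ha hm0 hρ hρδ hδ
  obtain ⟨C0, hC0, hbd0, -⟩ := amp_cl ha hm0 hρ (hρ.trans hρδ) hδ 0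
  have hbd : ∀ x ξ η, ‖a x ξ η‖ ≤ C0 := fun x ξ η => hbd0 [] le_rfl (x, ξ, η)
  set e := m + n * (1 - ρ) / 2 + n * (δ - ρ) / 2 with he
  set r : ℝ := 2 ^ e with hr
  have hr0 : 0 < r := by positivity
  have hr1 : r < 1 := Real.rpow_lt_one_of_one_lt_of_neg one_lt_two hm
  clear_value r
  set K0 : ℝ := ((N0 n ×ˢ N0 n).card : ℝ) * C1 with hK0
  set K1 : ℝ := ((PJ n).card : ℝ) * C1 with hK1
  have hK0' : 0 ≤ K0 := by positivity
  have hK1' : 0 ≤ K1 := by positivity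
  refine ⟨K0 + K1 * (1 - r)⁻¹ + 1, by
    have : 0 < (1 - r)⁻¹ := inv_pos.2 (by linarith)
    positivity, ?_⟩
  intro F G hF hG
  -- a single block
  have hone : ∀ (J : ℕ) (ν μ : Fin n → ℤ), ν ∈ M4 n → μ ∈ M4 n → (J = 0 ∨ ¬ (ν ∈ N0 n ∧ μ ∈ N0 n)) →
      eLpNorm (fun x => ∫ w, (Qc (2 ^ J) ν ×ˢ Qc (2 ^ J) μ).indicator (Hk a φ₁ φ₂ F G x) w) 1 volume ≤
        ENNReal.ofReal (C1 * r ^ J) * (eLpNorm F 2 volume * eLpNorm G 2 volume) := by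
    intro J ν μ hν hμ hJ
    have hs : (0:ℝ) < 2 ^ J := by positivity
    have hs1 : (1:ℝ) ≤ 2 ^ J := one_le_pow₀ (by norm_num)
    have hFi := (hF.ind (Qc_meas (2 ^ J) ν)).mono Set.inter_subset_left
    have hGi := (hG.ind (Qc_meas (2 ^ J) μ)).mono Set.inter_subset_left
    have h1 := hblk (2 ^ J) hs1 ν μ (fun ξ hξ η hη => ⟨?_, ?_⟩) _ _ hFi hGi
    · rw [blk_exp hs] at h1
      have h2 : ((2:ℝ) ^ J) ^ e = r ^ J := by
        rw [hr, ← Real.rpow_natCast, ← Real.rpow_natCast, ← Real.rpow_mul (by norm_num), ← Real.rpow_mul (by norm_num), mul_comm]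
      rw [h2] at h1
      have h3 : (fun x => ∫ w, (Qc (2 ^ J) ν ×ˢ Qc (2 ^ J) μ).indicator (Hk a φ₁ φ₂ F G x) w) =
          fun x => ∫ ξ, eP φ₁ x ξ * Vb φ₂ a ((Qc (2 ^ J) μ).indicator G) [] x ξ * (Qc (2 ^ J) ν).indicator F ξ := by
        funext x
        rw [Hk_ind, Hk_nested ha hφ₁ hφ₂ hFi hGi hbd]
      rw [h3]
      refine h1.trans ?_
      gcongr
      · exact eLpNorm_indicator_le F
      · exact eLpNorm_indicator_le G
    · rcases hJ with rfl | hJ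
      · have := norm_nonneg ξ
        have := norm_nonneg η
        rw [pow_zero]; linarith
      · rw [not_and_or, N0_iff, N0_iff, not_not, not_not] at hJ
        have h3 := norm_nonneg ξ
        have h4 := norm_nonneg η
        rcases hJ with hJ | hJ
        · have := Qc_far hs hJ hξ
          linarith
        · have := Qc_far hs hJ hη
          linarith
    · have h3 := Qc_upper hs hν hξ
      have h4 := Qc_upper hs hμ hη
      linarith
  -- measurability of partial operators
  have hmeas : ∀ E : Set (En n × En n), MeasurableSet E →
      AEStronglyMeasurable (fun x => ∫ w, E.indicator (Hk a φ₁ φ₂ F G x) w) volume := by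
    intro E hE
    have h1 := (Hk_meas ha hφ₁ hφ₂ hF.meas hG.meas).indicator (MeasurableSet.univ.prod hE : MeasurableSet ((Set.univ : Set (En n)) ×ˢ E))
    have h2 := h1.stronglyMeasurable.integral_prod_right' (ν := (volume : Measure (En n × En n)))
    have h3 : (fun x => ∫ w, E.indicator (Hk a φ₁ φ₂ F G x) w) = fun x => ∫ w,
        ((Set.univ : Set (En n)) ×ˢ E).indicator (fun p : En n × (En n × En n) => Hk a φ₁ φ₂ F G p.1 p.2) (x, w) := by
      funext x; congr 1; funext w
      by_cases hw : w ∈ E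
      · rw [Set.indicator_of_mem hw, Set.indicator_of_mem (by exact ⟨trivial, hw⟩)]
      · rw [Set.indicator_of_notMem hw, Set.indicator_of_notMem (fun h => hw h.2)]
    rw [h3]
    exact h2.aestronglyMeasurable
  have hIntg : ∀ (E : Set (En n × En n)) (x : En n), MeasurableSet E →
      Integrable (E.indicator (Hk a φ₁ φ₂ F G x)) volume := fun E x hE =>
    (Hk_int ha hφ₁ hφ₂ hF hG hbd x).indicator hE
  have hQm : ∀ (s : ℝ) (p : (Fin n → ℤ) × (Fin n → ℤ)), MeasurableSet (Qc (n := n) s p.1 ×ˢ Qc (n := n) s p.2) :=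
    fun s p => (Qc_meas s p.1).prod (Qc_meas s p.2)
  set NN := eLpNorm F 2 volume * eLpNorm G 2 volume with hNN
  -- sums of blocks
  have hsum : ∀ (J : ℕ) (P : Finset ((Fin n → ℤ) × (Fin n → ℤ))),
      (∀ p ∈ P, p.1 ∈ M4 n ∧ p.2 ∈ M4 n ∧ (J = 0 ∨ ¬ (p.1 ∈ N0 n ∧ p.2 ∈ N0 n))) →
      eLpNorm (fun x => ∫ w, ∑ p ∈ P, (Qc (2 ^ J) p.1 ×ˢ Qc (2 ^ J) p.2).indicator (Hk a φ₁ φ₂ F G x) w) 1 volume ≤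
        ENNReal.ofReal ((P.card : ℝ) * C1 * r ^ J) * NN := by
    intro J P hP
    have h1 : (fun x => ∫ w, ∑ p ∈ P, (Qc (2 ^ J) p.1 ×ˢ Qc (2 ^ J) p.2).indicator (Hk a φ₁ φ₂ F G x) w) =
        ∑ p ∈ P, fun x => ∫ w, (Qc (2 ^ J) p.1 ×ˢ Qc (2 ^ J) p.2).indicator (Hk a φ₁ φ₂ F G x) w := by
      funext x
      rw [Finset.sum_apply]
      exact integral_finsetSum _ fun p _ => hIntg _ x (hQm _ p)
    rw [h1]
    refine (eLpNorm_sum_le (fun p _ => hmeas _ (hQm _ p)) le_rfl).trans ?_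
    refine (Finset.sum_le_sum fun p hp => hone J p.1 p.2 (hP p hp).1 (hP p hp).2.1 (hP p hp).2.2).trans (le_of_eq ?_)
    rw [Finset.sum_const, nsmul_eq_mul, ← mul_assoc, mul_assoc (P.card : ℝ), ENNReal.ofReal_mul (p := (P.card : ℝ)) (by positivity),
      ENNReal.ofReal_natCast]
  -- induction over dyadic scales
  have hind : ∀ J : ℕ, eLpNorm (fun x => ∫ w, (EJ n J).indicator (Hk a φ₁ φ₂ F G x) w) 1 volume ≤
      ENNReal.ofReal (K0 + K1 * ∑ j ∈ Finset.range J, r ^ j) * NN := by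
    intro J
    induction J with
    | zero =>
      have h1 := hsum 0 (N0 n ×ˢ N0 n) (fun p hp => by
        rw [Finset.mem_product] at hp
        exact ⟨N0_sub hp.1, N0_sub hp.2, Or.inl rfl⟩)
      simp only [pow_zero, mul_one] at h1
      simp only [EJ_zero, Finset.range_zero, Finset.sum_empty, mul_zero, add_zero]
      exact h1
    | succ J ih =>
      have h1 := hsum J (PJ n) (fun p hp => by
        simp only [PJ, Finset.mem_filter, Finset.mem_product] at hp
        exact ⟨hp.1.1, hp.1.2, Or.inr hp.2⟩)
      have h2 : (fun x => ∫ w, (EJ n (J + 1)).indicator (Hk a φ₁ φ₂ F G x) w) =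
          (fun x => ∫ w, (EJ n J).indicator (Hk a φ₁ φ₂ F G x) w) +
          fun x => ∫ w, ∑ p ∈ PJ n, (Qc (2 ^ J) p.1 ×ˢ Qc (2 ^ J) p.2).indicator (Hk a φ₁ φ₂ F G x) w := by
        funext x
        simp only [EJ_succ, Pi.add_apply]
        exact integral_add (hIntg _ x (EJ_meas J)) (integrable_finsetSum _ fun p _ => hIntg _ x (hQm _ p))
      have h3 : AEStronglyMeasurable (fun x => ∫ w, ∑ p ∈ PJ n, (Qc (2 ^ J) p.1 ×ˢ Qc (2 ^ J) p.2).indicator (Hk a φ₁ φ₂ F G x) w) volume := by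
        have : (fun x => ∫ w, ∑ p ∈ PJ n, (Qc (2 ^ J) p.1 ×ˢ Qc (2 ^ J) p.2).indicator (Hk a φ₁ φ₂ F G x) w) =
            fun x => ∑ p ∈ PJ n, ∫ w, (Qc (2 ^ J) p.1 ×ˢ Qc (2 ^ J) p.2).indicator (Hk a φ₁ φ₂ F G x) w := by
          funext x
          exact integral_finsetSum _ fun p _ => hIntg _ x (hQm _ p)
        rw [this]
        exact Finset.aestronglyMeasurable_fun_sum _ fun p _ => hmeas _ (hQm _ p)
      rw [h2]
      refine (eLpNorm_add_le (hmeas _ (EJ_meas J)) h3 le_rfl).trans ((add_le_add ih h1).trans (le_of_eq ?_))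
      rw [← add_mul, ← ENNReal.ofReal_add (by positivity) (by positivity), Finset.sum_range_succ]
      congr 2
      rw [hK1]; ring
  refine fatou_one (f := fun J x => ∫ w, (EJ n J).indicator (Hk a φ₁ φ₂ F G x) w) (fun J => hmeas _ (EJ_meas J)) ?_ ?_
  · intro x
    refine tendsto_integral_of_dominated_convergence (fun w => ‖Hk a φ₁ φ₂ F G x w‖)
      (fun J => (hIntg _ x (EJ_meas J)).aestronglyMeasurable) (Hk_int ha hφ₁ hφ₂ hF hG hbd x).norm
      (fun J => Filter.Eventually.of_forall fun w => norm_indicator_le_norm_self _ _) (Filter.Eventually.of_forall fun w => ?_)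
    refine tendsto_const_nhds.congr' ?_
    filter_upwards [EJ_ev w] with J hJ
    rw [Set.indicator_of_mem hJ]
  · intro J
    refine (hind J).trans (mul_le_mul_left (ENNReal.ofReal_le_ofReal ?_) NN)
    have h1 : ∑ j ∈ Finset.range J, r ^ j ≤ (1 - r)⁻¹ := by
      rw [← tsum_geometric_of_lt_one hr0.le hr1]
      exact (summable_geometric_of_lt_one hr0.le hr1).sum_le_tsum _ fun _ _ => by positivity
    have := mul_le_mul_of_nonneg_left h1 hK1'
    linarith

lemma Horm_mono {m ρ δ δ' : ℝ} (h : δ ≤ δ') (ha : HormS2 m ρ δ a) : HormS2 m ρ δ' a := by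
  refine ⟨ha.1, fun β α₁ α₂ => ?_⟩
  obtain ⟨C, hC⟩ := ha.2 β α₁ α₂
  refine ⟨|C|, fun x ξ η => (hC x ξ η).trans ?_⟩
  have h1 : (1:ℝ) ≤ 1 + ‖ξ‖ + ‖η‖ := by
    have := norm_nonneg ξ
    have := norm_nonneg η
    linarith
  refine mul_le_mul (le_abs_self C) (Real.rpow_le_rpow_of_exponent_le h1 ?_) (by positivity) (abs_nonneg _)
  have : δ * (mdeg β : ℝ) ≤ δ' * mdeg β := mul_le_mul_of_nonneg_right h (by positivity)
  linarith

lemma ft_FG (f : 𝓢(En n, ℂ)) : FG Set.univ (ft (⇑f)) :=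
  ⟨(ft_cont f).measurable, ft_int f, ft_memLp f, fun ξ h => (h trivial).elim⟩

lemma case_zero (a : En 0 → En 0 → En 0 → ℂ) (φ₁ φ₂ : En 0 → En 0 → ℝ) :
    ∃ C : ℝ, 0 < C ∧ ∀ f g : 𝓢(En 0, ℂ),
      eLpNorm (bfio a φ₁ φ₂ (⇑f) (⇑g)) 1 volume ≤
        ENNReal.ofReal C * eLpNorm (⇑f) 2 volume * eLpNorm (⇑g) 2 volume := by
  have hv : (volume : Measure (En 0)) = Measure.dirac 0 := by
    have h1 := (EuclideanSpace.volume_preserving_symm_measurableEquiv_toLp (Fin 0)).symm.map_eq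
    rw [← h1, volume_pi, Measure.pi_of_empty, Measure.map_dirac' (by fun_prop)]
    congr 1
    exact Subsingleton.elim _ _
  have hft : ∀ f : En 0 → ℂ, ∀ ξ, ft f ξ = f 0 := by
    intro f ξ
    unfold ft
    rw [hv, integral_dirac]
    have : ξ = 0 := Subsingleton.elim _ _
    simp [this]
  have hn : ∀ (f : En 0 → ℂ) (p : ℝ≥0∞), p ≠ 0 → eLpNorm f p volume = ‖f 0‖ₑ := by
    intro f p hp
    have : f = fun _ => f 0 := by
      funext x; congr 1; exact Subsingleton.elim _ _
    rw [this, eLpNorm_const _ hp (by rw [hv]; exact NeZero.ne _), hv]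
    simp
  refine ⟨‖a 0 0 0‖ + 1, by positivity, fun f g => ?_⟩
  rw [hn _ 1 one_ne_zero, hn _ 2 two_ne_zero, hn _ 2 two_ne_zero]
  have hb : bfio a φ₁ φ₂ f g 0 = a 0 0 0 * Complex.exp (Complex.I * Complex.ofReal (φ₁ 0 0 + φ₂ 0 0)) * f 0 * g 0 := by
    unfold bfio
    rw [show (volume : Measure (En 0 × En 0)) = (volume : Measure (En 0)).prod volume from rfl, hv, Measure.dirac_prod_dirac,
      integral_dirac]
    simp only [hft]
  have he : ‖Complex.exp (Complex.I * Complex.ofReal (φ₁ 0 0 + φ₂ 0 0))‖ₑ = 1 := by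
    rw [← ofReal_norm, mul_comm, Complex.norm_exp_ofReal_mul_I, ENNReal.ofReal_one]
  rw [hb, enorm_mul, enorm_mul, enorm_mul, he, mul_one]
  gcongr
  rw [← ofReal_norm]
  exact ENNReal.ofReal_le_ofReal (by linarith)

end fin

/-- Theorem 5.16, second part: global `L²×L²→L¹` boundedness of
smooth bilinear FIOs. -/
theorem statement16 {n : ℕ}
    (φ₁ φ₂ : En n → En n → ℝ) (hφ₁ : PhiClass 2 φ₁) (hφ₂ : PhiClass 2 φ₂)
    (hs₁ : SNDcond φ₁) (hs₂ : SNDcond φ₂)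
    (m ρ δ : ℝ) (hρ0 : 0 ≤ ρ) (hρ1 : ρ ≤ 1) (hδ0 : 0 ≤ δ) (hδ1 : δ ≤ 1)
    (hm : m < (n : ℝ) * (ρ - 1) / 2 + (n : ℝ) * min (ρ - δ) 0 / 2)
    (a : En n → En n → En n → ℂ) (ha : HormS2 m ρ δ a) :
    ∃ C : ℝ, 0 < C ∧ ∀ f g : 𝓢(En n, ℂ),
      eLpNorm (bfio a φ₁ φ₂ (⇑f) (⇑g)) 1 volume ≤
        ENNReal.ofReal C * eLpNorm (⇑f) 2 volume * eLpNorm (⇑g) 2 volume := by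
  rcases Nat.eq_zero_or_pos n with rfl | hn
  · exact case_zero a φ₁ φ₂
  have hmin : min (ρ - δ) 0 = ρ - max δ ρ := by
    rcases le_total δ ρ with h | h
    · rw [max_eq_right h, min_eq_right (by linarith)]; ring
    · rw [max_eq_left h, min_eq_left (by linarith)]
  obtain ⟨C, hC, hmain⟩ := main_pos (δ := max δ ρ) hn hφ₁ hφ₂ hs₁ hs₂ (Horm_mono (le_max_left _ _) ha) hρ0 (le_max_right _ _)
    (max_le hδ1 hρ1) (by rw [hmin] at hm; linarith)
  refine ⟨C * (2 * π) ^ n, by positivity, fun f g => ?_⟩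
  have h1 := hmain _ _ (ft_FG f) (ft_FG g)
  rw [ft_norm, ft_norm] at h1
  refine (show eLpNorm (bfio a φ₁ φ₂ (⇑f) (⇑g)) 1 volume ≤ _ from h1).trans (le_of_eq ?_)
  have h2 : cPl n ^ (1/2 : ℝ) * cPl n ^ (1/2 : ℝ) = ENNReal.ofReal ((2 * π) ^ n) := by
    rw [← ENNReal.rpow_add_of_nonneg _ _ (by norm_num) (by norm_num)]
    norm_num [cPl]
  rw [ENNReal.ofReal_mul (p := C) hC.le, ← h2]
  ring
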